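/- arXiv:2202.11517 — 2 statements merged into one kernel-verified Lean document; each statement's English description precedes it below -/
import Mathlib

section
/- Let f be a homeomorphism of the closed annulus A = (ℝ/ℤ) × [0,1] that is isotopic to the identity, preserves a finite area, and is reversible. If f has at least one periodic point (some z and k ≥ 1 with f^[k](z) = z), then the set of symmetric periodic points of f is infinite (in particular f has infinitely many symmetric periodic orbits). -/
open MeasureTheory Filter Topology

/-- The circle `ℝ/ℤ`. -/
abbrev Circle1 : Type := AddCircle (1 : ℝ)

/-- The closed annulus `(ℝ/ℤ) × [0,1]`. -/
abbrev AnnC : Type := Circle1 × ↥(Set.Icc (0 : ℝ) 1)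

/-- The reflection `R(θ, y) = (−θ, y)` of the closed annulus. -/
noncomputable def RC : AnnC → AnnC := fun z => (-z.1, z.2)

/-- `f` is isotopic to the identity. -/
def IsotopicToIdC (f : AnnC → AnnC) : Prop :=
  ∃ H : ↥(Set.Icc (0 : ℝ) 1) × AnnC → AnnC, Continuous H ∧
    (∀ z, H (⟨0, by norm_num⟩, z) = z) ∧
    (∀ z, H (⟨1, by norm_num⟩, z) = f z) ∧
    (∀ t, ∃ g : AnnC ≃ₜ AnnC, ∀ z, H (t, z) = g z)

/-- `f` preserves a finite area: a finite Borel measure, without atoms,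
positive on nonempty open sets. -/
def PreservesFiniteAreaC (f : AnnC → AnnC) : Prop :=
  ∃ μ : Measure AnnC, μ Set.univ < ⊤ ∧ (∀ z, μ {z} = 0) ∧
    (∀ U : Set AnnC, IsOpen U → U.Nonempty → 0 < μ U) ∧
    MeasurePreserving f μ μ

namespace FranksRev

open unitInterval

/-- A nonvanishing continuous function on the square has a continuous logarithm. -/
lemma exists_log (u : I × I → ℂ) (hu : Continuous u) (h0 : ∀ p, u p ≠ 0) :
    ∃ U : I × I → ℂ, Continuous U ∧ ∀ p, Complex.exp (U p) = u p := by
  let pr : ℝ × ℝ → I × I := fun p =>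
    (Set.projIcc 0 1 zero_le_one p.1, Set.projIcc 0 1 zero_le_one p.2)
  have hpr : Continuous pr := by
    have := continuous_projIcc (a := (0:ℝ)) (b := 1) (h := zero_le_one)
    exact (this.comp continuous_fst).prodMk (this.comp continuous_snd)
  let f : C(ℝ × ℝ, ℂ) := ⟨u ∘ pr, hu.comp hpr⟩
  obtain ⟨F, ⟨_, hF⟩, _⟩ := Complex.isCoveringMapOn_exp.existsUnique_continuousMap_lifts f
    (a₀ := (0, 0)) (e₀ := Complex.log (f (0, 0))) (Complex.exp_log (h0 _)) (fun a => h0 _)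
  refine ⟨fun p => F (p.1, p.2), by fun_prop, fun p => ?_⟩
  have h := congrFun hF ((p.1 : ℝ), (p.2 : ℝ))
  simp only [Function.comp_apply] at h
  rw [h]
  simp [f, pr]

/-- A continuous function on the interval with constant exponential is constant. -/
lemma const_of_exp (w : I → ℂ) (hw : Continuous w) (c : ℂ) (h : ∀ s, Complex.exp (w s) = c) :
    w 1 = w 0 := by
  have := Complex.isCoveringMap_exp.eq_of_comp_eq (g₁ := w) (g₂ := fun _ => w 0) hw
    continuous_const (by ext s; simp [h]) 0 rfl
  rw [this]

lemma lift_diff (U : I → ℂ) (hU : Continuous U) (k : ℂ) (hk : k ≠ 0)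
    (h : ∀ s, k * Complex.exp (U s) ∈ Complex.slitPlane) :
    U 1 - U 0 = Complex.log (k * Complex.exp (U 1)) - Complex.log (k * Complex.exp (U 0)) := by
  have := const_of_exp (fun s => U s - Complex.log (k * Complex.exp (U s)))
    (hU.sub (Continuous.clog (by fun_prop) h)) k⁻¹ (fun s => by
      rw [Complex.exp_sub, Complex.exp_log (Complex.slitPlane_ne_zero (h s))]
      field_simp)
  linear_combination this

/-- The basic winding number lemma. -/
lemma winding (u v : I × I → ℂ) (hu : Continuous u) (hv : Continuous v)
    (u0 : ∀ p, u p ≠ 0) (v0 : ∀ p, v p ≠ 0)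
    (e0 : ∀ t, u (0, t) = v (0, t)) (e1 : ∀ t, u (1, t) = v (1, t))
    (k : ℂ) (hk : k ≠ 0)
    (hku : ∀ s, k * u (s, 1) ∈ Complex.slitPlane) (hkv : ∀ s, k * v (s, 1) ∈ Complex.slitPlane)
    (hur : ∀ s, 0 ≤ (u (s, 0)).re) (hvr : ∀ s, (v (s, 0)).re ≤ 0)
    (h0 : (u (0, 0)).im < 0) (h1 : 0 < (u (1, 0)).im) : False := by
  obtain ⟨U, hU, hUe⟩ := exists_log u hu u0
  obtain ⟨V, hV, hVe⟩ := exists_log v hv v0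
  have d0 : U (0, 1) - V (0, 1) = U (0, 0) - V (0, 0) :=
    const_of_exp (fun t => U (0, t) - V (0, t)) (by fun_prop) 1 (fun t => by
      rw [Complex.exp_sub, hUe, hVe, e0, div_self (v0 _)])
  have d1 : U (1, 1) - V (1, 1) = U (1, 0) - V (1, 0) :=
    const_of_exp (fun t => U (1, t) - V (1, t)) (by fun_prop) 1 (fun t => by
      rw [Complex.exp_sub, hUe, hVe, e1, div_self (v0 _)])
  have a1 := lift_diff (fun s => U (s, 1)) (by fun_prop) k hk (fun s => by rw [hUe]; exact hku s)
  have a2 := lift_diff (fun s => V (s, 1)) (by fun_prop) k hk (fun s => by rw [hVe]; exact hkv s)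
  have a3 := lift_diff (fun s => U (s, 0)) (by fun_prop) 1 one_ne_zero (fun s => by
    rw [hUe, one_mul, Complex.mem_slitPlane_iff]
    by_contra hc
    push Not at hc
    exact u0 (s, 0) (Complex.ext (le_antisymm hc.1 (hur s)) hc.2))
  have a4 := lift_diff (fun s => V (s, 0)) (by fun_prop) (-1) (by norm_num) (fun s => by
    rw [hVe, neg_one_mul, Complex.mem_slitPlane_iff]
    by_contra hc
    push Not at hc
    simp only [Complex.neg_re, Complex.neg_im] at hc
    exact v0 (s, 0) (Complex.ext (le_antisymm (hvr s) (by simpa using hc.1)) (by simpa using hc.2)))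
  simp only [hUe, hVe, one_mul, neg_one_mul, e0, e1] at a1 a2 a3 a4
  have key : Complex.log (v (1, 0)) - Complex.log (v (0, 0))
      = Complex.log (-v (1, 0)) - Complex.log (-v (0, 0)) := by
    linear_combination a4 - a3 + a1 - a2 - d1 + d0
  have r0 : (v (0, 0)).re = 0 := le_antisymm (hvr 0) (by rw [← e0]; exact hur 0)
  have r1 : (v (1, 0)).re = 0 := le_antisymm (hvr 1) (by rw [← e1]; exact hur 1)
  rw [e0] at h0
  rw [e1] at h1
  have key2 := congrArg Complex.im key
  simp only [Complex.sub_im, Complex.log_im] at key2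
  rw [Complex.arg_eq_pi_div_two_iff.2 ⟨r1, h1⟩, Complex.arg_eq_neg_pi_div_two_iff.2 ⟨r0, h0⟩,
    Complex.arg_eq_neg_pi_div_two_iff.2 ⟨by simp [r1], by simpa using h1⟩,
    Complex.arg_eq_pi_div_two_iff.2 ⟨by simp [r0], by simpa using h0⟩] at key2
  linarith [Real.pi_pos]


/-- The strip, universal cover of the annulus. -/
abbrev St : Type := ℝ × I

/-- Embedding of the strip in the complex plane. -/
def toC (w : St) : ℂ := ⟨w.1, w.2⟩

lemma continuous_toC : Continuous toC := by
  have : toC = fun w : St => ((w.1 : ℝ) : ℂ) + ((w.2 : ℝ) : ℂ) * Complex.I := by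
    ext w
    exact Complex.mk_eq_add_mul_I _ _
  rw [this]
  fun_prop

lemma toC_inj {a b : St} (h : toC a = toC b) : a = b := by
  have h1 := congrArg Complex.re h
  have h2 := congrArg Complex.im h
  exact Prod.ext h1 (Subtype.ext h2)

/-- Affine interpolation in the interval. -/
def lerpI (t a b : I) : I :=
  ⟨(1 - (t : ℝ)) * a + t * b, by
    have := t.2; have := a.2; have := b.2
    simp only [Set.mem_Icc] at *
    constructor
    · have := mul_nonneg (sub_nonneg.2 t.2.2) a.2.1
      have := mul_nonneg t.2.1 b.2.1
      linarith
    · have := mul_le_mul_of_nonneg_left a.2.2 (sub_nonneg.2 t.2.2)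
      have := mul_le_mul_of_nonneg_left b.2.2 t.2.1
      linarith⟩

/-- Affine interpolation in the strip. -/
def lerpS (t : I) (a b : St) : St := ((1 - (t : ℝ)) * a.1 + t * b.1, lerpI t a.2 b.2)

lemma continuous_lerpI {X : Type*} [TopologicalSpace X] {t a b : X → I} (ht : Continuous t)
    (ha : Continuous a) (hb : Continuous b) : Continuous fun x => lerpI (t x) (a x) (b x) := by
  unfold lerpI
  fun_prop

lemma continuous_lerpS {X : Type*} [TopologicalSpace X] {t : X → I} {a b : X → St}
    (ht : Continuous t)
    (ha : Continuous a) (hb : Continuous b) : Continuous fun x => lerpS (t x) (a x) (b x) := by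
  unfold lerpS
  exact Continuous.prodMk (by fun_prop) (continuous_lerpI ht (by fun_prop) (by fun_prop))

@[simp] lemma lerpI_zero (a b : I) : lerpI 0 a b = a := by ext; simp [lerpI]
@[simp] lemma lerpI_one (a b : I) : lerpI 1 a b = b := by ext; simp [lerpI]
@[simp] lemma lerpS_zero (a b : St) : lerpS 0 a b = a := by ext <;> simp [lerpS]
@[simp] lemma lerpS_one (a b : St) : lerpS 1 a b = b := by ext <;> simp [lerpS]

/-- Half circles around a point of the strip. -/
noncomputable def circ (p : St) (r : ℝ) (s : I) : St :=
  (p.1 + r * Real.sin (Real.pi * s), ⟨p.2 - min (p.2 : ℝ) (1 - p.2) * Real.cos (Real.pi * s), by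
    have h1 := min_le_left (p.2 : ℝ) (1 - p.2)
    have h2 := min_le_right (p.2 : ℝ) (1 - p.2)
    have h3 : 0 ≤ min (p.2 : ℝ) (1 - p.2) := le_min p.2.2.1 (sub_nonneg.2 p.2.2.2)
    have h4 := Real.abs_cos_le_one (Real.pi * s)
    rw [abs_le] at h4
    constructor
    · have := mul_le_mul_of_nonneg_left h4.2 h3
      linarith
    · have := mul_le_mul_of_nonneg_left h4.1 h3
      linarith⟩)

lemma continuous_circ (p : St) (r : ℝ) : Continuous (circ p r) := by
  unfold circ
  fun_prop

lemma circ_ne (p : St) (r : ℝ) (hr : r ≠ 0) (h0 : (p.2 : ℝ) ≠ 0) (h1 : (p.2 : ℝ) ≠ 1) (s : I) :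
    circ p r s ≠ p := by
  intro h
  have ha := congrArg Prod.fst h
  have hb := congrArg (fun w : St => (w.2 : ℝ)) h
  simp only [circ] at ha hb
  have h3 : 0 < min (p.2 : ℝ) (1 - p.2) :=
    lt_min (lt_of_le_of_ne p.2.2.1 (Ne.symm h0)) (sub_pos.2 (lt_of_le_of_ne p.2.2.2 h1))
  have hs : Real.sin (Real.pi * s) = 0 := by
    have : r * Real.sin (Real.pi * s) = 0 := by linarith
    simpa [hr] using this
  have hc : Real.cos (Real.pi * s) = 0 := by
    have : min (p.2 : ℝ) (1 - p.2) * Real.cos (Real.pi * s) = 0 := by linarith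
    simpa [h3.ne'] using this
  have := Real.sin_sq_add_cos_sq (Real.pi * s)
  rw [hs, hc] at this
  norm_num at this

/-- A homeomorphism of the strip maps interior points to interior points. -/
lemma interior_pres (K : St ≃ₜ St) (p : St) (h0 : (p.2 : ℝ) ≠ 0) (h1 : (p.2 : ℝ) ≠ 1)
    (hb : (K p).2 = 0 ∨ (K p).2 = 1) : False := by
  -- the point of the boundary opposite to `K p`
  obtain ⟨c, hc⟩ : ∃ c : St, ∀ (t : I) (w : St), w ≠ K p → lerpS t w c ≠ K p := by
    rcases hb with hb | hb
    · refine ⟨(0, 1), fun t w hw h => ?_⟩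
      have h2 := congrArg (fun w : St => (w.2 : ℝ)) h
      simp only [hb, lerpS, lerpI] at h2
      norm_num at h2
      have i1 := mul_nonneg (sub_nonneg.2 t.2.2) w.2.2.1
      have i2 := t.2.1
      have : t = 0 := Subtype.ext (show (t : ℝ) = 0 by linarith)
      rw [this, lerpS_zero] at h
      exact hw h
    · refine ⟨(0, 0), fun t w hw h => ?_⟩
      have h2 := congrArg (fun w : St => (w.2 : ℝ)) h
      simp only [hb, lerpS, lerpI] at h2
      norm_num at h2
      have i1 := mul_le_mul_of_nonneg_left w.2.2.2 (sub_nonneg.2 t.2.2)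
      have i2 := t.2.1
      have : t = 0 := Subtype.ext (show (t : ℝ) = 0 by linarith)
      rw [this, lerpS_zero] at h
      exact hw h
  have hne : ∀ (r : ℝ), r ≠ 0 → ∀ q : I × I,
      toC (K.symm (lerpS q.2 (K (circ p r q.1)) c)) - toC p ≠ 0 := by
    intro r hr q h
    have h2 := toC_inj (sub_eq_zero.1 h)
    rw [Homeomorph.symm_apply_eq] at h2
    exact hc _ _ (fun h3 => circ_ne p r hr h0 h1 _ (K.injective h3)) h2
  have hcont : ∀ r : ℝ, Continuous fun q : I × I =>
      toC (K.symm (lerpS q.2 (K (circ p r q.1)) c)) - toC p := by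
    intro r
    refine (continuous_toC.comp (K.symm.continuous.comp (continuous_lerpS (by fun_prop)
      (K.continuous.comp ((continuous_circ p r).comp (by fun_prop))) (by fun_prop)))).sub
      continuous_const
  have e0 : circ p 1 0 = circ p (-1) 0 := by ext <;> simp [circ]
  have e1 : circ p 1 1 = circ p (-1) 1 := by ext <;> simp [circ]
  have hk : toC (K.symm c) - toC p ≠ 0 := by
    have := hne 1 one_ne_zero (0, 1)
    simpa using this
  have h3 : 0 < min (p.2 : ℝ) (1 - p.2) :=
    lt_min (lt_of_le_of_ne p.2.2.1 (Ne.symm h0)) (sub_pos.2 (lt_of_le_of_ne p.2.2.2 h1))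
  have hsin : ∀ s : I, 0 ≤ Real.sin (Real.pi * s) := fun s =>
    Real.sin_nonneg_of_nonneg_of_le_pi (mul_nonneg Real.pi_pos.le s.2.1)
      (by have := mul_le_mul_of_nonneg_left s.2.2 Real.pi_pos.le; linarith)
  refine winding _ _ (hcont 1) (hcont (-1)) (hne 1 (by norm_num)) (hne (-1) (by norm_num))
    (fun t => by simp only [e0]) (fun t => by simp only [e1])
    (toC (K.symm c) - toC p)⁻¹ (inv_ne_zero hk) (fun s => ?_) (fun s => ?_) (fun s => ?_)
    (fun s => ?_) ?_ ?_
  · simp [inv_mul_cancel₀ hk]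
  · simp [inv_mul_cancel₀ hk]
  · simpa [toC, circ] using hsin s
  · simpa [toC, circ] using hsin s
  · simpa [toC, circ] using h3
  · simpa [toC, circ] using h3


/-- Reflection of the strip. -/
def RS : St ≃ₜ St := (Homeomorph.neg ℝ).prodCongr (Homeomorph.refl I)

/-- Unit translation of the strip. -/
def TS : St ≃ₜ St := (Homeomorph.addRight (1 : ℝ)).prodCongr (Homeomorph.refl I)

lemma RS_apply (w : St) : RS w = (-w.1, w.2) := rfl
lemma TS_apply (w : St) : TS w = (w.1 + 1, w.2) := rfl

lemma RS_mul_RS : RS * RS = 1 := by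
  ext w <;> simp [RS_apply]

/-- The situation to be excluded. -/
structure Core (K : St ≃ₜ St) (M : ℝ) : Prop where
  rev : RS * K * RS = K⁻¹
  disp : ∃ D : ℝ, ∀ w, |(K w).1 - w.1| ≤ D
  bot : ∀ x, (K (x, 0)).2 = 0
  botmono : StrictMono fun x : ℝ => (K (x, 0)).1
  top : ∀ x, (K (x, 1)).2 = 1
  topmono : StrictMono fun x : ℝ => (K (x, 1)).1
  bdd : ∀ (n : ℕ) (y : I), |((K ^ n) (0, y)).1| ≤ M
  fin : {y : I | K (0, y) = (0, y)}.Finite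
  ret : ∀ (n : ℕ) (y : I), 1 ≤ n → ((K ^ n) (0, y)).1 = 0 → K (0, y) = (0, y)

lemma rev_pow {K : St ≃ₜ St} (h : RS * K * RS = K⁻¹) (n : ℕ) : RS * K ^ n * RS = (K ^ n)⁻¹ := by
  have hR : RS⁻¹ = RS := inv_eq_of_mul_eq_one_left RS_mul_RS
  have : RS * K ^ n * RS⁻¹ = (RS * K * RS⁻¹) ^ n := conj_pow.symm
  rw [hR, h] at this
  rw [this, inv_pow]

lemma inv_pow_axis {K : St ≃ₜ St} (h : RS * K * RS = K⁻¹) (n : ℕ) (y : I) :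
    (K ^ n)⁻¹ (0, y) = (-((K ^ n) (0, y)).1, ((K ^ n) (0, y)).2) := by
  rw [← rev_pow h]
  simp [RS_apply]

lemma inv_axis {K : St ≃ₜ St} (h : RS * K * RS = K⁻¹) (y : I) :
    K⁻¹ (0, y) = (-(K (0, y)).1, (K (0, y)).2) := by
  simpa using inv_pow_axis h 1 y

lemma Core.inv {K : St ≃ₜ St} {M : ℝ} (h : Core K M) : Core K⁻¹ M := by
  have hinv : ∀ w : St, K⁻¹ w = (-(K (-w.1, w.2)).1, (K (-w.1, w.2)).2) := by
    intro w
    rw [← h.rev]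
    simp [RS_apply]
  refine ⟨?_, ?_, ?_, ?_, ?_, ?_, ?_, ?_, ?_⟩
  · have := rev_pow h.rev 1
    rw [inv_inv, ← h.rev]
    calc RS * (RS * K * RS) * RS = (RS * RS) * K * (RS * RS) := by group
      _ = K := by rw [RS_mul_RS]; simp
  · obtain ⟨D, hD⟩ := h.disp
    refine ⟨D, fun w => ?_⟩
    have := hD (K⁻¹ w)
    rw [← Homeomorph.mul_apply, mul_inv_cancel, Homeomorph.one_apply, abs_sub_comm] at this
    exact this
  · intro x
    rw [hinv]; exact h.bot _
  · intro x y hxy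
    simp only [hinv]
    exact neg_lt_neg (h.botmono (neg_lt_neg hxy))
  · intro x
    rw [hinv]; exact h.top _
  · intro x y hxy
    simp only [hinv]
    exact neg_lt_neg (h.topmono (neg_lt_neg hxy))
  · intro n y
    rw [inv_pow, inv_pow_axis h.rev]
    simpa using h.bdd n y
  · refine h.fin.subset fun y hy => ?_
    have hy' : K⁻¹ (0, y) = (0, y) := hy
    have := congrArg K hy'
    rw [← Homeomorph.mul_apply, mul_inv_cancel, Homeomorph.one_apply] at this
    exact this.symm
  · intro n y hn h0
    rw [inv_pow, inv_pow_axis h.rev] at h0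
    have h1 := h.ret n y hn (by simpa using h0)
    rw [inv_axis h.rev, h1]
    simp

/-- A nonvanishing function on a segment does not change sign. -/
lemma sign_seg (g : I → ℝ) (hg : Continuous g) (a b : I)
    (h : ∀ s, g (lerpI s a b) ≠ 0) (ha : 0 < g a) : 0 < g b := by
  by_contra hb
  push Not at hb
  obtain ⟨s, hs⟩ := mem_range_of_exists_le_of_exists_ge (f := fun s => g (lerpI s a b))
    (hg.comp (continuous_lerpI continuous_id continuous_const continuous_const))
    (c := 0) ⟨1, by simpa using hb⟩ ⟨0, by simpa using ha.le⟩
  exact h s hs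

lemma lerpI_mem (s a b : I) (hab : a ≤ b) : a ≤ lerpI s a b ∧ lerpI s a b ≤ b := by
  have hab' : (a : ℝ) ≤ b := hab
  have h1 := mul_nonneg s.2.1 (sub_nonneg.2 hab')
  have h2 := mul_nonneg (sub_nonneg.2 s.2.2) (sub_nonneg.2 hab')
  constructor
  · show (a : ℝ) ≤ (1 - (s : ℝ)) * a + s * b
    linarith
  · show (1 - (s : ℝ)) * a + s * b ≤ (b : ℝ)
    linarith

lemma lerpI_mem' (s a b : I) (hab : b ≤ a) : b ≤ lerpI s a b ∧ lerpI s a b ≤ a := by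
  have hab' : (b : ℝ) ≤ a := hab
  have h1 := mul_nonneg s.2.1 (sub_nonneg.2 hab')
  have h2 := mul_nonneg (sub_nonneg.2 s.2.2) (sub_nonneg.2 hab')
  constructor
  · show (b : ℝ) ≤ (1 - (s : ℝ)) * a + s * b
    linarith
  · show (1 - (s : ℝ)) * a + s * b ≤ (a : ℝ)
    linarith

lemma Core.nz {K : St ≃ₜ St} {M : ℝ} (h : Core K M) {y : I} (hy : K (0, y) ≠ (0, y)) {n : ℕ}
    (hn : 1 ≤ n) : ((K ^ n) (0, y)).1 ≠ 0 := fun h0 => hy (h.ret n y hn h0)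

lemma Core.cont {K : St ≃ₜ St} (n : ℕ) : Continuous fun y : I => ((K ^ n) (0, y)).1 := by
  have := (K ^ n).continuous
  fun_prop

/-- the edge case: the boundary end of the axis is in the same arc. -/
lemma Core.pos_edge {K : St ≃ₜ St} {M : ℝ} (h : Core K M) (e : I)
    (he : ∀ x, (K (x, e)).2 = e) (hm : StrictMono fun x : ℝ => (K (x, e)).1)
    (y : I) (hy : 0 < (K (0, y)).1)
    (hf : ∀ s, K (0, lerpI s e y) ≠ (0, lerpI s e y)) (hf' : ∀ s, K (0, lerpI s y e) ≠ (0, lerpI s y e)) (n : ℕ) (hn : 1 ≤ n) :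
    0 < ((K ^ n) (0, y)).1 := by
  have h0 : 0 < (K (0, e)).1 := by
    have := sign_seg (fun y => ((K ^ 1) (0, y)).1) (Core.cont 1) y e
      (fun s => h.nz (hf' s) le_rfl) (by simpa using hy)
    simpa using this
  have h1 : ∀ n : ℕ, 1 ≤ n → 0 < ((K ^ n) (0, e)).1 ∧ ((K ^ n) (0, e)).2 = e := by
    intro n hn
    induction n, hn using Nat.le_induction with
    | base => simpa using ⟨h0, he 0⟩
    | succ n hn ih =>
      have h2 : (K ^ n) (0, e) = (((K ^ n) (0, e)).1, e) := Prod.ext rfl ih.2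
      rw [pow_succ', Homeomorph.mul_apply, h2]
      exact ⟨lt_trans h0 (hm ih.1), he _⟩
  exact sign_seg (fun y => ((K ^ n) (0, y)).1) (Core.cont n) e y
      (fun s => h.nz (hf s) hn) (h1 n hn).1

lemma K_inv_apply (K : St ≃ₜ St) (w : St) : K (K⁻¹ w) = w := K.apply_symm_apply w
lemma inv_K_apply (K : St ≃ₜ St) (w : St) : K⁻¹ (K w) = w := K.symm_apply_apply w

/-- the Jordan curve type argument. -/
lemma Core.pos_mid {K : St ≃ₜ St} {M : ℝ} (h : Core K M) (a b y : I)
    (hay : a < y) (hyb : y < b) (ha : K (0, a) = (0, a)) (hb : K (0, b) = (0, b))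
    (hf : ∀ y', a < y' → y' < b → K (0, y') ≠ (0, y'))
    (hy : 0 < (K (0, y)).1) (n : ℕ) (hn : 1 ≤ n) (hyn : 0 < ((K ^ n) (0, y)).1) :
    0 < ((K ^ (n + 1)) (0, y)).1 := by
  have hpa : ∀ m : ℕ, (K ^ m) (0, a) = (0, a) := by
    intro m
    induction m with
    | zero => simp
    | succ m ih => rw [pow_succ', Homeomorph.mul_apply, ih, ha]
  have hpb : ∀ m : ℕ, (K ^ m) (0, b) = (0, b) := by
    intro m
    induction m with
    | zero => simp
    | succ m ih => rw [pow_succ', Homeomorph.mul_apply, ih, hb]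
  have hin : ∀ y', a < y' → y' < b → ∀ s, K (0, lerpI s y y') ≠ (0, lerpI s y y') := by
    intro y' h1 h2 s
    rcases le_total y y' with h3 | h3
    · have := lerpI_mem s y y' h3
      exact hf _ (hay.trans_le this.1) (this.2.trans_lt h2)
    · have := lerpI_mem' s y y' h3
      exact hf _ (h1.trans_le this.1) (this.2.trans_lt hyb)
  have hpos : ∀ m : ℕ, 1 ≤ m → 0 < ((K ^ m) (0, y)).1 → ∀ y', a ≤ y' → y' ≤ b →
      0 ≤ ((K ^ m) (0, y')).1 := by
    intro m hm hp y' h1 h2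
    rcases h1.eq_or_lt with rfl | h1
    · rw [hpa]
    rcases h2.eq_or_lt with rfl | h2
    · rw [hpb]
    exact (sign_seg (fun y => ((K ^ m) (0, y)).1) (Core.cont m) y y'
      (fun s => h.nz (hin y' h1 h2 s) hm) hp).le
  have hneg : ∀ m : ℕ, 1 ≤ m → ((K ^ m) (0, y)).1 < 0 → ∀ y', a ≤ y' → y' ≤ b →
      ((K ^ m) (0, y')).1 ≤ 0 := by
    intro m hm hp y' h1 h2
    rcases h1.eq_or_lt with rfl | h1
    · rw [hpa]
    rcases h2.eq_or_lt with rfl | h2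
    · rw [hpb]
    have := (sign_seg (fun y => -((K ^ m) (0, y)).1) (Core.cont m).neg y y'
      (fun s => neg_ne_zero.2 (h.nz (hin y' h1 h2 s) hm)) (neg_pos.2 hp)).le
    linarith
  by_contra hcon
  have hlt : ((K ^ (n + 1)) (0, y)).1 < 0 :=
    lt_of_le_of_ne (not_lt.1 hcon) (h.nz (hf y hay hyb) (by omega))
  obtain ⟨D, hD⟩ := h.disp
  have hD0 : 0 ≤ D := (abs_nonneg _).trans (hD (0, 0))
  have hM0 : 0 ≤ M := (abs_nonneg _).trans (h.bdd 0 0)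
  have hab : a ≤ b := (hay.trans hyb).le
  -- the path in the left half strip
  let sg : I → St := fun t => lerpS t (K⁻¹ (0, y)) (-(M + D + 1), 0)
  have hsg : Continuous sg := continuous_lerpS continuous_id continuous_const continuous_const
  have hsgneg : ∀ t, (sg t).1 < 0 := by
    intro t
    have e1 : (sg t).1 = (1 - (t : ℝ)) * -(K (0, y)).1 + t * -(M + D + 1) := by
      simp only [sg, lerpS, inv_axis h.rev]
    rw [e1]
    rcases t.2.1.eq_or_lt with h0 | h0
    · rw [← h0]; linarith
    · have := mul_nonneg (sub_nonneg.2 t.2.2) hy.le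
      have := mul_pos h0 (by linarith : 0 < M + D + 1)
      linarith
  have hcont : ∀ m : ℕ, Continuous fun q : I × I =>
      toC ((K ^ m) (0, lerpI q.1 a b)) - toC (K (sg q.2)) := by
    intro m
    refine (continuous_toC.comp ((K ^ m).continuous.comp (Continuous.prodMk continuous_const
      (continuous_lerpI (by fun_prop) (by fun_prop) (by fun_prop))))).sub
      (continuous_toC.comp (K.continuous.comp (hsg.comp continuous_snd)))
  have hfar : ∀ (m : ℕ) (s : I),
      0 < (toC ((K ^ m) (0, lerpI s a b)) - toC (K (sg 1))).re := by
    intro m s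
    have h1 := (abs_le.1 (h.bdd m (lerpI s a b))).1
    have h2 := (abs_le.1 (hD (sg 1))).2
    have h3 : (sg 1).1 = -(M + D + 1) := by simp [sg]
    simp only [toC, Complex.sub_re]
    linarith
  have hne : ∀ m : ℕ, (∀ y', a ≤ y' → y' ≤ b → 0 ≤ ((K ^ m) (0, y')).1) → ∀ q : I × I,
      toC ((K ^ (m + 1)) (0, lerpI q.1 a b)) - toC (K (sg q.2)) ≠ 0 := by
    intro m hm q h0
    have h1 := toC_inj (sub_eq_zero.1 h0)
    rw [pow_succ', Homeomorph.mul_apply] at h1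
    have h2 := K.injective h1
    have h3 := lerpI_mem q.1 a b hab
    have h4 := hm _ h3.1 h3.2
    rw [h2] at h4
    linarith [hsgneg q.2]
  have hst : K (sg 0) = (0, y) := by simp [sg, K_inv_apply]
  refine winding _ _ (hcont (0 + 1)) (hcont (n + 1)) (hne 0 (fun y' _ _ => by simp))
    (hne n (hpos n hn hyn)) (fun t => ?_) (fun t => ?_) 1 one_ne_zero (fun s => ?_) (fun s => ?_)
    (fun s => ?_) (fun s => ?_) ?_ ?_
  · simp only [lerpI_zero, hpa]
  · simp only [lerpI_one, hpb]
  · rw [one_mul]; exact Or.inl (hfar _ s)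
  · rw [one_mul]; exact Or.inl (hfar _ s)
  · have h3 := lerpI_mem s a b hab
    have := hpos 1 le_rfl (by simpa using hy) _ h3.1 h3.2
    simpa [hst, toC] using this
  · have h3 := lerpI_mem s a b hab
    have := hneg (n + 1) (by omega) hlt _ h3.1 h3.2
    simpa [hst, toC] using this
  · simpa [hst, toC, ha] using hay
  · simpa [hst, toC, hb] using hyb

/-- Signs along orbits of axis points are constant. -/
lemma Core.pos_iter {K : St ≃ₜ St} {M : ℝ} (h : Core K M) (y : I)
    (hy : 0 < (K (0, y)).1) (n : ℕ) (hn : 1 ≤ n) : 0 < ((K ^ n) (0, y)).1 := by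
  have hyf : K (0, y) ≠ (0, y) := fun h0 => by rw [h0] at hy; exact lt_irrefl _ hy
  by_cases hA : ∃ y', y' ≤ y ∧ K (0, y') = (0, y')
  · by_cases hB : ∃ y', y ≤ y' ∧ K (0, y') = (0, y')
    · obtain ⟨a, ha, hamax⟩ := Set.exists_max_image {y' : I | y' ≤ y ∧ K (0, y') = (0, y')} id
        (h.fin.subset fun _ h => h.2) hA
      obtain ⟨b, hb, hbmin⟩ := Set.exists_min_image {y' : I | y ≤ y' ∧ K (0, y') = (0, y')} id
        (h.fin.subset fun _ h => h.2) hB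
      have hay : a < y := lt_of_le_of_ne ha.1 (by rintro rfl; exact hyf ha.2)
      have hyb : y < b := lt_of_le_of_ne hb.1 (by rintro rfl; exact hyf hb.2)
      have hf : ∀ y', a < y' → y' < b → K (0, y') ≠ (0, y') := by
        intro y' h1 h2 h3
        rcases le_total y' y with h4 | h4
        · exact absurd (hamax y' ⟨h4, h3⟩) (not_le.2 h1)
        · exact absurd (hbmin y' ⟨h4, h3⟩) (not_le.2 h2)
      induction n, hn using Nat.le_induction with
      | base => simpa using hy
      | succ n hn ih => exact h.pos_mid a b y hay hyb ha.2 hb.2 hf hy n hn ih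
    · push Not at hB
      exact h.pos_edge 1 h.top h.topmono y hy (fun s => hB _ (lerpI_mem' s 1 y le_one').1)
        (fun s => hB _ (lerpI_mem s y 1 le_one').1) n hn
  · push Not at hA
    exact h.pos_edge 0 h.bot h.botmono y hy (fun s => hA _ (lerpI_mem s 0 y nonneg').2)
        (fun s => hA _ (lerpI_mem' s y 0 nonneg').2) n hn

lemma Core.neg_iter {K : St ≃ₜ St} {M : ℝ} (h : Core K M) (y : I)
    (hy : (K (0, y)).1 < 0) (n : ℕ) (hn : 1 ≤ n) : ((K ^ n) (0, y)).1 < 0 := by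
  have := h.inv.pos_iter y (by rw [inv_axis h.rev]; simpa using hy) n hn
  rw [inv_pow, inv_pow_axis h.rev] at this
  simpa using this


lemma infinite_of_open_I {s : Set I} (hs : IsOpen s) (hne : s.Nonempty) : s.Infinite := by
  obtain ⟨y, hy⟩ := hne
  have : (𝓝[≠] y).NeBot := inferInstance
  exact infinite_of_mem_nhds y (hs.mem_nhds hy)

lemma Core.inv_cases {K : St ≃ₜ St} {M : ℝ} (h : Core K M) (y : I) :
    K (0, y) = (0, y) ∨ (∀ n : ℕ, 1 ≤ n → 0 < ((K ^ n) (0, y)).1) ∨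
      (∀ n : ℕ, 1 ≤ n → ((K ^ n) (0, y)).1 < 0) := by
  by_cases hy : K (0, y) = (0, y)
  · exact Or.inl hy
  · have := h.nz hy (n := 1) le_rfl
    rw [pow_one] at this
    rcases this.lt_or_gt with h1 | h1
    · exact Or.inr (Or.inr (h.neg_iter y h1))
    · exact Or.inr (Or.inl (h.pos_iter y h1))

/-- The triple intersection is empty. -/
lemma Core.triple {K : St ≃ₜ St} {M : ℝ} (h : Core K M) (n : ℕ) (hn : 2 ≤ n) (v : St)
    (h1 : 0 < v.1) (h2 : (K⁻¹ v).1 < 0) (h3 : 0 < ((K ^ n)⁻¹ v).1) : False := by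
  have c1 : Continuous fun w : St => (K⁻¹ w).1 := by
    have := (K⁻¹).continuous
    fun_prop
  have c2 : Continuous fun w : St => ((K ^ n)⁻¹ w).1 := by
    have := ((K ^ n)⁻¹).continuous
    fun_prop
  let V : Set St := {w | 0 < w.1 ∧ (K⁻¹ w).1 < 0 ∧ 0 < ((K ^ n)⁻¹ w).1}
  have hV : IsOpen V := by
    refine (isOpen_lt continuous_const continuous_fst).inter
      ((isOpen_lt c1 continuous_const).inter (isOpen_lt continuous_const c2))
  let Z : Set St := {w | 0 ≤ w.1 ∧ (K⁻¹ w).1 ≤ 0 ∧ 0 ≤ ((K ^ n)⁻¹ w).1}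
  have hZ : IsClosed Z := by
    refine (isClosed_le continuous_const continuous_fst).inter
      ((isClosed_le c1 continuous_const).inter (isClosed_le continuous_const c2))
  have hVZ : V ⊆ Z := fun w hw => ⟨hw.1.le, hw.2.1.le, hw.2.2.le⟩
  have hinf : {y : I | (v.1, y) ∈ V}.Infinite :=
    infinite_of_open_I (hV.preimage (by fun_prop)) ⟨v.2, h1, h2, h3⟩
  refine hinf (h.fin.subset fun y hy => ?_)
  have hy : (v.1, y) ∈ V := hy
  show K (0, y) = (0, y)
  let A : Set ℝ := {x | x ≤ v.1 ∧ (x, y) ∉ V}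
  have hA : IsClosed A := isClosed_Iic.inter
    ((hV.preimage (f := fun x : ℝ => ((x, y) : St)) (by fun_prop)).isClosed_compl)
  have hA0 : (0 : ℝ) ∈ A := ⟨h1.le, fun h => lt_irrefl _ h.1⟩
  have hAb : BddAbove A := ⟨v.1, fun x hx => hx.1⟩
  have hx := hA.csSup_mem ⟨0, hA0⟩ hAb
  set x := sSup A with hxdef
  have hxlt : x < v.1 := lt_of_le_of_ne hx.1 (by rintro h0; exact hx.2 (by rw [h0]; exact hy))
  have hIoc : Set.Ioc x v.1 ⊆ (fun x : ℝ => ((x, y) : St)) ⁻¹' Z := by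
    intro x' hx'
    by_contra hc
    have : x' ∈ A := ⟨hx'.2, fun hv => hc (hVZ hv)⟩
    exact absurd (le_csSup hAb this) (not_le.2 hx'.1)
  have hxZ : (x, y) ∈ Z := by
    have hcl : IsClosed ((fun x : ℝ => ((x, y) : St)) ⁻¹' Z) := hZ.preimage (by fun_prop)
    have := closure_minimal hIoc hcl
    rw [closure_Ioc hxlt.ne] at this
    exact this (Set.left_mem_Icc.2 hxlt.le)
  obtain ⟨z1, z2, z3⟩ := hxZ
  have hnV := hx.2
  -- `w` is on one of the three curves
  have hcase : x = 0 ∨ (K⁻¹ (x, y)).1 = 0 ∨ ((K ^ n)⁻¹ (x, y)).1 = 0 := by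
    by_contra hc
    push Not at hc
    exact hnV ⟨lt_of_le_of_ne z1 hc.1.symm, lt_of_le_of_ne z2 hc.2.1,
      lt_of_le_of_ne z3 hc.2.2.symm⟩
  obtain ⟨m, rfl⟩ : ∃ m, n = m + 1 := ⟨n - 1, by omega⟩
  rcases hcase with h0 | h0 | h0
  · rw [h0] at z2 z3
    rw [inv_axis h.rev] at z2
    rw [inv_pow_axis h.rev] at z3
    rcases h.inv_cases y with hc | hc | hc
    · exact hc
    · have := hc (m + 1) (by omega); simp only at z3; linarith
    · have := hc 1 le_rfl; rw [pow_one] at this; simp only at z2; linarith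
  · obtain ⟨q, hq⟩ : ∃ q : I, (x, y) = K (0, q) := by
      refine ⟨(K⁻¹ (x, y)).2, ?_⟩
      rw [← K_inv_apply K (x, y)]
      congr 1
      exact Prod.ext (by rw [K_inv_apply]; exact h0) (by rw [K_inv_apply])
    have e3 : (K ^ (m + 1))⁻¹ (K (0, q)) = (K ^ m)⁻¹ (0, q) := by
      rw [← Homeomorph.mul_apply]
      congr 1
      rw [pow_succ']; group
    have z1' : 0 ≤ (K (0, q)).1 := by rw [← hq]; exact z1
    rw [hq, e3, inv_pow_axis h.rev] at z3
    rcases h.inv_cases q with hc | hc | hc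
    · rw [hc, Prod.mk.injEq] at hq
      rw [hq.2]; exact hc
    · have := hc m (by omega); simp only at z3; linarith
    · have := hc 1 le_rfl; rw [pow_one] at this; linarith
  · obtain ⟨q, hq⟩ : ∃ q : I, (x, y) = (K ^ (m + 1)) (0, q) := by
      refine ⟨((K ^ (m + 1))⁻¹ (x, y)).2, ?_⟩
      rw [← K_inv_apply (K ^ (m + 1)) (x, y)]
      congr 1
      exact Prod.ext (by rw [K_inv_apply]; exact h0) (by rw [K_inv_apply])
    have e3 : K⁻¹ ((K ^ (m + 1)) (0, q)) = (K ^ m) (0, q) := by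
      rw [← Homeomorph.mul_apply]
      congr 1
      rw [pow_succ']; group
    have z1' : 0 ≤ ((K ^ (m + 1)) (0, q)).1 := by rw [← hq]; exact z1
    rw [hq, e3] at z2
    rcases h.inv_cases q with hc | hc | hc
    · have hfix : ∀ k : ℕ, (K ^ k) (0, q) = (0, q) := by
        intro k
        induction k with
        | zero => simp
        | succ k ih => rw [pow_succ', Homeomorph.mul_apply, ih, hc]
      rw [hfix, Prod.mk.injEq] at hq
      rw [hq.2]; exact hc
    · have := hc m (by omega); linarith
    · have := hc (m + 1) (by omega); linarith

/-- The wandering set. -/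
def wset (K : St ≃ₜ St) : Set St := {w | 0 < w.1 ∧ (K⁻¹ w).1 < 0}

lemma isOpen_wset (K : St ≃ₜ St) : IsOpen (wset K) := by
  have c1 : Continuous fun w : St => (K⁻¹ w).1 := by
    have := (K⁻¹).continuous
    fun_prop
  exact (isOpen_lt continuous_const continuous_fst).inter (isOpen_lt c1 continuous_const)

lemma Core.wander {K : St ≃ₜ St} {M : ℝ} (h : Core K M) (n : ℕ) (hn : 1 ≤ n) (w : St)
    (hw : w ∈ wset K) : (K ^ n) w ∉ wset K := by
  intro hc
  rcases hn.eq_or_lt with rfl | hn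
  · have := hc.2
    rw [pow_one, inv_K_apply] at this
    exact absurd hw.1 (not_lt.2 this.le)
  · exact h.triple n hn _ hc.1 hc.2 (by rw [inv_K_apply]; exact hw.1)

lemma Core.wset_nonempty {K : St ≃ₜ St} {M : ℝ} (h : Core K M) :
    (wset K).Nonempty ∨ (wset K⁻¹).Nonempty := by
  have key : ∀ (K : St ≃ₜ St) (y : I), 0 < (K (0, y)).1 → (wset K).Nonempty := by
    intro K y hy
    have hc : Continuous fun x : ℝ => (K (x, y)).1 := by
      have := K.continuous
      fun_prop
    have h1 : ∀ᶠ x in 𝓝[<] (0 : ℝ), 0 < (K (x, y)).1 :=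
      (hc.tendsto 0).eventually (lt_mem_nhds hy) |>.filter_mono nhdsWithin_le_nhds
    obtain ⟨x, hx, hx0⟩ := (h1.and self_mem_nhdsWithin).exists
    exact ⟨K (x, y), hx, by rw [inv_K_apply]; exact hx0⟩
  obtain ⟨y, hy⟩ : ∃ y : I, K (0, y) ≠ (0, y) := by
    by_contra hc
    push Not at hc
    refine infinite_of_open_I isOpen_univ ⟨0, trivial⟩ (h.fin.subset fun y _ => hc y)
  have := h.nz hy (n := 1) le_rfl
  rw [pow_one] at this
  rcases this.lt_or_gt with h1 | h1
  · right
    exact key _ y (by rw [inv_axis h.rev]; simpa using h1)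
  · left
    exact key _ y h1

lemma disp_pow {K : St ≃ₜ St} {D : ℝ} (hD : ∀ w, |(K w).1 - w.1| ≤ D) (n : ℕ) :
    ∀ w, |((K ^ n) w).1 - w.1| ≤ n * D := by
  induction n with
  | zero => simp
  | succ n ih =>
    intro w
    rw [pow_succ', Homeomorph.mul_apply]
    have h1 := abs_le.1 (hD ((K ^ n) w))
    have h2 := abs_le.1 (ih w)
    push_cast
    rw [abs_le]
    constructor <;> linarith

/-- Images of the right half strip stay to the right of the images of the axis. -/
lemma right_side {K : St ≃ₜ St} {M D : ℝ} (hD : ∀ w, |(K w).1 - w.1| ≤ D)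
    (hM : ∀ y, -M ≤ (K (0, y)).1) (w : St) (hw : 0 < w.1) : -M ≤ (K w).1 := by
  by_contra hc
  push Not at hc
  have hcont : Continuous fun x : ℝ => (K⁻¹ (x, (K w).2)).1 := by
    have := (K⁻¹).continuous
    fun_prop
  have hDi : ∀ w, |(K⁻¹ w).1 - w.1| ≤ D := by
    intro w
    have := hD (K⁻¹ w)
    rwa [K_inv_apply, abs_sub_comm] at this
  set b := (K w).1 with hb
  have hbw : (K⁻¹ (b, (K w).2)).1 = w.1 := by rw [hb, Prod.mk.eta, inv_K_apply]
  let a := min b (-(D + 1))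
  have ha : (K⁻¹ (a, (K w).2)).1 ≤ 0 := by
    have h1 := (abs_le.1 (hDi (a, (K w).2))).2
    have h2 : a ≤ -(D + 1) := min_le_right _ _
    simp only at h1
    linarith
  obtain ⟨x, hx, hx0⟩ := intermediate_value_Icc (min_le_left b (-(D + 1)))
    hcont.continuousOn (show (0 : ℝ) ∈ _ from ⟨ha, by simp only [hbw]; exact hw.le⟩)
  have hq : K (0, (K⁻¹ (x, (K w).2)).2) = (x, (K w).2) := by
    rw [← K_inv_apply K (x, (K w).2)]
    congr 1
    exact Prod.ext (by rw [K_inv_apply]; exact hx0.symm) (by rw [K_inv_apply])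
  have := hM (K⁻¹ (x, (K w).2)).2
  rw [hq] at this
  have h3 := hx.2
  simp only at this
  linarith

lemma left_side {K : St ≃ₜ St} {M D : ℝ} (hD : ∀ w, |(K w).1 - w.1| ≤ D)
    (hM : ∀ y, (K (0, y)).1 ≤ M) (w : St) (hw : w.1 < 0) : (K w).1 ≤ M := by
  have := right_side (K := RS * K * RS) (M := M) (D := D) (fun w => ?_) (fun y => ?_) (RS w) ?_
  · simp [RS_apply] at this
    linarith
  · have := hD (RS w)
    rw [abs_le] at this ⊢
    simp only [Homeomorph.mul_apply, RS_apply] at this ⊢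
    constructor <;> linarith
  · simpa [RS_apply] using hM y
  · simpa [RS_apply] using hw

lemma Core.wset_bdd {K : St ≃ₜ St} {M : ℝ} (h : Core K M) (n : ℕ) (w : St)
    (hw : w ∈ wset K) : |((K ^ n) w).1| ≤ M := by
  obtain ⟨D, hD⟩ := h.disp
  rw [abs_le]
  constructor
  · exact right_side (disp_pow hD n) (fun y => (abs_le.1 (h.bdd n y)).1) w hw.1
  · have := left_side (disp_pow hD (n + 1)) (fun y => (abs_le.1 (h.bdd (n + 1) y)).2) (K⁻¹ w) hw.2
    rwa [pow_succ, Homeomorph.mul_apply, K_inv_apply] at this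


/-- The covering projection of the strip onto the annulus. -/
noncomputable def prj (w : St) : AnnC := ((w.1 : Circle1), w.2)

lemma continuous_prj : Continuous prj :=
  ((AddCircle.continuous_mk' 1).comp continuous_fst).prodMk continuous_snd

lemma isOpenMap_prj : IsOpenMap prj := by
  have h1 : IsOpenMap (fun x : ℝ => (x : Circle1)) := QuotientAddGroup.isOpenMap_coe
  exact h1.prodMap IsOpenMap.id

lemma coe_int (m : ℤ) : ((m : ℝ) : Circle1) = 0 :=
  AddCircle.coe_eq_zero_iff 1 |>.2 ⟨m, by simp⟩

lemma coe_circ_eq {a b : ℝ} (h : (a : Circle1) = (b : Circle1)) : ∃ m : ℤ, b = a + m := by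
  have h1 : ((b - a : ℝ) : Circle1) = 0 := by
    rw [AddCircle.coe_sub, h, sub_self]
  obtain ⟨m, hm⟩ := (AddCircle.coe_eq_zero_iff 1).1 h1
  refine ⟨m, ?_⟩
  simp at hm
  linarith

lemma prj_eq {u v : St} (h : prj u = prj v) : ∃ m : ℤ, v.1 = u.1 + m ∧ v.2 = u.2 := by
  obtain ⟨m, hm⟩ := coe_circ_eq (congrArg Prod.fst h)
  exact ⟨m, hm, (congrArg Prod.snd h).symm⟩

lemma prj_add (x : ℝ) (m : ℤ) (y : I) : prj (x + m, y) = prj (x, y) := by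
  simp [prj]

lemma measure_wander {K : St ≃ₜ St} {M : ℝ} (h : Core K M) (g : AnnC ≃ₜ AnnC)
    (hg : ∀ w, prj (K w) = g (prj w)) (μ : Measure AnnC) (hfin : μ Set.univ < ⊤)
    (hpos : ∀ U : Set AnnC, IsOpen U → U.Nonempty → 0 < μ U)
    (hmp : MeasurePreserving g μ μ) (hne : (wset K).Nonempty) : False := by
  set W : Set St := wset K with hW
  let E : ℕ → Set AnnC := fun i => prj '' ((K ^ i : St ≃ₜ St) '' W)
  have hEo : ∀ i, IsOpen (E i) := fun i =>
    isOpenMap_prj _ ((K ^ i : St ≃ₜ St).isOpenMap _ (isOpen_wset K))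
  have hgp : ∀ (i : ℕ) w, prj ((K ^ i) w) = (⇑g)^[i] (prj w) := by
    intro i
    induction i with
    | zero => intro w; simp
    | succ i ih =>
      intro w
      rw [pow_succ, Homeomorph.mul_apply, ih, hg, Function.iterate_succ_apply]
  have hEi : ∀ i, E i = (⇑g)^[i] '' E 0 := by
    intro i
    simp only [E, Set.image_image, hgp, Function.iterate_zero, id]
  have hmu : ∀ i, μ (E i) = μ (E 0) := by
    intro i
    have h1 := (hmp.iterate i).measure_preimage (hEo i).measurableSet.nullMeasurableSet
    rw [← h1, hEi i, Set.preimage_image_eq _ (g.injective.iterate i)]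
  have hE0 : 0 < μ (E 0) := hpos _ (hEo 0) ((hne.image _).image _)
  let B : Finset ℤ := Finset.Icc ⌊-M⌋ ⌊M⌋
  have hmult : ∀ (n : ℕ) (a : AnnC),
      ∑ i ∈ Finset.range n, (E i).indicator (fun _ => (1 : ENNReal)) a ≤ (B.card : ENNReal) := by
    classical
    intro n a
    have hl : ∀ i, a ∈ E i → ∃ w, w ∈ W ∧ prj ((K ^ i) w) = a := by
      rintro i ⟨_, ⟨w, hw, rfl⟩, h2⟩
      exact ⟨w, hw, h2⟩
    choose! w hwW hwa using hl
    have hc : ((Finset.range n).filter fun i => a ∈ E i).card ≤ B.card := by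
      refine Finset.card_le_card_of_injOn (fun i => ⌊((K ^ i) (w i)).1⌋) ?_ ?_
      · intro i hi
        have hi' := (Finset.mem_filter.1 hi).2
        have hb := abs_le.1 (h.wset_bdd i (w i) (hwW i hi'))
        exact Finset.mem_coe.2 (Finset.mem_Icc.2 ⟨Int.floor_le_floor hb.1, Int.floor_le_floor hb.2⟩)
      · have key : ∀ i j, i < j → a ∈ E i → a ∈ E j →
            ⌊((K ^ i) (w i)).1⌋ = ⌊((K ^ j) (w j)).1⌋ → False := by
          intro i j hij hi hj hfl
          obtain ⟨m, hm1, hm2⟩ := prj_eq ((hwa i hi).trans (hwa j hj).symm)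
          rw [hm1, Int.floor_add_intCast] at hfl
          have hm0 : m = 0 := by omega
          have he : (K ^ j) (w j) = (K ^ i) (w i) := by
            refine Prod.ext ?_ hm2
            rw [hm1, hm0]; simp
          obtain ⟨d, rfl⟩ := Nat.exists_eq_add_of_lt hij
          rw [show i + d + 1 = i + (d + 1) by ring, pow_add, Homeomorph.mul_apply] at he
          have := (K ^ i).injective he
          refine h.wander (d + 1) (by omega) _ (hwW _ hj) ?_
          rw [show i + d + 1 = i + (d + 1) by ring] at *
          rw [this]
          exact hwW i hi
        intro i hi j hj hfl
        have hi' := (Finset.mem_filter.1 hi).2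
        have hj' := (Finset.mem_filter.1 hj).2
        rcases lt_trichotomy i j with hlt | heq | hlt
        · exact (key i j hlt hi' hj' hfl).elim
        · exact heq
        · exact (key j i hlt hj' hi' hfl.symm).elim
    calc ∑ i ∈ Finset.range n, (E i).indicator (fun _ => (1 : ENNReal)) a
        = (((Finset.range n).filter fun i => a ∈ E i).card : ENNReal) := by
          simp [Set.indicator_apply]
      _ ≤ _ := by exact_mod_cast hc
  have hn : ∀ n : ℕ, (n : ENNReal) * μ (E 0) ≤ B.card * μ Set.univ := by
    intro n
    calc (n : ENNReal) * μ (E 0) = ∑ i ∈ Finset.range n, μ (E i) := by simp [hmu]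
      _ = ∑ i ∈ Finset.range n, ∫⁻ a, (E i).indicator (fun _ => (1 : ENNReal)) a ∂μ := by
          refine Finset.sum_congr rfl fun i _ => ?_
          rw [lintegral_indicator (hEo i).measurableSet]; simp
      _ = ∫⁻ a, ∑ i ∈ Finset.range n, (E i).indicator (fun _ => (1 : ENNReal)) a ∂μ := by
          rw [lintegral_finsetSum]
          intro i _
          exact measurable_const.indicator (hEo i).measurableSet
      _ ≤ ∫⁻ a, (B.card : ENNReal) ∂μ := lintegral_mono (hmult n)
      _ = _ := by simp
  have hC : (B.card : ENNReal) * μ Set.univ ≠ ⊤ := ENNReal.mul_ne_top (by simp) hfin.ne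
  obtain ⟨n, hn'⟩ := ENNReal.exists_nat_mul_gt hE0.ne' hC
  exact absurd (hn n) (not_le.2 hn')

lemma Core.measure_false {K : St ≃ₜ St} {M : ℝ} (h : Core K M) (g : AnnC ≃ₜ AnnC)
    (hg : ∀ w, prj (K w) = g (prj w)) (μ : Measure AnnC) (hfin : μ Set.univ < ⊤)
    (hpos : ∀ U : Set AnnC, IsOpen U → U.Nonempty → 0 < μ U)
    (hmp : MeasurePreserving g μ μ) : False := by
  rcases h.wset_nonempty with hne | hne
  · exact measure_wander h g hg μ hfin hpos hmp hne
  · refine measure_wander h.inv g.symm ?_ μ hfin hpos ?_ hne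
    · intro w
      rw [Homeomorph.eq_symm_apply, ← hg]
      exact congrArg prj (K.apply_symm_apply w)
    · exact (MeasurePreserving.symm g.toMeasurableEquiv hmp)


lemma TS_zpow (m : ℤ) (w : St) : (TS ^ m) w = (w.1 + m, w.2) := by
  induction m using Int.induction_on generalizing w with
  | zero => simp
  | succ i ih =>
    rw [zpow_add_one, Homeomorph.mul_apply, ih, TS_apply]
    ext <;> simp
    ring
  | pred i ih =>
    rw [zpow_sub_one, Homeomorph.mul_apply, ih]
    have : TS⁻¹ w = (w.1 - 1, w.2) := by
      change TS.symm w = _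
      rw [Homeomorph.symm_apply_eq, TS_apply]
      simp
    rw [this]
    ext <;> simp
    ring

lemma RS_inv : RS⁻¹ = RS := inv_eq_of_mul_eq_one_left RS_mul_RS

lemma RS_TS_zpow (m : ℤ) : RS * TS ^ m * RS = TS ^ (-m) := by
  ext w
  · simp only [Homeomorph.mul_apply, TS_zpow, RS_apply]
    push_cast
    ring
  · simp only [Homeomorph.mul_apply, TS_zpow, RS_apply]

lemma prj_TS (m : ℤ) (w : St) : prj ((TS ^ m) w) = prj w := by
  rw [TS_zpow]; exact prj_add _ _ _

lemma prj_RS (w : St) : prj (RS w) = RC (prj w) := by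
  simp [prj, RS_apply, RC]

lemma exists_disp {f : AnnC ≃ₜ AnnC} (hiso : IsotopicToIdC f) :
    ∃ d : AnnC → ℝ, Continuous d ∧ ∀ z, (f z).1 = z.1 + (d z : Circle1) := by
  obtain ⟨H, hH, h0, h1, -⟩ := hiso
  let L : C(I × AnnC, Circle1) := ⟨fun p => (H p).1 - p.2.1, by fun_prop⟩
  let c0 : C(AnnC, ℝ) := ContinuousMap.const _ 0
  have hL0 : ∀ z, L (0, z) = ((c0 z : ℝ) : Circle1) := by
    intro z
    have := h0 z
    change (H (⟨0, _⟩, z)).1 - z.1 = ((0 : ℝ) : Circle1)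
    rw [this]; simp
  let D := (AddCircle.isCoveringMap_coe (1 : ℝ)).liftHomotopy L c0 hL0
  have hD : ∀ p, ((D p : ℝ) : Circle1) = L p := fun p =>
    congrFun ((AddCircle.isCoveringMap_coe (1 : ℝ)).liftHomotopy_lifts L c0 hL0) p
  refine ⟨fun z => D (1, z), by fun_prop, fun z => ?_⟩
  rw [hD]
  have := h1 z
  change (f z).1 = z.1 + ((H (⟨1, _⟩, z)).1 - z.1)
  rw [this]; abel

/-- Lift of a homeomorphism with continuous real displacement. -/
lemma exists_lift {f : AnnC ≃ₜ AnnC} (hiso : IsotopicToIdC f) :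
    ∃ F : St ≃ₜ St, (∀ w, prj (F w) = f (prj w)) ∧ (F * TS = TS * F) ∧
      ∃ D : ℝ, ∀ w, |(F w).1 - w.1| ≤ D := by
  obtain ⟨d, hd, hfd⟩ := exists_disp hiso
  have hprj : ∀ w : St, prj (w.1 + d (prj w), (f (prj w)).2) = f (prj w) := by
    intro w
    refine Prod.ext ?_ rfl
    rw [hfd]
    simp [prj]
  have hprj' : ∀ w : St, prj (w.1 - d (f.symm (prj w)), (f.symm (prj w)).2) = f.symm (prj w) := by
    intro w
    refine Prod.ext ?_ rfl
    have := hfd (f.symm (prj w))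
    rw [f.apply_symm_apply] at this
    have h2 : ((w.1 : ℝ) : Circle1) = (f.symm (prj w)).1 + (d (f.symm (prj w)) : Circle1) := this
    change ((w.1 - d (f.symm (prj w)) : ℝ) : Circle1) = _
    rw [AddCircle.coe_sub, h2]; abel
  have hpc := continuous_prj
  let F : St ≃ₜ St :=
    { toFun := fun w => (w.1 + d (prj w), (f (prj w)).2)
      invFun := fun w => (w.1 - d (f.symm (prj w)), (f.symm (prj w)).2)
      left_inv := by
        intro w
        simp only [hprj, f.symm_apply_apply]
        ext <;> simp [prj]
      right_inv := by
        intro w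
        simp only [hprj', f.apply_symm_apply]
        ext <;> simp [prj]
      continuous_toFun := by fun_prop
      continuous_invFun := by fun_prop }
  have hF : ∀ w, F w = (w.1 + d (prj w), (f (prj w)).2) := fun _ => rfl
  refine ⟨F, hprj, ?_, ?_⟩
  · ext w
    · simp only [Homeomorph.mul_apply, hF]
      have : prj (TS w) = prj w := by simpa using prj_TS 1 w
      rw [this]; simp [TS_apply]; ring
    · simp only [Homeomorph.mul_apply, hF]
      have : prj (TS w) = prj w := by simpa using prj_TS 1 w
      rw [this]; simp [TS_apply]
  · obtain ⟨D, hD⟩ := (isCompact_range hd).isBounded.exists_norm_le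
    refine ⟨D, fun w => ?_⟩
    have := hD _ ⟨prj w, rfl⟩
    simpa [hF] using this

lemma lift_id {L : St ≃ₜ St} (h : ∀ w, prj (L w) = prj w) : ∃ m : ℤ, L = TS ^ m := by
  obtain ⟨m, hm, -⟩ := prj_eq (h (0, 0)).symm
  refine ⟨m, ?_⟩
  have key : (fun w : St => (L w).1) = fun w : St => w.1 + m := by
    refine (AddCircle.isCoveringMap_coe (1 : ℝ)).eq_of_comp_eq (by fun_prop) (by fun_prop) ?_
      (0, 0) hm
    ext w
    have h1 : (((L w).1 : ℝ) : Circle1) = (w.1 : Circle1) := congrArg Prod.fst (h w)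
    simp [h1]
  ext w
  · rw [TS_zpow]; exact congrFun key w
  · rw [TS_zpow]
    exact congrArg (fun z : AnnC => ((z.2 : I) : ℝ)) (h w)

lemma lift_rev {f : AnnC ≃ₜ AnnC} (hrev : ∀ z, f (RC z) = RC (f.symm z)) {F : St ≃ₜ St}
    (hF : ∀ w, prj (F w) = f (prj w)) (hT : F * TS = TS * F) : RS * F * RS = F⁻¹ := by
  obtain ⟨m, hm⟩ := lift_id (L := RS * F * RS * F) (by
    intro w
    simp only [Homeomorph.mul_apply, prj_RS, hF, hrev]
    simp [RC])
  have hTm : F * TS ^ m = TS ^ m * F := (Commute.zpow_right (show Commute F TS from hT) m)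
  have h1 : RS * (RS * F * RS * F) * RS = F * (RS * F * RS * F) * F⁻¹ := by
    calc _ = (RS * RS) * (F * RS * F * RS) := by group
      _ = F * RS * F * RS := by rw [RS_mul_RS, one_mul]
      _ = _ := by group
  rw [hm, RS_TS_zpow, hTm, mul_inv_cancel_right] at h1
  have h2 := congrArg (fun L : St ≃ₜ St => (L (0, 0)).1) h1
  simp only [TS_zpow] at h2
  push_cast at h2
  have h3 : (m : ℝ) = 0 := by linarith
  have h4 : m = 0 := by exact_mod_cast h3
  rw [h4, zpow_zero] at hm
  exact eq_inv_of_mul_eq_one_left hm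


lemma comm_pow {G : St ≃ₜ St} (hc : G * TS = TS * G) (n : ℕ) (j : ℤ) (w : St) :
    (G ^ n) ((TS ^ j) w) = (TS ^ j) ((G ^ n) w) := by
  have : G ^ n * TS ^ j = TS ^ j * G ^ n :=
    ((show Commute G TS from hc).pow_left n).zpow_right j
  rw [← Homeomorph.mul_apply, this, Homeomorph.mul_apply]

lemma half_return {G : St ≃ₜ St} (hc : G * TS = TS * G) (hr : RS * G * RS = G⁻¹)
    {n : ℕ} {y : I} {j : ℤ} (h : ((G ^ n) (0, y)).1 = (j : ℝ) / 2) :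
    (G ^ (2 * n)) (0, y) = ((j : ℝ), y) := by
  have h1 := inv_pow_axis hr n y
  have h2 : (G ^ n)⁻¹ (0, y) = (TS ^ (-j)) ((G ^ n) (0, y)) := by
    rw [h1, TS_zpow, h]
    ext
    · push_cast; ring
    · rfl
  have h3 := congrArg (G ^ n) h2
  rw [K_inv_apply, comm_pow hc, ← Homeomorph.mul_apply (G ^ n) (G ^ n), ← pow_add, ← two_mul] at h3
  have h4 := congrArg (TS ^ j) h3
  rw [← Homeomorph.mul_apply (TS ^ j) (TS ^ (-j)), ← zpow_add, add_neg_cancel, zpow_zero,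
    Homeomorph.one_apply, TS_zpow] at h4
  rw [← h4]; simp

lemma iter_return {G : St ≃ₜ St} (hc : G * TS = TS * G)
    {a : ℕ} {y : I} {j : ℤ} (h : (G ^ a) (0, y) = ((j : ℝ), y)) (b : ℕ) :
    (G ^ (a * b)) (0, y) = ((b : ℝ) * (j : ℝ), y) := by
  induction b with
  | zero => simp
  | succ b ih =>
    have h5 : (((b : ℝ) * (j : ℝ), y) : St) = (TS ^ ((b : ℤ) * j)) (0, y) := by
      rw [TS_zpow]; ext <;> simp
    rw [show a * (b + 1) = a + a * b by ring, pow_add, Homeomorph.mul_apply, ih, h5,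
      comm_pow hc, h, TS_zpow]
    ext
    · push_cast; ring
    · rfl

/-- Hypotheses on the lift of an iterate. -/
structure Pre (G : St ≃ₜ St) : Prop where
  comm : G * TS = TS * G
  rev : RS * G * RS = G⁻¹
  disp : ∃ D : ℝ, ∀ w, |(G w).1 - w.1| ≤ D
  fix : ∃ w, G w = w
  fin : {y : I | ∃ n : ℕ, 1 ≤ n ∧ ∃ j : ℤ, ((G ^ n) (0, y)).1 = (j : ℝ) / 2}.Finite

lemma Pre.inv {G : St ≃ₜ St} (h : Pre G) : Pre G⁻¹ := by
  refine ⟨?_, ?_, ?_, ?_, ?_⟩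
  · exact ((show Commute G TS from h.comm).inv_left)
  · rw [inv_inv, ← h.rev]
    calc RS * (RS * G * RS) * RS = (RS * RS) * G * (RS * RS) := by group
      _ = G := by rw [RS_mul_RS]; simp
  · obtain ⟨D, hD⟩ := h.disp
    refine ⟨D, fun w => ?_⟩
    have := hD (G⁻¹ w)
    rw [← Homeomorph.mul_apply, mul_inv_cancel, Homeomorph.one_apply, abs_sub_comm] at this
    exact this
  · obtain ⟨w, hw⟩ := h.fix
    exact ⟨w, by conv_lhs => rw [← hw, inv_K_apply]⟩
  · refine h.fin.subset ?_
    rintro y ⟨n, hn, j, hj⟩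
    refine ⟨n, hn, -j, ?_⟩
    rw [inv_pow, inv_pow_axis h.rev] at hj
    simp only at hj
    push_cast
    linarith

lemma Pre.upper {G : St ≃ₜ St} (h : Pre G) :
    ∃ M : ℝ, ∀ (n : ℕ) (y : I), ((G ^ n) (0, y)).1 ≤ M := by
  obtain ⟨D, hD⟩ := h.disp
  have hD0 : 0 ≤ D := (abs_nonneg _).trans (hD (0, 0))
  obtain ⟨w, hw⟩ := h.fix
  obtain ⟨c, hc⟩ := exists_nat_gt |w.1|
  have hwc := abs_lt.1 hc
  have hlow : ∀ n : ℕ, ∃ y : I, ((G ^ n) (0, y)).1 ≤ 2 * c := by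
    intro n
    by_contra hcon
    push Not at hcon
    have hfixn : (G ^ n) w = w := by
      clear hcon
      induction n with
      | zero => simp
      | succ n ih => rw [pow_succ, Homeomorph.mul_apply, hw, ih]
    have h1 := right_side (K := G ^ n) (M := -(2 * c : ℝ)) (disp_pow hD n)
      (fun y => by rw [neg_neg]; exact (hcon y).le) ((TS ^ (c : ℤ)) w)
      (by rw [TS_zpow]; simp; linarith)
    rw [comm_pow h.comm, hfixn, TS_zpow] at h1
    simp at h1
    linarith
  have hfinS : {n : ℕ | ∃ y : I, ((G ^ n) (0, y)).1 = 2 * c + 1}.Finite := by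
    have hex : ∀ n : ℕ, n ∈ {n : ℕ | ∃ y : I, ((G ^ n) (0, y)).1 = 2 * c + 1} →
      ∃ y : I, ((G ^ n) (0, y)).1 = 2 * c + 1 := fun n hn => hn
    choose! Y hY using hex
    have hret : ∀ n ∈ {n : ℕ | ∃ y : I, ((G ^ n) (0, y)).1 = 2 * c + 1},
        ((G ^ n) (0, Y n)).1 = (((2 * (2 * c + 1) : ℤ)) : ℝ) / 2 := by
      intro n hn
      rw [hY n hn]; push_cast; ring
    refine Set.Finite.of_finite_image (f := Y) (h.fin.subset ?_) ?_
    · rintro _ ⟨n, hn, rfl⟩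
      refine ⟨n, ?_, _, hret n hn⟩
      rcases Nat.eq_zero_or_pos n with h0 | h0
      · have := hY n hn
        subst h0
        simp at this
        have hc0 : (0 : ℝ) ≤ c := Nat.cast_nonneg c
        linarith
      · exact h0
    · intro n hn n' hn' hYY
      have e1 := iter_return h.comm (half_return h.comm h.rev (hret n hn)) n'
      have e2 := iter_return h.comm (half_return h.comm h.rev (hret n' hn')) n
      rw [← hYY, show 2 * n' * n = 2 * n * n' by ring, e1] at e2
      have e3 := congrArg Prod.fst e2
      simp only at e3
      have hpos : ((2 * (2 * c + 1) : ℤ) : ℝ) ≠ 0 := by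
        have : (2 * (2 * (c : ℤ) + 1)) ≠ 0 := by omega
        exact_mod_cast this
      have e4 := mul_right_cancel₀ hpos e3
      exact_mod_cast e4.symm
  obtain ⟨N, hN⟩ := hfinS.bddAbove
  refine ⟨max (2 * c + 1) (N * D), fun n y => ?_⟩
  by_cases hle : ((G ^ n) (0, y)).1 ≤ 2 * c + 1
  · exact hle.trans (le_max_left _ _)
  · push Not at hle
    obtain ⟨y0, hy0⟩ := hlow n
    have hcont : Continuous fun y : I => ((G ^ n) (0, y)).1 := by
      have := (G ^ n).continuous
      fun_prop
    obtain ⟨y1, hy1⟩ := mem_range_of_exists_le_of_exists_ge hcont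
      ⟨y0, hy0.trans (by linarith : (2 * c : ℝ) ≤ 2 * c + 1)⟩ ⟨y, hle.le⟩
    have hnN : n ≤ N := hN ⟨y1, hy1⟩
    have h2 := disp_pow hD n (0, y)
    have h3 : ((n : ℝ)) * D ≤ N * D := by gcongr
    have h4 := le_abs_self (((G ^ n) (0, y)).1 - (0 : ℝ))
    refine le_trans ?_ (le_max_right _ _)
    simp only at h2
    linarith

lemma Pre.bounded {G : St ≃ₜ St} (h : Pre G) :
    ∃ M : ℝ, ∀ (n : ℕ) (y : I), |((G ^ n) (0, y)).1| ≤ M := by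
  obtain ⟨M, hM⟩ := h.upper
  obtain ⟨M', hM'⟩ := h.inv.upper
  refine ⟨max M M', fun n y => abs_le.2 ⟨?_, (hM n y).trans (le_max_left _ _)⟩⟩
  have := hM' n y
  rw [inv_pow, inv_pow_axis h.rev] at this
  simp only at this
  have := le_max_right M M'
  linarith

lemma bd_dichotomy (G : St ≃ₜ St) (e : I) (he : e = 0 ∨ e = 1) :
    (∀ x, (G (x, e)).2 = 0) ∨ (∀ x, (G (x, e)).2 = 1) := by
  have hv : ∀ x, (G (x, e)).2 = 0 ∨ (G (x, e)).2 = 1 := by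
    intro x
    by_contra hcon
    push Not at hcon
    refine interior_pres G⁻¹ (G (x, e)) ?_ ?_ ?_
    · intro h; exact hcon.1 (Subtype.ext h)
    · intro h; exact hcon.2 (Subtype.ext h)
    · rw [inv_K_apply]; exact he
  by_contra hcon
  push Not at hcon
  obtain ⟨⟨a, ha⟩, ⟨b, hb⟩⟩ := hcon
  have ha1 := (hv a).resolve_left ha
  have hb0 := (hv b).resolve_right hb
  have hcont : Continuous fun x : ℝ => (((G (x, e)).2 : I) : ℝ) := by
    have := G.continuous
    fun_prop
  obtain ⟨x, hx⟩ := mem_range_of_exists_le_of_exists_ge hcont (c := 1 / 2)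
    ⟨b, by rw [hb0]; norm_num⟩ ⟨a, by rw [ha1]; norm_num⟩
  have hx' : (((G (x, e)).2 : I) : ℝ) = 1 / 2 := hx
  rcases hv x with h | h <;> rw [h] at hx' <;> norm_num at hx'

lemma bd_sq (G : St ≃ₜ St) :
    (∀ x, ((G * G) (x, 0)).2 = 0) ∧ (∀ x, ((G * G) (x, 1)).2 = 1) := by
  have hsurj : ∀ e e' : I, (e' = 0 ∨ e' = 1) → (∀ x, (G (x, 0)).2 = e) → (∀ x, (G (x, 1)).2 = e) →
      e = e' := by
    intro e e' he' h0 h1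
    by_contra hne
    have hq : G (G⁻¹ (0, e')) = (0, e') := K_inv_apply _ _
    by_cases hq0 : (G⁻¹ (0, e')).2 = 0
    · have := h0 (G⁻¹ (0, e')).1
      rw [← hq0] at this
      rw [Prod.mk.eta, hq] at this
      exact hne this.symm
    · by_cases hq1 : (G⁻¹ (0, e')).2 = 1
      · have := h1 (G⁻¹ (0, e')).1
        rw [← hq1] at this
        rw [Prod.mk.eta, hq] at this
        exact hne this.symm
      · refine interior_pres G (G⁻¹ (0, e')) ?_ ?_ ?_
        · intro h; exact hq0 (Subtype.ext h)
        · intro h; exact hq1 (Subtype.ext h)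
        · rw [hq]; exact he'
  have step : ∀ a b : I, (∀ x, (G (x, a)).2 = b) → ∀ x, G (x, a) = ((G (x, a)).1, b) := by
    intro a b h x
    exact Prod.ext rfl (h x)
  rcases bd_dichotomy G 0 (Or.inl rfl) with h0 | h0 <;>
    rcases bd_dichotomy G 1 (Or.inr rfl) with h1 | h1
  · exact absurd (hsurj 0 1 (Or.inr rfl) h0 h1) (by norm_num)
  · constructor <;> intro x <;> rw [Homeomorph.mul_apply]
    · rw [step _ _ h0, h0]
    · rw [step _ _ h1, h1]
  · constructor <;> intro x <;> rw [Homeomorph.mul_apply]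
    · rw [step _ _ h0, h1]
    · rw [step _ _ h1, h0]
  · exact absurd (hsurj 1 0 (Or.inl rfl) h0 h1) (by norm_num)

lemma bd_mono {K : St ≃ₜ St} (hc : K * TS = TS * K) (e : I) (he : ∀ x, (K (x, e)).2 = e) :
    StrictMono fun x : ℝ => (K (x, e)).1 := by
  have hcont : Continuous fun x : ℝ => (K (x, e)).1 := by
    have := K.continuous
    fun_prop
  have hinj : Function.Injective fun x : ℝ => (K (x, e)).1 := by
    intro a b hab
    have : K (a, e) = K (b, e) := Prod.ext hab ((he a).trans (he b).symm)
    exact congrArg Prod.fst (K.injective this)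
  rcases hcont.strictMono_of_inj hinj with h | h
  · exact h
  · exfalso
    have h1 : (K (1, e)).1 < (K (0, e)).1 := h one_pos
    have h2 : K (TS (0, e)) = TS (K (0, e)) := by
      rw [← Homeomorph.mul_apply, hc, Homeomorph.mul_apply]
    simp only [TS_apply, zero_add] at h2
    rw [h2] at h1
    simp only at h1
    linarith

lemma Pre.core {G : St ≃ₜ St} (h : Pre G) : ∃ (N : ℕ) (M : ℝ), Core (G ^ N) M := by
  classical
  obtain ⟨M, hM⟩ := h.bounded
  obtain ⟨D, hD⟩ := h.disp
  have hQ0 : {y : I | ∃ n : ℕ, 1 ≤ n ∧ ((G ^ n) (0, y)).1 = 0}.Finite := by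
    refine h.fin.subset ?_
    rintro y ⟨n, hn, h0⟩
    exact ⟨n, hn, 0, by simpa using h0⟩
  have hex : ∀ y : I, (∃ n : ℕ, 1 ≤ n ∧ ((G ^ n) (0, y)).1 = 0) →
    ∃ n : ℕ, 1 ≤ n ∧ ((G ^ n) (0, y)).1 = 0 := fun y hy => hy
  choose! T hT1 hT0 using hex
  set P : ℕ := ∏ y ∈ hQ0.toFinset, T y with hP
  have hP1 : 1 ≤ P := by
    refine Nat.one_le_iff_ne_zero.2 (Finset.prod_ne_zero_iff.2 fun y hy => ?_)
    have := hT1 y (hQ0.mem_toFinset.1 hy)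
    omega
  have hfix : ∀ y : I, (∃ n : ℕ, 1 ≤ n ∧ ((G ^ n) (0, y)).1 = 0) →
      (G ^ (2 * P)) (0, y) = (0, y) := by
    intro y hy
    have h1 := half_return (j := 0) h.comm h.rev (n := T y) (y := y) (by simpa using hT0 y hy)
    obtain ⟨b, hb⟩ : T y ∣ P := Finset.dvd_prod_of_mem T (hQ0.mem_toFinset.2 hy)
    have h2 := iter_return h.comm h1 b
    rw [hb, ← mul_assoc, h2]; simp
  have hcN : G ^ (2 * P) * TS = TS * G ^ (2 * P) :=
    (show Commute G TS from h.comm).pow_left _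
  have hsq : G ^ (2 * P) = G ^ P * G ^ P := by rw [two_mul, pow_add]
  have hbd := bd_sq (G ^ P)
  rw [← hsq] at hbd
  refine ⟨2 * P, M, rev_pow h.rev _, ⟨_, disp_pow hD _⟩, hbd.1, bd_mono hcN 0 hbd.1, hbd.2,
    bd_mono hcN 1 hbd.2, ?_, ?_, ?_⟩
  · intro n y
    rw [← pow_mul]; exact hM _ _
  · refine h.fin.subset fun y hy => ⟨2 * P, by omega, 0, ?_⟩
    have hy' : (G ^ (2 * P)) (0, y) = (0, y) := hy
    rw [hy']; simp
  · intro n y hn h0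
    refine hfix y ⟨2 * P * n, ?_, ?_⟩
    · exact Nat.mul_pos (by omega) hn
    · rw [pow_mul]; exact h0


lemma prj_pow {K : St ≃ₜ St} {g : AnnC → AnnC} (hg : ∀ w, prj (K w) = g (prj w)) (n : ℕ) (w : St) :
    prj ((K ^ n) w) = g^[n] (prj w) := by
  induction n generalizing w with
  | zero => simp
  | succ n ih => rw [pow_succ, Homeomorph.mul_apply, ih, hg, Function.iterate_succ_apply]

lemma coe_pow_iter (f : AnnC ≃ₜ AnnC) (n : ℕ) : ⇑(f ^ n) = (⇑f)^[n] := by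
  induction n with
  | zero => rfl
  | succ n ih =>
    funext w
    rw [pow_succ, Homeomorph.mul_apply, ih, Function.iterate_succ_apply]

theorem main (f : AnnC ≃ₜ AnnC)
    (hiso : IsotopicToIdC f) (harea : PreservesFiniteAreaC f)
    (hrev : ∀ z, f (RC z) = RC (f.symm z))
    (z : AnnC) (k : ℕ) (hk : 1 ≤ k) (hz : (⇑f)^[k] z = z) :
    {w : AnnC | (∃ m : ℕ, 1 ≤ m ∧ (⇑f)^[m] w = w) ∧
      (∃ j : ℕ, RC w = (⇑f)^[j] w)}.Infinite := by
  intro hfin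
  obtain ⟨μ, hμ, -, hpos, hmp⟩ := harea
  obtain ⟨F, hF, hFT, D, hD⟩ := exists_lift hiso
  have hFr := lift_rev hrev hF hFT
  obtain ⟨x, hx⟩ := QuotientAddGroup.mk_surjective z.1
  have hzt : prj (x, z.2) = z := Prod.ext hx rfl
  have hFk := prj_pow hF k
  obtain ⟨p, hp1, hp2⟩ := prj_eq (u := (x, z.2)) (v := (F ^ k) (x, z.2)) (by rw [hFk, hzt, hz])
  have hFkT : Commute (F ^ k) TS := (show Commute F TS from hFT).pow_left k
  set G : St ≃ₜ St := TS ^ (-p) * F ^ k with hG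
  have hGprj : ∀ w, prj (G w) = (⇑f)^[k] (prj w) := by
    intro w
    rw [hG, Homeomorph.mul_apply, prj_TS, hFk]
  have hcomm : G * TS = TS * G :=
    Commute.mul_left ((Commute.refl TS).zpow_left (-p)) hFkT
  have hGr : RS * G * RS = G⁻¹ := by
    calc RS * G * RS = RS * TS ^ (-p) * (RS * RS) * F ^ k * RS := by
          rw [hG, RS_mul_RS]; simp [mul_assoc]
      _ = (RS * TS ^ (-p) * RS) * (RS * F ^ k * RS) := by simp only [mul_assoc]
      _ = TS ^ (-(-p)) * (F ^ k)⁻¹ := by rw [RS_TS_zpow, rev_pow hFr]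
      _ = (F ^ k)⁻¹ * TS ^ (-(-p)) := ((hFkT.inv_left).zpow_right _).eq.symm
      _ = G⁻¹ := by rw [hG, mul_inv_rev, zpow_neg TS (-p)]
  have hpre : Pre G := by
    refine ⟨hcomm, hGr, ⟨k * D + |(p : ℝ)|, fun w => ?_⟩, ⟨(x, z.2), ?_⟩, ?_⟩
    · rw [hG, Homeomorph.mul_apply, TS_zpow]
      have h1 := abs_le.1 (disp_pow hD k w)
      have h2 := le_abs_self (p : ℝ)
      have h3 := neg_abs_le (p : ℝ)
      simp only
      push_cast
      rw [abs_le]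
      constructor <;> linarith [h1.1, h1.2]
    · rw [hG, Homeomorph.mul_apply, TS_zpow]
      refine Prod.ext ?_ hp2
      simp only [hp1]
      push_cast
      ring
    · have hinj : Function.Injective fun y : I => prj (0, y) := by
        intro a b hab
        exact congrArg (fun q : AnnC => q.2) hab
      refine (hfin.preimage hinj.injOn).subset ?_
      rintro y ⟨n, hn, j, hj⟩
      have h1 := half_return hcomm hGr hj
      have h2 := prj_pow hGprj (2 * n) (0, y)
      rw [h1, ← Function.iterate_mul] at h2
      have h3 : prj ((j : ℝ), y) = prj (0, y) := by
        have := prj_add 0 j y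
        rwa [zero_add] at this
      refine ⟨⟨k * (2 * n), Nat.mul_pos hk (by omega), ?_⟩, 0, ?_⟩
      · rw [← h2, h3]
      · simp [RC, prj]
  obtain ⟨N, M, hcore⟩ := hpre.core
  refine hcore.measure_false (f ^ (k * N)) ?_ μ hμ hpos ?_
  · intro w
    rw [coe_pow_iter, prj_pow hGprj, ← Function.iterate_mul]
  · rw [coe_pow_iter]; exact hmp.iterate _


end FranksRev

/-- A reversible area-preserving homeomorphism of the closed annulus isotopic to
the identity with at least one periodic point has infinitely many symmetric
periodic points. -/
theorem franks_reversible_symmetric (f : AnnC ≃ₜ AnnC)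
    (hiso : IsotopicToIdC f) (harea : PreservesFiniteAreaC f)
    (hrev : ∀ z, f (RC z) = RC (f.symm z))
    (z : AnnC) (k : ℕ) (hk : 1 ≤ k) (hz : (⇑f)^[k] z = z) :
    {w : AnnC | (∃ m : ℕ, 1 ≤ m ∧ (⇑f)^[m] w = w) ∧
      (∃ j : ℕ, RC w = (⇑f)^[j] w)}.Infinite :=
  FranksRev.main f hiso harea hrev z k hk hz
end

section
/- Let f be a homeomorphism of the closed annulus A = (ℝ/ℤ) × [0,1] that is isotopic to the identity, preserves a finite area, and is reversible. Let k, n₀ ≥ 1 be integers with gcd(k, n₀) = 1. If f has a point z with f^[k](z) = z, then the set of symmetric periodic points of f whose minimal period is a positive integer coprime to n₀ is infinite. -/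
open MeasureTheory Filter Topology

section

lemma log_lift {Z : Type*} [TopologicalSpace Z] (ρ : unitInterval × Z → ℂ) (hc : Continuous ρ)
    (h0 : ∀ x, ρ x ≠ 0) (h1 : ∀ z, ρ (0, z) = 1) :
    ∃ φ : unitInterval × Z → ℂ, Continuous φ ∧ (∀ z, φ (0, z) = 0) ∧
      ∀ x, Complex.exp (φ x) = ρ x := by
  have cov := Complex.isCoveringMap_exp
  let H : C(unitInterval × Z, {z : ℂ // z ≠ 0}) := ⟨fun x => ⟨ρ x, h0 x⟩, by fun_prop⟩
  let f0 : C(Z, ℂ) := ContinuousMap.const Z 0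
  have H0 : ∀ a, H (0, a) = (fun z : ℂ ↦ (⟨_, z.exp_ne_zero⟩ : {z : ℂ // z ≠ 0})) (f0 a) := by
    intro a
    apply Subtype.ext
    simp [H, f0, h1]
  refine ⟨cov.liftHomotopy H f0 H0, (cov.liftHomotopy H f0 H0).continuous, ?_, ?_⟩
  · intro z
    exact cov.liftHomotopy_zero H f0 H0 z
  · intro x
    have := congrFun (cov.liftHomotopy_lifts H f0 H0) x
    exact congrArg Subtype.val this

lemma exp_const {Z : Type*} [TopologicalSpace Z] [PreconnectedSpace Z] (d : Z → ℂ)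
    (hd : Continuous d) (h : ∀ z z', Complex.exp (d z) = Complex.exp (d z')) (z z' : Z) :
    d z = d z' := by
  have cov := Complex.isCoveringMap_exp
  have := cov.eq_of_comp_eq hd (continuous_const (y := d z')) (by
    funext x
    exact Subtype.ext (h x z')) z' rfl
  exact congrFun this z

lemma square_lift (v : unitInterval × unitInterval → ℂ) (hc : Continuous v)
    (h0 : ∀ x, v x ≠ 0) :
    ∃ u : unitInterval × unitInterval → ℂ, Continuous u ∧ ∀ x, Complex.exp (u x) = v x := by
  obtain ⟨φ, hφ, h1, h2⟩ := log_lift (Z := unitInterval × unitInterval)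
    (fun x => v (x.1 * x.2.1, x.1 * x.2.2) / v (0, 0)) (by fun_prop)
    (fun x => div_ne_zero (h0 _) (h0 _)) (by intro z; simp [h0])
  refine ⟨fun x => φ (1, x) + Complex.log (v (0, 0)), by fun_prop, ?_⟩
  intro x
  rw [Complex.exp_add, h2, Complex.exp_log (h0 _)]
  simp [h0]

end

section

/-- Domains in the plane invariant under conjugation and the translation by `τ i`. -/
structure Dom (Y : Set ℂ) (τ : ℝ) : Prop where
  conj : ∀ w ∈ Y, (starRingEnd ℂ) w ∈ Y
  add : ∀ w ∈ Y, w + τ * Complex.I ∈ Y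
  sub : ∀ w ∈ Y, w - τ * Complex.I ∈ Y
  slice : ∀ c : ℝ, Set.OrdConnected {x : ℝ | (⟨x, c⟩ : ℂ) ∈ Y}
  conn : ∀ O : Set ℝ, O.OrdConnected → IsPreconnected {η : Y | (η : ℂ).im ∈ O}
  ne : ∀ c : ℝ, ∃ w : Y, (w : ℂ).im = c
  pos : 0 < τ

namespace Dom
variable {Y : Set ℂ} {τ : ℝ}

/-- Complex conjugation. -/
def c (D : Dom Y τ) : Y ≃ₜ Y where
  toFun w := ⟨(starRingEnd ℂ) w, D.conj _ w.2⟩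
  invFun w := ⟨(starRingEnd ℂ) w, D.conj _ w.2⟩
  left_inv w := Subtype.ext (by simp)
  right_inv w := Subtype.ext (by simp)
  continuous_toFun := by
    have : Continuous (starRingEnd ℂ) := Complex.continuous_conj
    fun_prop
  continuous_invFun := by
    have : Continuous (starRingEnd ℂ) := Complex.continuous_conj
    fun_prop

/-- Translation. -/
def T (D : Dom Y τ) : Y ≃ₜ Y where
  toFun w := ⟨w + τ * Complex.I, D.add _ w.2⟩
  invFun w := ⟨w - τ * Complex.I, D.sub _ w.2⟩
  left_inv w := Subtype.ext (by simp)
  right_inv w := Subtype.ext (by simp)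
  continuous_toFun := by fun_prop
  continuous_invFun := by fun_prop

variable (D : Dom Y τ)

@[simp] lemma c_coe (w : Y) : ((D.c w : Y) : ℂ) = (starRingEnd ℂ) (w : ℂ) := rfl
@[simp] lemma T_coe (w : Y) : ((D.T w : Y) : ℂ) = w + τ * Complex.I := rfl
@[simp] lemma c_c (w : Y) : D.c (D.c w) = w := Subtype.ext (by simp)
lemma cc : D.c * D.c = 1 := by ext1 w; exact D.c_c w
@[simp] lemma c_inv : D.c⁻¹ = D.c := inv_eq_of_mul_eq_one_left D.cc
lemma Tinv_coe (w : Y) : ((D.T⁻¹ w : Y) : ℂ) = w - τ * Complex.I := rfl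

lemma cTc : D.c * D.T * D.c = D.T⁻¹ := by
  ext1 w
  apply Subtype.ext
  rw [Tinv_coe]
  simp [Homeomorph.mul_apply, sub_eq_add_neg]

lemma Tzpow_coe (m : ℤ) (w : Y) : (((D.T ^ m) w : Y) : ℂ) = w + m * τ * Complex.I := by
  induction m with
  | zero => simp
  | succ n ih =>
    rw [add_comm, zpow_add, Homeomorph.mul_apply, zpow_one, T_coe, ih]
    push_cast; ring
  | pred n ih =>
    rw [sub_eq_add_neg, add_comm, zpow_add, Homeomorph.mul_apply, zpow_neg_one, Tinv_coe, ih]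
    push_cast; ring

/-- A homeomorphism as a continuous map to the plane. -/
noncomputable def em (_ : Dom Y τ) (g : Y ≃ₜ Y) : C(Y, ℂ) := ⟨fun w => (g w : ℂ), by fun_prop⟩

@[simp] lemma em_apply (g : Y ≃ₜ Y) (w : Y) : D.em g w = (g w : ℂ) := rfl

/-- Injective equivariant maps. -/
def P (D : Dom Y τ) (E : C(Y, ℂ)) : Prop :=
  Function.Injective E ∧ ∀ w, E (D.T w) = E w + τ * Complex.I

/-- equivariant isotopy -/
def Iso (D : Dom Y τ) (g h : Y ≃ₜ Y) : Prop :=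
  ContinuousMap.HomotopicWith (D.em g) (D.em h) D.P

variable {D}

lemma Iso.of {g h : Y ≃ₜ Y} (E : unitInterval × Y → ℂ) (hE : Continuous E)
    (h0 : ∀ w, E (0, w) = (g w : ℂ)) (h1 : ∀ w, E (1, w) = (h w : ℂ))
    (hi : ∀ t w w', E (t, w) = E (t, w') → w = w')
    (he : ∀ t w, E (t, D.T w) = E (t, w) + τ * Complex.I) : D.Iso g h :=
  ⟨{ toFun := E
     continuous_toFun := hE
     map_zero_left := h0
     map_one_left := h1
     prop' := fun t => ⟨fun w w' h => hi t w w' h, fun w => he t w⟩ }⟩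

lemma Iso.get {g h : Y ≃ₜ Y} (H : D.Iso g h) : ∃ E : unitInterval × Y → ℂ, Continuous E ∧
    (∀ w, E (0, w) = (g w : ℂ)) ∧ (∀ w, E (1, w) = (h w : ℂ)) ∧
    (∀ t w w', E (t, w) = E (t, w') → w = w') ∧
    (∀ t w, E (t, D.T w) = E (t, w) + τ * Complex.I) := by
  obtain ⟨F⟩ := H
  refine ⟨fun x => F x, F.continuous, fun w => F.apply_zero w, fun w => F.apply_one w, ?_, ?_⟩
  · intro t w w' h
    exact (F.prop t).1 h
  · intro t w
    exact (F.prop t).2 w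

lemma Iso.symm {g h : Y ≃ₜ Y} (H : D.Iso g h) : D.Iso h g := ContinuousMap.HomotopicWith.symm H
lemma Iso.trans {g h k : Y ≃ₜ Y} (H : D.Iso g h) (H' : D.Iso h k) : D.Iso g k :=
  ContinuousMap.HomotopicWith.trans H H'

lemma Iso.comp {g h k : Y ≃ₜ Y} (H : D.Iso g h) (hk : Commute k D.T) :
    D.Iso (g * k) (h * k) := by
  obtain ⟨E, h1, h2, h3, h4, h5⟩ := H.get
  refine Iso.of (fun x => E (x.1, k x.2)) (by fun_prop) (fun w => h2 _) (fun w => h3 _)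
    (fun t w w' h => k.injective (h4 _ _ _ h)) ?_
  intro t w
  have : k (D.T w) = D.T (k w) := DFunLike.congr_fun hk.eq w
  simp only [this, h5]

variable (D)

/-- Reversible systems. -/
structure Sys (g : Y ≃ₜ Y) : Prop where
  comm : Commute g D.T
  rev : D.c * g * D.c = g⁻¹
  iso : D.Iso 1 g

variable {D}

lemma Sys.mul {g h : Y ≃ₜ Y} (hg : D.Sys g) (hh : D.Sys h) (hc : Commute g h) :
    D.Sys (g * h) where
  comm := hg.comm.mul_left hh.comm
  rev := by
    have : D.c * (g * h) * D.c = (D.c * g * D.c) * (D.c * h * D.c) := by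
      calc _ = D.c * g * 1 * h * D.c := by group
        _ = _ := by rw [← D.cc]; group
    rw [this, hg.rev, hh.rev, ← mul_inv_rev, hc.eq]
  iso := hh.iso.trans (by simpa using hg.iso.comp hh.comm)

lemma Sys.one : D.Sys 1 where
  comm := Commute.one_left _
  rev := by simp [D.cc]
  iso := by
    refine Iso.of (fun x => (x.2 : ℂ)) (by fun_prop) (fun w => rfl) (fun w => rfl)
      (fun t w w' h => Subtype.ext h) (fun t w => rfl)

lemma Sys.inv {g : Y ≃ₜ Y} (hg : D.Sys g) : D.Sys g⁻¹ where
  comm := hg.comm.inv_left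
  rev := by
    rw [inv_inv]
    calc _ = D.c * (D.c * g * D.c) * D.c := by rw [hg.rev]
      _ = (D.c * D.c) * g * (D.c * D.c) := by simp only [mul_assoc]
      _ = _ := by rw [D.cc]; simp
  iso := by simpa using (hg.iso.comp hg.comm.inv_left).symm

lemma Sys.pow {g : Y ≃ₜ Y} (hg : D.Sys g) (n : ℕ) : D.Sys (g ^ n) := by
  induction n with
  | zero => simpa using Sys.one
  | succ n ih => rw [pow_succ]; exact ih.mul hg ((Commute.refl g).pow_left n)

lemma Sys.zpow {g : Y ≃ₜ Y} (hg : D.Sys g) (n : ℤ) : D.Sys (g ^ n) := by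
  cases n with
  | ofNat n => simpa using hg.pow n
  | negSucc n => rw [zpow_negSucc]; exact (hg.pow _).inv

lemma Sys.T : D.Sys D.T where
  comm := Commute.refl _
  rev := D.cTc
  iso := by
    refine Iso.of (fun x => (x.2 : ℂ) + x.1 * τ * Complex.I) (by fun_prop)
      (fun w => by simp) (fun w => by simp) ?_ ?_
    · intro t w w' h
      exact Subtype.ext (by simpa using h)
    · intro t w
      simp only [T_coe]; ring

lemma Sys.Tmul {g : Y ≃ₜ Y} (hg : D.Sys g) (m : ℤ) : D.Sys (D.T ^ m * g) :=
  (Sys.T.zpow m).mul hg (hg.comm.symm.zpow_left m)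

lemma Sys.inv_apply {g : Y ≃ₜ Y} (hg : D.Sys g) (w : Y) : g⁻¹ w = D.c (g (D.c w)) := by
  rw [← hg.rev]; rfl

lemma Sys.apply_T {g : Y ≃ₜ Y} (hg : D.Sys g) (w : Y) : g (D.T w) = D.T (g w) :=
  DFunLike.congr_fun hg.comm.eq w

lemma Sys.apply_Tz {g : Y ≃ₜ Y} (hg : D.Sys g) (m : ℤ) (w : Y) :
    g ((D.T ^ m) w) = (D.T ^ m) (g w) :=
  DFunLike.congr_fun (hg.comm.zpow_right m).eq w

/-- The separation lemma. -/
lemma Sys.sep {g : Y ≃ₜ Y} (hg : D.Sys g) (γ : unitInterval → Y) (hγ : Continuous γ)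
    (h1 : γ 1 = g (D.c (γ 0))) : ∃ s, g (D.c (γ s)) = γ s := by
  by_contra! hne
  obtain ⟨E, hE, E0, E1, Ei, -⟩ := hg.iso.get
  have hSS : ∀ w, g (D.c (g (D.c w))) = w := by
    intro w
    have := hg.inv_apply w
    have h2 : g (g⁻¹ w) = w := g.apply_symm_apply w
    rw [this] at h2
    have h3 := congrArg D.c (hg.inv_apply (D.c w))
    have h4 : g⁻¹ (g (D.c w)) = D.c w := g.symm_apply_apply _
    rw [hg.inv_apply] at h4
    have h5 := congrArg D.c h4
    simpa using h5
  let v : unitInterval × unitInterval → ℂ :=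
    fun x => E (x.1, D.c (g (D.c (γ x.2)))) - E (x.1, D.c (γ x.2))
  have hv : Continuous v := by fun_prop
  have hv0 : ∀ x, v x ≠ 0 := by
    intro x hx
    have := Ei _ _ _ (sub_eq_zero.1 hx)
    exact hne x.2 (D.c.injective this)
  obtain ⟨u, hu, huv⟩ := square_lift v hv hv0
  have hvneg : ∀ t, v (t, 1) = - v (t, 0) := by
    intro t
    simp only [v, h1, hSS]
    ring
  have hdc : ∀ t t', u (t, 1) - u (t, 0) = u (t', 1) - u (t', 0) := by
    have hd : ∀ t, Complex.exp (u (t, 1) - u (t, 0)) = -1 := by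
      intro t
      rw [Complex.exp_sub, huv, huv, hvneg, neg_div, div_self (hv0 _)]
    exact exp_const (fun t => u (t, 1) - u (t, 0)) (by fun_prop)
      (fun t t' => by rw [hd, hd])
  have hconj : ∀ s s', (starRingEnd ℂ) (u (0, s)) - u (1, s) =
      (starRingEnd ℂ) (u (0, s')) - u (1, s') := by
    have hcc : Continuous (starRingEnd ℂ) := Complex.continuous_conj
    have hd : ∀ s, Complex.exp ((starRingEnd ℂ) (u (0, s)) - u (1, s)) = -1 := by
      intro s
      rw [Complex.exp_sub, Complex.exp_conj, huv, huv]
      have e0 : (starRingEnd ℂ) (v (0, s)) = - v (1, s) := by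
        simp only [v, E0, E1, hSS]
        simp
      rw [e0, neg_div, div_self (hv0 _)]
    exact exp_const (fun s => (starRingEnd ℂ) (u (0, s)) - u (1, s)) (by fun_prop)
      (fun t t' => by rw [hd, hd])
  have k1 := hdc 0 1
  have k2 := hconj 0 1
  have k3 : (starRingEnd ℂ) (u (0, 1) - u (0, 0)) = u (0, 1) - u (0, 0) := by
    rw [map_sub]
    linear_combination k1.symm - k2
  have k4 : Complex.exp (u (0, 1) - u (0, 0)) = -1 := by
    rw [Complex.exp_sub, huv, huv, hvneg, neg_div, div_self (hv0 _)]
  obtain ⟨r, hr⟩ := Complex.conj_eq_iff_real.1 k3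
  rw [hr, ← Complex.ofReal_exp] at k4
  have : Real.exp r = -1 := by exact_mod_cast k4
  linarith [Real.exp_pos r]

end Dom

end

section

namespace Dom
variable {Y : Set ℂ} {τ : ℝ} {D : Dom Y τ}

@[simp] lemma c_im (w : Y) : ((D.c w : Y) : ℂ).im = - (w : ℂ).im := by simp
@[simp] lemma c_re (w : Y) : ((D.c w : Y) : ℂ).re = (w : ℂ).re := by simp
@[simp] lemma Tz_im (m : ℤ) (w : Y) : (((D.T ^ m) w : Y) : ℂ).im = (w : ℂ).im + m * τ := by
  simp [Tzpow_coe]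
@[simp] lemma Tz_re (m : ℤ) (w : Y) : (((D.T ^ m) w : Y) : ℂ).re = (w : ℂ).re := by
  simp [Tzpow_coe]

lemma Sys.line {g : Y ≃ₜ Y} (hg : D.Sys g) (η ξ : Y) (c : ℝ) (h : g η = ξ)
    (hη : (η : ℂ).im = -c) (hξ : (ξ : ℂ).im = c) :
    ∃ ω : Y, (ω : ℂ).im = c ∧ g (D.c ω) = ω ∧
      (ω : ℂ).re ∈ Set.uIcc (η : ℂ).re (ξ : ℂ).re := by
  have hm : ∀ s : unitInterval, (⟨(1 - s) * (η : ℂ).re + s * (ξ : ℂ).re, c⟩ : ℂ) ∈ Y ∧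
      (1 - s) * (η : ℂ).re + s * (ξ : ℂ).re ∈ Set.uIcc (η : ℂ).re (ξ : ℂ).re := by
    intro s
    have hmem : (1 - s) * (η : ℂ).re + s * (ξ : ℂ).re ∈ Set.uIcc (η : ℂ).re (ξ : ℂ).re := by
      rw [← segment_eq_uIcc]
      exact ⟨1 - s, s, by linarith [s.2.2], s.2.1, by ring, rfl⟩
    refine ⟨?_, hmem⟩
    have hoc := D.slice c
    have := hoc.uIcc_subset (x := (η : ℂ).re) (y := (ξ : ℂ).re) ?_ ?_ hmem
    · exact this
    · have := (D.c η).2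
      have e : ((D.c η : Y) : ℂ) = ⟨(η : ℂ).re, c⟩ := by
        apply Complex.ext <;> simp [hη]
      rwa [e] at this
    · have := ξ.2
      have e : (ξ : ℂ) = ⟨(ξ : ℂ).re, c⟩ := by
        apply Complex.ext <;> simp [hξ]
      show (⟨(ξ : ℂ).re, c⟩ : ℂ) ∈ Y
      rwa [e] at this
  let γ : unitInterval → Y := fun s => ⟨_, (hm s).1⟩
  have hγ : Continuous γ := by
    apply Continuous.subtype_mk
    have e : ∀ s : unitInterval, (⟨(1 - s) * (η : ℂ).re + s * (ξ : ℂ).re, c⟩ : ℂ) =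
        (((1 - s) * (η : ℂ).re + s * (ξ : ℂ).re : ℝ) : ℂ) + c * Complex.I := by
      intro s
      apply Complex.ext <;> simp
    simp_rw [e]
    fun_prop
  have g0 : γ 0 = D.c η := by
    apply Subtype.ext; apply Complex.ext <;> simp [γ, hη]
  have g1 : γ 1 = ξ := by
    apply Subtype.ext; apply Complex.ext <;> simp [γ, hξ]
  obtain ⟨s, hs⟩ := hg.sep γ hγ (by rw [g0, g1, c_c, h])
  exact ⟨γ s, rfl, hs, (hm s).2⟩

lemma Sys.noncross {g : Y ≃ₜ Y} (hg : D.Sys g) (v u' : Y) (a c : ℝ) (m : ℤ)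
    (hac : a + c = m * τ) (hv : (g v : ℂ).im = c) (hu' : u' = (D.T ^ m) (D.c (g v))) :
    (u' : ℂ).im = a ∧ (g u' : ℂ).im = c + a - (v : ℂ).im := by
  constructor
  · rw [hu', Tz_im, c_im, hv]; linarith
  · have h1 : v = D.c (g (D.c (g v))) := by
      rw [← hg.inv_apply]; exact (g.symm_apply_apply v).symm
    rw [hu', hg.apply_Tz, Tz_im]
    have h2 : (v : ℂ).im = - (g (D.c (g v)) : ℂ).im := by
      conv_lhs => rw [h1]
      rw [c_im]
    linarith

lemma im_ordConn (O : Set ℝ) (hO : O.OrdConnected) (φ : Y → Y) (hφ : Continuous φ) (D : Dom Y τ) :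
    ((fun η : Y => (φ η : ℂ).im) '' {η : Y | (η : ℂ).im ∈ O}).OrdConnected := by
  apply IsPreconnected.ordConnected
  exact (D.conn O hO).image _ (by fun_prop)

lemma Sys.hs_up {g : Y ≃ₜ Y} (hg : D.Sys g) (a c : ℝ) (m : ℤ) (hac : a + c = m * τ)
    (h : ∀ u : Y, (u : ℂ).im = a → c < (g u : ℂ).im) (u : Y) (hu : a ≤ (u : ℂ).im) :
    c < (g u : ℂ).im := by
  by_contra! hlt
  obtain ⟨u0, hu0⟩ := D.ne a
  have hoc := im_ordConn (Set.Ici a) Set.ordConnected_Ici g g.continuous D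
  obtain ⟨v, hv, hvc⟩ := hoc.out ⟨u, hu, rfl⟩ ⟨u0, hu0.ge, rfl⟩ ⟨hlt, (h u0 hu0).le⟩
  obtain ⟨h1, h2⟩ := hg.noncross v _ a c m hac hvc rfl
  have := h _ h1
  have hv' : a ≤ (v : ℂ).im := hv
  linarith

lemma Sys.hs_down {g : Y ≃ₜ Y} (hg : D.Sys g) (a c : ℝ) (m : ℤ) (hac : a + c = m * τ)
    (h : ∀ u : Y, (u : ℂ).im = a → (g u : ℂ).im < c) (u : Y) (hu : (u : ℂ).im ≤ a) :
    (g u : ℂ).im < c := by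
  by_contra! hlt
  obtain ⟨u0, hu0⟩ := D.ne a
  have hoc := im_ordConn (Set.Iic a) Set.ordConnected_Iic g g.continuous D
  obtain ⟨v, hv, hvc⟩ := hoc.out ⟨u0, hu0.le, rfl⟩ ⟨u, hu, rfl⟩ ⟨(h u0 hu0).le, hlt⟩
  obtain ⟨h1, h2⟩ := hg.noncross v _ a c m hac hvc rfl
  have := h _ h1
  have hv' : (v : ℂ).im ≤ a := hv
  linarith

/-- Construct a system from an isotopy whose end map is reversible up to translations. -/
lemma mkSys (D : Dom Y τ) (g : Y → Y) (E : unitInterval × Y → ℂ) (hE : Continuous E)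
    (E0 : ∀ w, E (0, w) = w) (E1 : ∀ w, E (1, w) = g w)
    (Ei : ∀ t w w', E (t, w) = E (t, w') → w = w')
    (Ee : ∀ t w, E (t, D.T w) = E (t, w) + τ * Complex.I)
    (hm : ∀ w, ∃ m : ℤ, D.c (g (D.c (g w))) = (D.T ^ m) w) :
    ∃ G : Y ≃ₜ Y, (∀ w, G w = g w) ∧ D.Sys G := by
  have hgc : Continuous g := by
    rw [continuous_induced_rng]
    have : Subtype.val ∘ g = fun w => E (1, w) := by funext w; exact (E1 w).symm
    rw [this]; fun_prop
  have hgT : ∀ w, g (D.T w) = D.T (g w) := by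
    intro w
    apply Subtype.ext
    rw [← E1, Ee, E1]; rfl
  have hgTi : ∀ w, g (D.T⁻¹ w) = D.T⁻¹ (g w) := by
    intro w
    apply D.T.injective
    rw [← hgT]
    exact (congrArg g (D.T.apply_symm_apply w)).trans (D.T.apply_symm_apply _).symm
  have hgTz : ∀ m : ℤ, ∀ w, g ((D.T ^ m) w) = (D.T ^ m) (g w) := by
    intro m
    induction m with
    | zero => intro w; simp
    | succ n ih =>
      intro w
      rw [zpow_add_one, Homeomorph.mul_apply, ih, hgT, Homeomorph.mul_apply]
    | pred n ih =>
      intro w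
      rw [zpow_sub_one, Homeomorph.mul_apply, ih, hgTi, Homeomorph.mul_apply]
  have hτ : (τ : ℂ) ≠ 0 := by exact_mod_cast D.pos.ne'
  have hcTz : ∀ m : ℤ, ∀ w, D.c ((D.T ^ m) w) = (D.T ^ (-m)) (D.c w) := by
    intro m w
    apply Subtype.ext
    rw [Tzpow_coe, c_coe, Tzpow_coe]
    simp
  have hpc : PreconnectedSpace Y := by
    have := D.conn Set.univ Set.ordConnected_univ
    refine ⟨?_⟩
    convert this
    simp
  have hconst := exp_const (fun w : Y => 2 * Real.pi / τ * ((D.c (g (D.c (g w))) : ℂ) - w))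
    (by fun_prop) (by
      have : ∀ w : Y, Complex.exp (2 * Real.pi / τ * ((D.c (g (D.c (g w))) : ℂ) - w)) = 1 := by
        intro w
        obtain ⟨m, hm⟩ := hm w
        rw [hm, Tzpow_coe, Complex.exp_eq_one_iff]
        refine ⟨m, ?_⟩
        field_simp
        ring
      intro z z'
      rw [this, this])
  have hpi : (Real.pi : ℂ) ≠ 0 := by exact_mod_cast Real.pi_ne_zero
  have key : ∀ w, D.c (g (D.c (g w))) = w := by
    intro w
    obtain ⟨m, h1⟩ := hm w
    obtain ⟨m', h2⟩ := hm (D.c (g w))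
    have h3 := hconst w (D.c (g w))
    beta_reduce at h3
    rw [h2, h1, Tzpow_coe, Tzpow_coe] at h3
    have h4 : (m : ℂ) = m' := by
      field_simp at h3
      have h3' : (m : ℂ) * Complex.I = m' * Complex.I :=
        mul_left_cancel₀ hτ (by linear_combination h3)
      exact mul_right_cancel₀ Complex.I_ne_zero h3'
    have h4' : m = m' := by exact_mod_cast h4
    subst h4'
    rw [h1, hgTz, hcTz] at h2
    have h5 := congrArg (fun x : Y => (x : ℂ).im) h2
    simp only [Tz_im] at h5
    have h6 : (m : ℝ) * τ = 0 := by push_cast at h5; linarith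
    have h7 : (m : ℝ) = 0 := by
      rcases mul_eq_zero.1 h6 with h | h
      · exact h
      · exact absurd h D.pos.ne'
    have h8 : m = 0 := by exact_mod_cast h7
    rw [h1, h8]; simp
  let G : Y ≃ₜ Y :=
    { toFun := g
      invFun := fun w => D.c (g (D.c w))
      left_inv := key
      right_inv := fun w => by
        have := congrArg D.c (key (D.c w))
        simpa using this
      continuous_toFun := hgc
      continuous_invFun := by fun_prop }
  refine ⟨G, fun w => rfl, ?_, ?_, ?_⟩
  · ext1 w; exact hgT w
  · ext1 w; rfl
  · exact Iso.of E hE E0 E1 Ei Ee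

end Dom

end

section

namespace Dom
variable {Y : Set ℂ} {τ : ℝ} {D : Dom Y τ}

lemma count_measure {A : Type*} [MeasurableSpace A] (μ : Measure A) (n B : ℕ) (U : ℕ → Set A)
    (hU : ∀ i, MeasurableSet (U i)) (v : ENNReal) (hv : ∀ i, v ≤ μ (U i))
    (hB : ∀ a, ∀ s : Finset ℕ, s ⊆ Finset.range n → (∀ i ∈ s, a ∈ U i) → s.card ≤ B) :
    n * v ≤ B * μ Set.univ := by
  classical
  calc (n : ENNReal) * v = ∑ i ∈ Finset.range n, v := by simp
    _ ≤ ∑ i ∈ Finset.range n, μ (U i) := Finset.sum_le_sum fun i _ => hv i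
    _ = ∑ i ∈ Finset.range n, ∫⁻ a, (U i).indicator 1 a ∂μ := by
        refine Finset.sum_congr rfl fun i _ => ?_
        rw [lintegral_indicator_one (hU i)]
    _ = ∫⁻ a, ∑ i ∈ Finset.range n, (U i).indicator 1 a ∂μ := by
        rw [lintegral_finsetSum]
        intro i _
        exact measurable_one.indicator (hU i)
    _ ≤ ∫⁻ _, (B : ENNReal) ∂μ := by
        apply lintegral_mono
        intro a
        simp only [Set.indicator_apply, Pi.one_apply]
        rw [← Finset.sum_filter, Finset.sum_const, nsmul_one]
        have := hB a ((Finset.range n).filter (fun i => a ∈ U i)) (Finset.filter_subset _ _)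
          (fun i hi => (Finset.mem_filter.1 hi).2)
        exact_mod_cast this
    _ = B * μ Set.univ := by simp

lemma Sys.core {g : Y ≃ₜ Y} (hg : D.Sys g) {A : Type*} [TopologicalSpace A] [MeasurableSpace A]
    [OpensMeasurableSpace A] (μ : Measure A) (hfin : μ Set.univ < ⊤)
    (hpos : ∀ U : Set A, IsOpen U → U.Nonempty → 0 < μ U) (pr : Y → A)
    (hpro : IsOpenMap pr) (h : A → A) (hh : MeasurePreserving h μ μ)
    (hpr : ∀ η, pr (g η) = h (pr η)) {C : Type*} [Fintype C] (code : Y → C)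
    (I' : Set Y) (hI0 : ∀ η ∈ I', (η : ℂ).im = 0) (hIc : IsPreconnected I')
    (hIcl : ∀ η : Y, (η : ℂ).im = 0 → η ∈ closure I')
    (hcl : ∀ η : Y, (η : ℂ).im = 0 → η ∈ closure {ξ : Y | 0 < (ξ : ℂ).im})
    (hne : ∀ η ∈ I', (g η : ℂ).im ≠ 0) (η₀ : Y) (hη₀ : η₀ ∈ I') (hgη₀ : 0 < (g η₀ : ℂ).im)
    (hcode : ∀ N : ℕ, ∃ n ≥ N, ∀ η η' : Y, pr η = pr η' → code η = code η' →
      0 < (η : ℂ).im → (((g ^ n)⁻¹ η : Y) : ℂ).im < 0 →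
      0 < (η' : ℂ).im → (((g ^ n)⁻¹ η' : Y) : ℂ).im < 0 → η = η') : False := by
  have hgim : Continuous (fun η : Y => (g η : ℂ).im) := by fun_prop
  have h1 : ∀ η ∈ I', 0 < (g η : ℂ).im := by
    intro η hη
    by_contra! hlt
    have hoc := (hIc.image (fun η : Y => (g η : ℂ).im) hgim.continuousOn).ordConnected
    obtain ⟨v, hv, hv0⟩ := hoc.out ⟨η, hη, rfl⟩ ⟨η₀, hη₀, rfl⟩ ⟨hlt, hgη₀.le⟩
    exact hne v hv hv0
  have h2 : ∀ η : Y, (η : ℂ).im = 0 → 0 ≤ (g η : ℂ).im := by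
    intro η hη
    have hc : IsClosed {η : Y | 0 ≤ (g η : ℂ).im} := isClosed_le continuous_const hgim
    exact closure_minimal (fun ξ hξ => (h1 ξ hξ).le) hc (hIcl η hη)
  have h3 : ∀ η : Y, 0 < (η : ℂ).im → 0 < (g η : ℂ).im := by
    intro η hη
    by_contra! hlt
    have hop : IsOpen {η : Y | 0 < (g η : ℂ).im} := isOpen_lt continuous_const hgim
    obtain ⟨ξ, hξ1, hξ2⟩ := mem_closure_iff.1 (hcl η₀ (hI0 _ hη₀)) _ hop hgη₀
    have hoc := im_ordConn (Set.Ioi 0) Set.ordConnected_Ioi g g.continuous D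
    obtain ⟨v, hv, hv0⟩ := hoc.out ⟨η, hη, rfl⟩ ⟨ξ, hξ2, rfl⟩ ⟨hlt, hξ1.le⟩
    obtain ⟨k1, k2⟩ := hg.noncross v _ 0 0 0 (by simp) hv0 rfl
    have := h2 _ k1
    have hv' : 0 < (v : ℂ).im := hv
    linarith
  have h4 : ∀ η : Y, (η : ℂ).im < 0 → (g⁻¹ η : ℂ).im < 0 := by
    intro η hη
    rw [hg.inv_apply, c_im, neg_neg_iff_pos]
    apply h3
    rw [c_im]; linarith
  have h3' : ∀ i : ℕ, ∀ η : Y, 0 < (η : ℂ).im → 0 < ((g ^ i) η : ℂ).im := by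
    intro i
    induction i with
    | zero => intro η hη; simpa using hη
    | succ i ih => intro η hη; rw [pow_succ, Homeomorph.mul_apply]; exact ih _ (h3 _ hη)
  have h4' : ∀ i : ℕ, ∀ η : Y, (η : ℂ).im < 0 → ((g⁻¹ ^ i) η : ℂ).im < 0 := by
    intro i
    induction i with
    | zero => intro η hη; simpa using hη
    | succ i ih => intro η hη; rw [pow_succ, Homeomorph.mul_apply]; exact ih _ (h4 _ hη)
  let O : Set Y := {η | 0 < (η : ℂ).im ∧ (g⁻¹ η : ℂ).im < 0}
  have hOo : IsOpen O := by
    apply IsOpen.and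
    · exact isOpen_lt continuous_const (by fun_prop)
    · exact isOpen_lt (by fun_prop) continuous_const
  have hOn : O.Nonempty := by
    have hop : IsOpen {η : Y | 0 < (g (D.c η) : ℂ).im} := isOpen_lt continuous_const (by fun_prop)
    have hc0 : D.c η₀ = η₀ := by
      apply Subtype.ext; apply Complex.ext <;> simp [hI0 _ hη₀]
    obtain ⟨ξ, hξ1, hξ2⟩ := mem_closure_iff.1 (hcl η₀ (hI0 _ hη₀)) _ hop (by
      show 0 < (g (D.c η₀) : ℂ).im
      rw [hc0]; exact hgη₀)
    refine ⟨g (D.c ξ), hξ1, ?_⟩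
    have : g⁻¹ (g (D.c ξ)) = D.c ξ := g.symm_apply_apply _
    rw [this, c_im]
    have : 0 < (ξ : ℂ).im := hξ2
    linarith
  have hdisj : ∀ i j : ℕ, ∀ η η' : Y, η ∈ O → η' ∈ O → (g ^ i) η = (g ^ j) η' → ¬ i < j := by
    intro i j η η' hη hη' he hij
    obtain ⟨d, rfl⟩ := Nat.exists_eq_add_of_lt hij
    have e1 : η = g ((g ^ d) η') := by
      apply (g ^ i).injective
      rw [he, ← Homeomorph.mul_apply, ← Homeomorph.mul_apply, ← pow_succ, ← pow_add]
      congr 2; omega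
    have e2 : g⁻¹ η = (g ^ d) η' := by rw [e1]; exact g.symm_apply_apply _
    have := h3' d η' hη'.1
    rw [← e2] at this
    linarith [hη.2]
  have hin : ∀ n i : ℕ, i < n → ∀ η ∈ O, (((g ^ n)⁻¹ ((g ^ i) η) : Y) : ℂ).im < 0 := by
    intro n i hi η hη
    obtain ⟨d, rfl⟩ := Nat.exists_eq_add_of_lt hi
    have e : (g ^ (i + d + 1))⁻¹ * g ^ i = g⁻¹ ^ d * g⁻¹ := by
      rw [← pow_succ, add_assoc, pow_add, mul_inv_rev, mul_assoc, inv_mul_cancel, mul_one, inv_pow]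
    rw [← Homeomorph.mul_apply, e, Homeomorph.mul_apply]
    exact h4' d _ hη.2
  have hiter : ∀ i : ℕ, ∀ η, pr ((g ^ i) η) = h^[i] (pr η) := by
    intro i
    induction i with
    | zero => intro η; simp
    | succ i ih => intro η; rw [pow_succ, Homeomorph.mul_apply, ih, hpr, Function.iterate_succ_apply]
  let U : ℕ → Set A := fun i => pr '' ((g ^ i) '' O)
  have hUo : ∀ i, IsOpen (U i) := fun i => hpro _ ((g ^ i).isOpenMap _ hOo)
  have hVpos : 0 < μ (pr '' O) := hpos _ (hpro _ hOo) (hOn.image _)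
  have hUm : ∀ i, μ (pr '' O) ≤ μ (U i) := by
    intro i
    rw [← (hh.iterate i).measure_preimage (hUo i).measurableSet.nullMeasurableSet]
    apply measure_mono
    rintro _ ⟨η, hη, rfl⟩
    exact ⟨(g ^ i) η, ⟨η, hη, rfl⟩, hiter i η⟩
  obtain ⟨N, hN⟩ := ENNReal.exists_nat_mul_gt hVpos.ne'
    (ENNReal.mul_ne_top (ENNReal.natCast_ne_top (Fintype.card C)) hfin.ne)
  obtain ⟨n, hn, hc⟩ := hcode N
  have := count_measure μ n (Fintype.card C) U (fun i => (hUo i).measurableSet) _ hUm (by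
    classical
    intro a s hs ha
    haveI : Nonempty Y := ⟨η₀⟩
    choose! η hη using ha
    choose! ξ hξ using fun i hi => (hη i hi).1
    refine Finset.card_le_card_of_injOn (t := Finset.univ) (fun i => code (η i))
      (fun _ _ => Finset.mem_coe.2 (Finset.mem_univ _)) ?_
    intro i hi j hj hij
    have hi' := hξ i hi
    have hj' := hξ j hj
    have hin' := Finset.mem_range.1 (hs hi)
    have hjn' := Finset.mem_range.1 (hs hj)
    have heq := hc (η i) (η j) ((hη i hi).2.trans (hη j hj).2.symm) hij
      (by rw [← hi'.2]; exact h3' i _ hi'.1.1) (by rw [← hi'.2]; exact hin n i hin' _ hi'.1)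
      (by rw [← hj'.2]; exact h3' j _ hj'.1.1) (by rw [← hj'.2]; exact hin n j hjn' _ hj'.1)
    have he : (g ^ i) (ξ i) = (g ^ j) (ξ j) := by rw [hi'.2, hj'.2, heq]
    have a1 := hdisj i j _ _ hi'.1 hj'.1 he
    have a2 := hdisj j i _ _ hj'.1 hi'.1 he.symm
    omega)
  have h5 : (N : ENNReal) * μ (pr '' O) ≤ n * μ (pr '' O) := by gcongr
  exact absurd (hN.trans_le (h5.trans this)) (lt_irrefl _)

end Dom

end

section

/-- The closed strip. -/
def SX : Set ℂ := {w | w.re ∈ Set.Icc (0 : ℝ) 1}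

lemma preconn_sub {Y : Set ℂ} (S : Set Y) (h : IsPreconnected (Subtype.val '' S)) :
    IsPreconnected S := (Topology.IsInducing.subtypeVal.isPreconnected_image).1 h

lemma DX : Dom SX 1 where
  conj w hw := by simpa [SX] using hw
  add w hw := by simpa [SX] using hw
  sub w hw := by simpa [SX] using hw
  slice c := by
    have : {x : ℝ | (⟨x, c⟩ : ℂ) ∈ SX} = Set.Icc 0 1 := by ext x; simp [SX]
    rw [this]; exact Set.ordConnected_Icc
  conn O hO := by
    apply preconn_sub
    have : (Subtype.val '' {η : SX | (η : ℂ).im ∈ O}) =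
        Complex.reLm ⁻¹' (Set.Icc 0 1) ∩ Complex.imLm ⁻¹' O := by
      ext w
      constructor
      · rintro ⟨η, hη, rfl⟩
        exact ⟨η.2, hη⟩
      · rintro ⟨h1, h2⟩
        exact ⟨⟨w, h1⟩, h2, rfl⟩
    rw [this]
    exact (((convex_Icc (0 : ℝ) 1).linear_preimage _).inter
      (hO.convex.linear_preimage _)).isPreconnected
  ne c := ⟨⟨⟨0, c⟩, by simp [SX]⟩, rfl⟩
  pos := one_pos

/-- The universal covering of the annulus. -/
def prX (w : SX) : AnnC := (((w : ℂ).im : Circle1), ⟨(w : ℂ).re, w.2⟩)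

lemma prX_cont : Continuous prX := by
  unfold prX
  apply Continuous.prodMk
  · exact (AddCircle.continuous_mk' 1).comp (by fun_prop)
  · fun_prop

/-- coordinates on the strip -/
def coordX : SX ≃ₜ ℝ × ↥(Set.Icc (0 : ℝ) 1) where
  toFun w := ((w : ℂ).im, ⟨(w : ℂ).re, w.2⟩)
  invFun p := ⟨(p.2 : ℝ) + p.1 * Complex.I, by
    have h1 := p.2.2.1
    have h2 := p.2.2.2
    show _ ∈ Set.Icc (0 : ℝ) 1
    simp only [Set.mem_Icc]
    constructor <;> simpa⟩
  left_inv w := by apply Subtype.ext; apply Complex.ext <;> simp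
  right_inv p := by apply Prod.ext <;> simp
  continuous_toFun := by fun_prop
  continuous_invFun := by fun_prop

lemma prX_open : IsOpenMap prX := by
  have : prX = (Prod.map (fun x : ℝ => (x : Circle1)) id) ∘ coordX := rfl
  rw [this]
  exact (IsOpenMap.prodMap QuotientAddGroup.isOpenMap_coe IsOpenMap.id).comp coordX.isOpenMap

lemma circ_eq {x y : ℝ} (h : (x : Circle1) = y) : ∃ m : ℤ, x = y + m := by
  have h1 : ((x - y : ℝ) : Circle1) = 0 := by rw [AddCircle.coe_sub, h, sub_self]
  obtain ⟨m, hm⟩ := (AddCircle.coe_eq_zero_iff _).1 h1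
  exact ⟨m, by simp at hm; linarith⟩

lemma prX_eq {w w' : SX} (h : prX w = prX w') : ∃ m : ℤ, w = (DX.T ^ m) w' := by
  obtain ⟨m, hm⟩ := circ_eq (congrArg Prod.fst h)
  refine ⟨m, ?_⟩
  have h2 := congrArg (fun p : AnnC => (p.2 : ℝ)) h
  simp only [prX] at h2
  apply Subtype.ext
  rw [Dom.Tzpow_coe]
  apply Complex.ext <;> simp [h2, hm]

lemma prX_T (m : ℤ) (w : SX) : prX ((DX.T ^ m) w) = prX w := by
  apply Prod.ext
  · show (((((DX.T ^ m) w : SX) : ℂ).im : ℝ) : Circle1) = (((w : ℂ).im : ℝ) : Circle1)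
    rw [Dom.Tz_im]
    have : ((m : ℝ) : Circle1) = 0 := (AddCircle.coe_eq_zero_iff _).2 ⟨m, by simp⟩
    rw [mul_one, AddCircle.coe_add, this, add_zero]
  · apply Subtype.ext
    exact Dom.Tz_re m w

lemma prX_c (w : SX) : prX (DX.c w) = RC (prX w) := by
  apply Prod.ext
  · simp [prX, RC]
  · apply Subtype.ext
    simp [prX, RC]

lemma prX_surj : Function.Surjective prX := by
  rintro ⟨θ, y⟩
  obtain ⟨x, rfl⟩ := QuotientAddGroup.mk_surjective θ
  exact ⟨⟨⟨y, x⟩, y.2⟩, rfl⟩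

lemma lift_exists (f : AnnC ≃ₜ AnnC) (hiso : IsotopicToIdC f)
    (hrev : ∀ z, f (RC z) = RC (f.symm z)) :
    ∃ F : SX ≃ₜ SX, DX.Sys F ∧ ∀ w, prX (F w) = f (prX w) := by
  obtain ⟨H, hH, H0, H1, Hi⟩ := hiso
  have cov : IsCoveringMap (fun x : ℝ => (x : Circle1)) := AddCircle.isCoveringMap_coe 1
  let δ : C(unitInterval × AnnC, Circle1) := ⟨fun x => (H x).1 - x.2.1, by fun_prop⟩
  let f0 : C(AnnC, ℝ) := ContinuousMap.const _ 0
  have δ0 : ∀ a, δ (0, a) = (fun x : ℝ => (x : Circle1)) (f0 a) := by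
    intro a
    have : H (0, a) = a := H0 a
    simp [δ, f0, this]
  let d : C(unitInterval × AnnC, ℝ) := cov.liftHomotopy δ f0 δ0
  have d0 : ∀ a, d (0, a) = 0 := fun a => cov.liftHomotopy_zero δ f0 δ0 a
  have dl : ∀ x, ((d x : ℝ) : Circle1) = (H x).1 - x.2.1 := fun x =>
    congrFun (cov.liftHomotopy_lifts δ f0 δ0) x
  let E' : unitInterval × SX → SX := fun x =>
    ⟨⟨(H (x.1, prX x.2)).2, (x.2 : ℂ).im + d (x.1, prX x.2)⟩, (H (x.1, prX x.2)).2.2⟩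
  have hprX := prX_cont
  have hpE : ∀ t w, prX (E' (t, w)) = H (t, prX w) := by
    intro t w
    apply Prod.ext
    · show ((((w : ℂ).im + d (t, prX w) : ℝ)) : Circle1) = _
      rw [AddCircle.coe_add, dl]
      simp [prX]
    · rfl
  have hET : ∀ t w, E' (t, DX.T w) = DX.T (E' (t, w)) := by
    intro t w
    have : prX (DX.T w) = prX w := by simpa using prX_T 1 w
    apply Subtype.ext
    apply Complex.ext
    · simp [E', this]
    · simp [E', this]; ring
  have hEc : Continuous (fun x => ((E' x : SX) : ℂ)) := by
    have : (fun x => ((E' x : SX) : ℂ)) = fun x : unitInterval × SX =>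
      (((H (x.1, prX x.2)).2 : ℝ) : ℂ) + (((x.2 : ℂ).im + d (x.1, prX x.2) : ℝ) : ℂ) * Complex.I := by
      funext x
      apply Complex.ext <;> simp [E']
    rw [this]
    fun_prop
  obtain ⟨F, hF, hS⟩ := DX.mkSys (fun w => E' (1, w)) (fun x => (E' x : ℂ)) hEc (by
      intro w
      have h0 : H (0, prX w) = prX w := H0 _
      apply Complex.ext <;> simp [E', h0, d0] <;> simp [prX]) (fun w => rfl) (by
      intro t w w' h
      have h' : E' (t, w) = E' (t, w') := Subtype.ext h
      have h1 : prX w = prX w' := by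
        obtain ⟨G, hG⟩ := Hi t
        apply G.injective
        rw [← hG, ← hG, ← hpE, ← hpE, h']
      have h2 := congrArg Complex.im h
      simp only [E', h1] at h2
      have h3 := congrArg (fun p : AnnC => (p.2 : ℝ)) h1
      simp only [prX] at h3
      apply Subtype.ext
      apply Complex.ext
      · exact h3
      · linarith) (by
      intro t w
      beta_reduce
      rw [hET]; rfl) (by
      intro w
      apply prX_eq
      have hf : ∀ w, prX (E' (1, w)) = f (prX w) := fun w => (hpE 1 w).trans (H1 _)
      beta_reduce
      rw [prX_c, hf, prX_c, hf, hrev, f.symm_apply_apply]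
      simp [RC])
  exact ⟨F, hS, fun w => by rw [hF]; exact (hpE 1 w).trans (H1 _)⟩

end

section

/-- The reduced situation. -/
structure Red (G : SX ≃ₜ SX) (n₀ : ℕ) : Prop where
  sys : DX.Sys G
  fix : ∃ z, G z = z
  s3 : ∀ u : SX, (u : ℂ).im = 0 → ∀ n : ℕ, 1 ≤ n → Nat.Coprime n n₀ → ∀ m : ℤ,
    (G ^ n) u = (DX.T ^ m) u → ∃ b : ℤ, G u = (DX.T ^ b) u

namespace Dom
variable {Y : Set ℂ} {τ : ℝ} {D : Dom Y τ}

lemma Sys.pow_Tz {g : Y ≃ₜ Y} (hg : D.Sys g) (u : Y) (b : ℤ) (h : g u = (D.T ^ b) u) (n : ℕ) :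
    (g ^ n) u = (D.T ^ (n * b)) u := by
  induction n with
  | zero => simp
  | succ n ih =>
    rw [pow_succ, Homeomorph.mul_apply, h, (hg.pow n).apply_Tz, ih, ← Homeomorph.mul_apply,
      ← zpow_add]
    congr 2; push_cast; ring

lemma Tz_inj {m m' : ℤ} {u : Y} (h : (D.T ^ m) u = (D.T ^ m') u) : m = m' := by
  have h5 := congrArg (fun x : Y => (x : ℂ).im) h
  simp only [Tz_im] at h5
  have h6 : ((m : ℝ) - m') * τ = 0 := by linarith
  rcases mul_eq_zero.1 h6 with h | h
  · have : (m : ℝ) = m' := by linarith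
    exact_mod_cast this
  · exact absurd h D.pos.ne'

lemma c_real {u : Y} (h : (u : ℂ).im = 0) : D.c u = u := by
  apply Subtype.ext; apply Complex.ext <;> simp [h]

lemma Tz_cancel (m : ℤ) (u : Y) : (D.T ^ m) ((D.T ^ (-m)) u) = u := by
  rw [← Homeomorph.mul_apply, ← zpow_add]; simp

lemma inv_fix {g : Y ≃ₜ Y} {u v : Y} : g⁻¹ u = v ↔ u = g v := by
  constructor
  · rintro rfl; exact (g.apply_symm_apply u).symm
  · rintro rfl; exact g.symm_apply_apply v

lemma Sys.inv_Tz {g : Y ≃ₜ Y} (hg : D.Sys g) {u : Y} {b : ℤ} (h : g u = (D.T ^ b) u) :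
    g⁻¹ u = (D.T ^ (-b)) u := by
  rw [inv_fix, hg.apply_Tz, h, ← Homeomorph.mul_apply, ← zpow_add]; simp

lemma Sys.inv_im_real {g : Y ≃ₜ Y} (hg : D.Sys g) {u : Y} (h : (u : ℂ).im = 0) :
    (g⁻¹ u : ℂ).im = - (g u : ℂ).im := by
  rw [hg.inv_apply, c_im, c_real h]

end Dom

namespace Red
open Dom
variable {G : SX ≃ₜ SX} {n₀ : ℕ}

lemma inv (h : Red G n₀) : Red G⁻¹ n₀ where
  sys := h.sys.inv
  fix := by
    obtain ⟨z, hz⟩ := h.fix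
    exact ⟨z, inv_fix.2 hz.symm⟩
  s3 u hu n hn hc m hm := by
    have h1 := (h.sys.inv.pow n).inv_Tz hm
    rw [inv_pow, inv_inv] at h1
    obtain ⟨b, hb⟩ := h.s3 u hu n hn hc _ h1
    exact ⟨_, h.sys.inv_Tz hb⟩

lemma no (h : Red G n₀) (n : ℕ) (hn : 1 ≤ n) (hc : Nat.Coprime n n₀) (m : ℤ) (hm : ¬ (n : ℤ) ∣ m)
    (u : SX) (hu : (u : ℂ).im = 0) : ((G ^ n) u : ℂ).im ≠ m := by
  intro hv
  have hS := (h.sys.pow n).Tmul (-m)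
  obtain ⟨ω, hω, hg, -⟩ := hS.line u _ 0 rfl (by simp [hu]) (by
    rw [Homeomorph.mul_apply, Tz_im, hv]; simp)
  rw [c_real hω, Homeomorph.mul_apply] at hg
  have h1 := congrArg (DX.T ^ m) hg
  rw [Tz_cancel] at h1
  obtain ⟨b, hb⟩ := h.s3 ω hω n hn hc m h1
  rw [h.sys.pow_Tz ω b hb] at h1
  exact hm ⟨b, (Tz_inj h1).symm⟩

lemma fix' (h : Red G n₀) (a : ℝ) : ∃ z, G z = z ∧ a ≤ (z : ℂ).im ∧ (z : ℂ).im < a + 1 := by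
  obtain ⟨z, hz⟩ := h.fix
  refine ⟨(DX.T ^ (-⌊(z : ℂ).im - a⌋)) z, ?_, ?_, ?_⟩
  · rw [h.sys.apply_Tz, hz]
  · rw [Tz_im]
    have := Int.floor_le ((z : ℂ).im - a)
    push_cast; linarith
  · rw [Tz_im]
    have := Int.lt_floor_add_one ((z : ℂ).im - a)
    push_cast; linarith

lemma pow_fix {z : SX} (hz : G z = z) (n : ℕ) : (G ^ n) z = z := by
  induction n with
  | zero => simp
  | succ n ih => rw [pow_succ, Homeomorph.mul_apply, hz, ih]

lemma u_down (h : Red G n₀) (n : ℕ) (hn : 2 ≤ n) (hc : Nat.Coprime n n₀) (u : SX)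
    (hu : (u : ℂ).im ≤ 0) : ((G ^ n) u : ℂ).im < 1 := by
  have hS := h.sys.pow n
  refine hS.hs_down 0 1 1 (by simp) ?_ u hu
  intro v hv
  by_contra! hge
  have hno : ∀ w : SX, (w : ℂ).im = 0 → ((G ^ n) w : ℂ).im ≠ 1 := by
    intro w hw h1
    refine h.no n (by omega) hc 1 ?_ w hw (by simpa using h1)
    intro hd
    have := Int.le_of_dvd one_pos hd
    omega
  have hall : ∀ w : SX, (w : ℂ).im = 0 → 1 < ((G ^ n) w : ℂ).im := by
    intro w hw
    by_contra! hle
    have hoc := im_ordConn {0} Set.ordConnected_singleton (G ^ n) (G ^ n).continuous DX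
    obtain ⟨x, hx, hx1⟩ := hoc.out ⟨w, hw, rfl⟩ ⟨v, hv, rfl⟩ ⟨hle, hge⟩
    exact hno x hx hx1
  obtain ⟨z, hz, hz0, hz1⟩ := h.fix' 0
  have := hS.hs_up 0 1 1 (by simp) hall z hz0
  rw [pow_fix hz] at this
  linarith

lemma u_up (h : Red G n₀) (n : ℕ) (hn : 2 ≤ n) (hc : Nat.Coprime n n₀) (u : SX)
    (hu : 0 ≤ (u : ℂ).im) : -1 < ((G ^ n) u : ℂ).im := by
  have hS := h.sys.pow n
  refine hS.hs_up 0 (-1) (-1) (by simp) ?_ u hu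
  intro v hv
  have := h.inv.u_down n hn hc v hv.le
  rw [inv_pow, hS.inv_im_real hv] at this
  linarith

lemma coprime_ex (n₀ : ℕ) (hn₀ : 1 ≤ n₀) (N : ℕ) : ∃ n ≥ N, 2 ≤ n ∧ Nat.Coprime n n₀ := by
  refine ⟨(N + 2) * n₀ + 1, ?_, ?_, ?_⟩
  · nlinarith
  · nlinarith
  · simp

lemma hne (h : Red G n₀)
    (hno : ∀ u : SX, (u : ℂ).im = 0 → 0 < (u : ℂ).re → (u : ℂ).re < 1 → G u ≠ u)
    (η : SX) (hη : (η : ℂ).im = 0) (e0 : 0 < (η : ℂ).re) (e1 : (η : ℂ).re < 1) :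
    (G η : ℂ).im ≠ 0 := by
  intro hG
  obtain ⟨ω, hω, hg, hr⟩ := h.sys.line η _ 0 rfl (by simp [hη]) hG
  rw [c_real hω] at hg
  have hb := hno ω hω
  have hG2 := (G η).2.1
  have hG3 := (G η).2.2
  have h5 : (ω : ℂ).re = (G η : ℂ).re := by
    by_contra hne
    rcases Set.mem_uIcc.1 hr with ⟨k1, k2⟩ | ⟨k1, k2⟩
    · exact hb (by linarith) (lt_of_lt_of_le (lt_of_le_of_ne k2 hne) hG3) hg
    · exact hb (lt_of_le_of_lt hG2 (lt_of_le_of_ne k1 (Ne.symm hne))) (by linarith) hg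
  have h6 : ω = G η := by
    apply Subtype.ext; apply Complex.ext
    · exact h5
    · rw [hω, hG]
  rw [← hg] at h6
  have h7 := G.injective h6
  rw [h7] at hg
  exact hno η hη e0 e1 hg

lemma caseB_pos (h : Red G n₀) (hn₀ : 1 ≤ n₀) (μ : Measure AnnC) (hfin : μ Set.univ < ⊤)
    (hpos : ∀ U : Set AnnC, IsOpen U → U.Nonempty → 0 < μ U) (f : AnnC → AnnC)
    (hf : MeasurePreserving f μ μ) (hpr : ∀ w, prX (G w) = f (prX w))
    (hno : ∀ u : SX, (u : ℂ).im = 0 → 0 < (u : ℂ).re → (u : ℂ).re < 1 → G u ≠ u)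
    (η₀ : SX) (hη₀ : (η₀ : ℂ).im = 0) (h0 : 0 < (η₀ : ℂ).re) (h1 : (η₀ : ℂ).re < 1)
    (hp : 0 < (G η₀ : ℂ).im) : False := by
  refine h.sys.core μ hfin hpos prX prX_open f hf hpr (fun _ => ())
    {u : SX | (u : ℂ).im = 0 ∧ 0 < (u : ℂ).re ∧ (u : ℂ).re < 1} (fun _ h => h.1) ?_ ?_ ?_ ?_
    η₀ ⟨hη₀, h0, h1⟩ hp ?_
  · apply preconn_sub
    have : (Subtype.val '' {u : SX | (u : ℂ).im = 0 ∧ 0 < (u : ℂ).re ∧ (u : ℂ).re < 1}) =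
        Complex.reLm ⁻¹' (Set.Ioo 0 1) ∩ Complex.imLm ⁻¹' {0} := by
      ext w
      constructor
      · rintro ⟨η, hη, rfl⟩
        exact ⟨hη.2, hη.1⟩
      · rintro ⟨h1, h2⟩
        exact ⟨⟨w, Set.Ioo_subset_Icc_self h1⟩, ⟨h2, h1⟩, rfl⟩
    rw [this]
    exact (((convex_Ioo (0 : ℝ) 1).linear_preimage _).inter
      ((convex_singleton _).linear_preimage _)).isPreconnected
  · intro η hη
    have hm : ∀ x : ℝ, x ∈ Set.Icc (0 : ℝ) 1 → (x : ℂ) ∈ SX := fun x hx => by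
      show (x : ℂ).re ∈ Set.Icc (0 : ℝ) 1
      simpa using hx
    let φ : Set.Icc (0 : ℝ) 1 → SX := fun x => ⟨_, hm x x.2⟩
    have hφ : Continuous φ := by fun_prop
    have hx : (⟨(η : ℂ).re, η.2⟩ : Set.Icc (0 : ℝ) 1) ∈
        closure {x : Set.Icc (0 : ℝ) 1 | 0 < (x : ℝ) ∧ (x : ℝ) < 1} := by
      rw [Topology.IsInducing.subtypeVal.closure_eq_preimage_closure_image]
      have : (Subtype.val '' {x : Set.Icc (0 : ℝ) 1 | 0 < (x : ℝ) ∧ (x : ℝ) < 1}) =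
          Set.Ioo 0 1 := by
        ext w
        constructor
        · rintro ⟨η, hη, rfl⟩
          exact hη
        · rintro h1
          exact ⟨⟨w, Set.Ioo_subset_Icc_self h1⟩, h1, rfl⟩
      rw [this, closure_Ioo (by norm_num)]
      exact η.2
    have h2 := image_closure_subset_closure_image hφ ⟨_, hx, rfl⟩
    have h3 : φ ⟨(η : ℂ).re, η.2⟩ = η := by
      apply Subtype.ext; apply Complex.ext <;> simp [φ, hη]
    rw [h3] at h2
    refine closure_mono ?_ h2
    rintro _ ⟨x, hx, rfl⟩
    exact ⟨by simp [φ], by simpa [φ] using hx.1, by simpa [φ] using hx.2⟩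
  · intro η hη
    have hm : ∀ x : ℝ, (η : ℂ) + x * Complex.I ∈ SX := fun x => by
      have := η.2
      show _ ∈ Set.Icc (0 : ℝ) 1
      simpa [SX] using this
    let φ : ℝ → SX := fun x => ⟨_, hm x⟩
    have hφ : Continuous φ := by fun_prop
    have hx : (0 : ℝ) ∈ closure (Set.Ioi (0 : ℝ)) := by simp
    have h2 := image_closure_subset_closure_image hφ ⟨_, hx, rfl⟩
    have h3 : φ 0 = η := by
      apply Subtype.ext; simp [φ]
    rw [h3] at h2
    refine closure_mono ?_ h2
    rintro _ ⟨x, hx, rfl⟩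
    show 0 < ((φ x : SX) : ℂ).im
    simpa [φ, hη] using hx
  · rintro η ⟨hη, e0, e1⟩ hG
    exact h.hne hno η hη e0 e1 hG
  · intro N
    obtain ⟨n, hnN, hn2, hnc⟩ := coprime_ex n₀ hn₀ N
    refine ⟨n, hnN, ?_⟩
    intro η η' hpη _ a1 a2 b1 b2
    have key : ∀ η : SX, (((G ^ n)⁻¹ η : SX) : ℂ).im < 0 → (η : ℂ).im < 1 := by
      intro η hη
      have := h.u_down n hn2 hnc _ hη.le
      have e : (G ^ n) ((G ^ n)⁻¹ η) = η := (G ^ n).apply_symm_apply η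
      rwa [e] at this
    have a3 := key η a2
    have b3 := key η' b2
    obtain ⟨m, rfl⟩ := prX_eq hpη
    rw [Tz_im] at a1 a3
    have m1 : (m : ℝ) < 1 := by linarith
    have m2 : (-1 : ℝ) < m := by linarith
    have m1' : m < 1 := by exact_mod_cast m1
    have m2' : -1 < m := by exact_mod_cast m2
    have : m = 0 := by omega
    subst this
    simp

end Red

end

section

open Dom

/-- The logarithmic covering domain of the punctured strip. -/
def YP (p : ℝ) : Set ℂ := (fun η : ℂ => (p : ℂ) + Complex.exp η) ⁻¹' SX

lemma mem_YP {p : ℝ} {η : ℂ} : η ∈ YP p ↔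
    0 ≤ p + Real.exp η.re * Real.cos η.im ∧ p + Real.exp η.re * Real.cos η.im ≤ 1 := by
  show (_ ∈ Set.Icc (0 : ℝ) 1) ↔ _
  simp [Complex.exp_re]

lemma YP_left {p : ℝ} (hp : 0 < p ∧ p < 1) {x y c : ℝ} (h : (⟨x, c⟩ : ℂ) ∈ YP p) (hyx : y ≤ x) :
    (⟨y, c⟩ : ℂ) ∈ YP p := by
  rw [mem_YP] at h ⊢
  simp only at h ⊢
  have h1 : Real.exp y ≤ Real.exp x := Real.exp_le_exp.2 hyx
  have h2 := Real.exp_pos y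
  rcases le_total 0 (Real.cos c) with h3 | h3
  · constructor
    · have := mul_nonneg h2.le h3
      linarith
    · nlinarith
  · constructor
    · nlinarith
    · have := mul_nonpos_of_nonneg_of_nonpos h2.le h3
      linarith

/-- a safe abscissa -/
noncomputable def xP (p : ℝ) : ℝ := Real.log (min p (1 - p))

lemma xP_mem {p : ℝ} (hp : 0 < p ∧ p < 1) (c : ℝ) : (⟨xP p, c⟩ : ℂ) ∈ YP p := by
  rw [mem_YP]
  simp only
  have h0 : 0 < min p (1 - p) := lt_min hp.1 (by linarith [hp.2])
  rw [xP, Real.exp_log h0]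
  have h1 := min_le_left p (1 - p)
  have h2 := min_le_right p (1 - p)
  have h3 := Real.cos_le_one c
  have h4 := Real.neg_one_le_cos c
  constructor <;> nlinarith

lemma YP_slice {p : ℝ} (hp : 0 < p ∧ p < 1) (c : ℝ) :
    Set.OrdConnected {x : ℝ | (⟨x, c⟩ : ℂ) ∈ YP p} := by
  constructor
  intro x _ y hy z hz
  exact YP_left hp hy hz.2

lemma DY {p : ℝ} (hp : 0 < p ∧ p < 1) : Dom (YP p) (2 * Real.pi) where
  conj w hw := by
    rw [mem_YP] at hw ⊢
    simpa using hw
  add w hw := by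
    show (p : ℂ) + Complex.exp _ ∈ SX
    push_cast
    rw [Complex.exp_periodic w]; exact hw
  sub w hw := by
    show (p : ℂ) + Complex.exp _ ∈ SX
    push_cast
    rw [Complex.exp_periodic.sub_eq w]; exact hw
  slice c := YP_slice hp c
  conn O hO := by
    apply preconn_sub
    have : (Subtype.val '' {η : YP p | (η : ℂ).im ∈ O}) = {η : ℂ | η ∈ YP p ∧ η.im ∈ O} := by
      ext w
      constructor
      · rintro ⟨η, hη, rfl⟩
        exact ⟨η.2, hη⟩
      · rintro ⟨h1, h2⟩
        exact ⟨⟨w, h1⟩, h2, rfl⟩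
    rw [this]
    rcases Set.eq_empty_or_nonempty {η : ℂ | η ∈ YP p ∧ η.im ∈ O} with he | ⟨b, hb⟩
    · rw [he]; exact isPreconnected_empty
    refine isPreconnected_of_forall (⟨xP p, b.im⟩ : ℂ) ?_
    intro y hy
    have hL : IsPreconnected {w : ℂ | w.re = xP p ∧ w.im ∈ O} := by
      have : {w : ℂ | w.re = xP p ∧ w.im ∈ O} =
        Complex.reLm ⁻¹' {xP p} ∩ Complex.imLm ⁻¹' O := rfl
      rw [this]
      exact (((convex_singleton _).linear_preimage _).inter
        (hO.convex.linear_preimage _)).isPreconnected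
    have hM : IsPreconnected {w : ℂ | w.re ∈ Set.uIcc (xP p) y.re ∧ w.im = y.im} := by
      have : {w : ℂ | w.re ∈ Set.uIcc (xP p) y.re ∧ w.im = y.im} =
        Complex.reLm ⁻¹' (Set.uIcc (xP p) y.re) ∩ Complex.imLm ⁻¹' {y.im} := rfl
      rw [this]
      exact (((convex_uIcc _ _).linear_preimage _).inter
        ((convex_singleton _).linear_preimage _)).isPreconnected
    refine ⟨_, ?_, ?_, ?_, IsPreconnected.union (⟨xP p, y.im⟩ : ℂ) ?_ ?_ hL hM⟩
    · rintro w (⟨h1, h2⟩ | ⟨h1, h2⟩)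
      · refine ⟨?_, h2⟩
        have := xP_mem hp w.im
        rwa [← h1] at this
      · refine ⟨?_, by rw [h2]; exact hy.2⟩
        have hy1 : (⟨y.re, y.im⟩ : ℂ) ∈ YP p := hy.1
        have := (YP_slice hp y.im).uIcc_subset (xP_mem hp y.im) hy1 h1
        have h3 : (⟨w.re, y.im⟩ : ℂ) ∈ YP p := this
        rwa [← h2] at h3
    · exact Or.inl ⟨rfl, hb.2⟩
    · exact Or.inr ⟨Set.right_mem_uIcc, rfl⟩
    · exact ⟨rfl, hy.2⟩
    · exact ⟨Set.left_mem_uIcc, rfl⟩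
  ne c := ⟨⟨_, xP_mem hp c⟩, rfl⟩
  pos := by positivity

/-- The logarithmic covering. -/
noncomputable def qY {p : ℝ} (η : YP p) : SX := ⟨(p : ℂ) + Complex.exp η, η.2⟩

section
variable {p : ℝ}

@[simp] lemma qY_coe (η : YP p) : (qY η : ℂ) = p + Complex.exp η := rfl

lemma qY_cont : Continuous (qY : YP p → SX) := by
  unfold qY; fun_prop

lemma qY_open : IsOpenMap (qY : YP p → SX) := by
  have h : IsOpenMap (fun η : ℂ => (p : ℂ) + Complex.exp η) :=
    (isOpenMap_add_left (p : ℂ)).comp Complex.isOpenMap_exp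
  exact h.restrictPreimage SX

lemma qY_im (η : YP p) : (qY η : ℂ).im = Real.exp (η : ℂ).re * Real.sin (η : ℂ).im := by
  simp [Complex.exp_im]

lemma qY_re_real (η : YP p) (h : (η : ℂ).im = 0) : (qY η : ℂ).re = p + Real.exp (η : ℂ).re := by
  simp [Complex.exp_re, h]

lemma qY_T (hp : 0 < p ∧ p < 1) (η : YP p) : qY ((DY hp).T η) = qY η := by
  apply Subtype.ext
  rw [qY_coe, T_coe, qY_coe]
  push_cast
  rw [Complex.exp_periodic]

lemma qY_c (hp : 0 < p ∧ p < 1) (η : YP p) : qY ((DY hp).c η) = DX.c (qY η) := by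
  apply Subtype.ext
  simp [← Complex.exp_conj]

lemma qY_eq (hp : 0 < p ∧ p < 1) {η η' : YP p} (h : qY η = qY η') :
    ∃ m : ℤ, η = ((DY hp).T ^ m) η' := by
  have h1 := congrArg Subtype.val h
  simp only [qY_coe, add_right_inj] at h1
  obtain ⟨m, hm⟩ := Complex.exp_eq_exp_iff_exists_int.1 h1
  refine ⟨m, Subtype.ext ?_⟩
  rw [Tzpow_coe, hm]
  push_cast; ring

end

lemma iso_bound (E : unitInterval × SX → ℂ) (hE : Continuous E)
    (Ee : ∀ t w, E (t, DX.T w) = E (t, w) + (1 : ℝ) * Complex.I) :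
    ∃ C : ℝ, ∀ t w, ‖E (t, w) - w‖ ≤ C := by
  let K : Set SX := {w | (w : ℂ).im ∈ Set.Icc (0 : ℝ) 1}
  have hK : IsCompact K := by
    have : K = coordX ⁻¹' (Set.Icc (0 : ℝ) 1 ×ˢ Set.univ) := by
      ext w
      constructor
      · intro h; exact ⟨h, trivial⟩
      · intro h; exact h.1
    rw [this, coordX.isCompact_preimage]
    exact isCompact_Icc.prod isCompact_univ
  have hK2 : IsCompact ((Set.univ : Set unitInterval) ×ˢ K) := isCompact_univ.prod hK
  obtain ⟨C, hC⟩ := hK2.exists_bound_of_continuousOn (f := fun x => E x - x.2) (by fun_prop)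
  refine ⟨C, fun t w => ?_⟩
  have hz : ∀ m : ℤ, ∀ w, E (t, (DX.T ^ m) w) = E (t, w) + m * Complex.I := by
    intro m
    induction m with
    | zero => intro w; simp
    | succ n ih =>
      intro w
      rw [zpow_add_one, Homeomorph.mul_apply, ih, Ee]
      push_cast; ring
    | pred n ih =>
      intro w
      rw [zpow_sub_one, Homeomorph.mul_apply, ih]
      have := Ee t (DX.T⁻¹ w)
      have e : DX.T (DX.T⁻¹ w) = w := DX.T.apply_symm_apply w
      rw [e] at this
      rw [this]
      push_cast; ring
  have h1 := hC (t, (DX.T ^ (-⌊(w : ℂ).im⌋)) w) ⟨trivial, by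
    show _ ∈ Set.Icc (0 : ℝ) 1
    rw [Tz_im]
    have a := Int.floor_le ((w : ℂ).im)
    have b := Int.lt_floor_add_one ((w : ℂ).im)
    constructor <;> push_cast <;> linarith⟩
  rw [hz, Tzpow_coe] at h1
  have : E (t, w) + ((-⌊(w : ℂ).im⌋ : ℤ) : ℂ) * Complex.I -
    ((w : ℂ) + ((-⌊(w : ℂ).im⌋ : ℤ) : ℂ) * ((1 : ℝ) : ℂ) * Complex.I) = E (t, w) - w := by
    push_cast; ring
  rwa [this] at h1

/-- Lifts to the logarithmic covering. -/
structure LY {p : ℝ} (hp : 0 < p ∧ p < 1) (G : SX ≃ₜ SX) (g : YP p ≃ₜ YP p) : Prop where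
  sys : (DY hp).Sys g
  q : ∀ η, qY (g η) = G (qY η)
  far : ∃ M : ℝ, ∀ η : YP p, M ≤ |(qY η : ℂ).im| →
    |(g η : ℂ).im - (η : ℂ).im| < Real.pi / 2
  bd : ∃ C : ℝ, ∀ w : SX, |(G w : ℂ).im - (w : ℂ).im| ≤ C

lemma LY.inv {p : ℝ} {hp : 0 < p ∧ p < 1} {G : SX ≃ₜ SX} {g : YP p ≃ₜ YP p} (h : LY hp G g) :
    LY hp G⁻¹ g⁻¹ where
  sys := h.sys.inv
  q η := by
    symm
    rw [inv_fix, ← h.q]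
    exact congrArg qY (g.apply_symm_apply η).symm
  far := by
    obtain ⟨M, hM⟩ := h.far
    refine ⟨M, fun η hη => ?_⟩
    have := hM ((DY hp).c η) (by rw [qY_c hp, c_im, abs_neg]; exact hη)
    rw [h.sys.inv_apply, c_im]
    rw [c_im] at this
    rw [← abs_neg]
    convert this using 2
    ring
  bd := by
    obtain ⟨C, hC⟩ := h.bd
    refine ⟨C, fun w => ?_⟩
    have := hC (G⁻¹ w)
    have e : G (G⁻¹ w) = w := G.apply_symm_apply w
    rw [e, abs_sub_comm] at this
    exact this

lemma LY_exists {p : ℝ} (hp : 0 < p ∧ p < 1) (G : SX ≃ₜ SX) (hG : DX.Sys G)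
    (P : SX) (hP : (P : ℂ) = p) (hfix : G P = P) : ∃ g, LY hp G g := by
  obtain ⟨E, hE, E0, E1, Ei, Ee⟩ := hG.iso.get
  obtain ⟨C, hC⟩ := iso_bound E hE Ee
  have hne : ∀ η : YP p, qY η ≠ P := by
    intro η h
    have := congrArg Subtype.val h
    rw [hP, qY_coe] at this
    exact Complex.exp_ne_zero (η : ℂ) (by linear_combination this)
  have hsub : ∀ w : {w : SX // w ≠ P}, ((w : SX) : ℂ) - p ≠ 0 := by
    intro w h
    exact w.2 (Subtype.ext (by rw [hP]; exact sub_eq_zero.1 h))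
  obtain ⟨φ, hφ, φ0, φe⟩ := log_lift (Z := {w : SX // w ≠ P})
    (fun x => (E (x.1, x.2) - E (x.1, P)) / (((x.2 : SX) : ℂ) - p))
    (Continuous.div (by fun_prop) (by fun_prop) (fun x => hsub x.2))
    (fun x => div_ne_zero (sub_ne_zero.2 fun h => x.2.2 (Ei _ _ _ h)) (hsub x.2))
    (fun z => by
      have a : E (0, (z : SX)) = (z : SX) := E0 _
      have b : E (0, P) = P := E0 _
      simp only [a, b, hP]
      exact div_self (hsub z))
  let q' : YP p → {w : SX // w ≠ P} := fun η => ⟨qY η, hne η⟩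
  have hq' : Continuous q' := by
    have := qY_cont (p := p)
    fun_prop
  let E' : unitInterval × YP p → ℂ := fun x => x.2 + φ (x.1, q' x.2)
  have hE' : Continuous E' := by fun_prop
  have hexp : ∀ t η, Complex.exp (E' (t, η)) = E (t, qY η) - E (t, P) := by
    intro t η
    have h2 : (qY η : ℂ) - p = Complex.exp η := by simp
    simp only [E', Complex.exp_add, φe, q', h2]
    field_simp
  have hmem : ∀ η, E' (1, η) ∈ YP p := by
    intro η
    show (p : ℂ) + Complex.exp _ ∈ SX
    rw [hexp, E1, E1, hfix, hP]
    simp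
  let g' : YP p → YP p := fun η => ⟨E' (1, η), hmem η⟩
  have hqg : ∀ η, qY (g' η) = G (qY η) := by
    intro η
    apply Subtype.ext
    simp only [qY_coe, g']
    rw [hexp, E1, E1, hfix, hP]
    simp
  have hqT : ∀ η, q' ((DY hp).T η) = q' η := fun η => Subtype.ext (qY_T hp η)
  obtain ⟨g, hg, hS⟩ := (DY hp).mkSys g' E' hE'
    (fun η => by simp [E', φ0]) (fun η => rfl)
    (by
      intro t η η' h
      have h1 := hexp t η
      rw [h, hexp, sub_left_inj] at h1
      have h2 := Ei _ _ _ h1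
      have h3 : q' η' = q' η := Subtype.ext h2
      simp only [E', h3, add_left_inj] at h
      exact Subtype.ext h)
    (by
      intro t η
      simp only [E', hqT, T_coe]; ring)
    (by
      intro η
      apply qY_eq hp
      rw [qY_c hp, hqg, qY_c hp, hqg, ← hG.inv_apply]
      exact G.symm_apply_apply _)
  refine ⟨g, hS, fun η => by rw [hg, hqg], ?_, ?_⟩
  · refine ⟨2 * C + 1, fun η hη => ?_⟩
    have hC0 : 0 ≤ C := (norm_nonneg _).trans (hC 0 P)
    have hw : 2 * C < ‖(qY η : ℂ) - p‖ := by
      have := Complex.abs_im_le_norm ((qY η : ℂ) - p)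
      simp only [Complex.sub_im, Complex.ofReal_im, sub_zero] at this
      linarith
    have hρ : ∀ t, 0 < ((E (t, qY η) - E (t, P)) / ((qY η : ℂ) - p)).re := by
      intro t
      have hn : (qY η : ℂ) - p ≠ 0 := hsub (q' η)
      have h1 : ‖(E (t, qY η) - E (t, P)) / ((qY η : ℂ) - p) - 1‖ < 1 := by
        rw [div_sub_one hn, norm_div, div_lt_one (norm_pos_iff.2 hn)]
        refine lt_of_le_of_lt ?_ hw
        have e : E (t, qY η) - E (t, P) - ((qY η : ℂ) - p) =
          (E (t, qY η) - qY η) - (E (t, P) - P) := by rw [hP]; ring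
        rw [e]
        refine (norm_sub_le _ _).trans ?_
        linarith [hC t (qY η), hC t P]
      have h2 := (Complex.abs_re_le_norm _).trans_lt h1
      rw [Complex.sub_re, Complex.one_re, abs_lt] at h2
      linarith
    have hcos : ∀ t, 0 < Real.cos (φ (t, q' η)).im := by
      intro t
      have h1 := hρ t
      have h2 : (E (t, qY η) - E (t, P)) / ((qY η : ℂ) - p) = Complex.exp (φ (t, q' η)) :=
        (φe (t, q' η)).symm
      rw [h2, Complex.exp_re] at h1
      exact (mul_pos_iff_of_pos_left (Real.exp_pos _)).1 h1
    have hco : Continuous (fun t : unitInterval => (φ (t, q' η)).im) := by fun_prop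
    have hoc : (Set.range (fun t : unitInterval => (φ (t, q' η)).im)).OrdConnected :=
      (isPreconnected_range hco).ordConnected
    have hz : (0 : ℝ) ∈ Set.range (fun t : unitInterval => (φ (t, q' η)).im) :=
      ⟨0, by simp [φ0]⟩
    have e : (g η : ℂ).im - (η : ℂ).im = (φ (1, q' η)).im := by
      rw [hg]; simp [g', E']
    rw [e, abs_lt]
    constructor
    · by_contra! hle
      obtain ⟨t, ht⟩ := hoc.out ⟨1, rfl⟩ hz ⟨hle, by linarith [Real.pi_pos]⟩
      have := hcos t
      simp only at ht
      rw [ht, Real.cos_neg, Real.cos_pi_div_two] at this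
      exact lt_irrefl _ this
    · by_contra! hle
      obtain ⟨t, ht⟩ := hoc.out hz ⟨1, rfl⟩ ⟨by linarith [Real.pi_pos], hle⟩
      have := hcos t
      simp only at ht
      rw [ht, Real.cos_pi_div_two] at this
      exact lt_irrefl _ this
  · refine ⟨C, fun w => ?_⟩
    have h1 := hC 1 w
    rw [E1] at h1
    have := Complex.abs_im_le_norm ((G w : ℂ) - w)
    rw [Complex.sub_im] at this
    exact this.trans h1

end

section

open Dom

lemma sin_pos_sheet {θ : ℝ} (h : 0 < Real.sin θ) :
    ∃ m : ℤ, m * (2 * Real.pi) < θ ∧ θ < m * (2 * Real.pi) + Real.pi := by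
  have hpi := Real.pi_pos
  refine ⟨⌊θ / (2 * Real.pi)⌋, ?_⟩
  set m := ⌊θ / (2 * Real.pi)⌋ with hm
  have h1 : m * (2 * Real.pi) ≤ θ := by
    rw [← le_div_iff₀ (by positivity)]; exact Int.floor_le _
  have h2 : θ < (m + 1) * (2 * Real.pi) := by
    rw [← div_lt_iff₀ (by positivity)]; exact Int.lt_floor_add_one _
  have h3 : Real.sin (θ - m * (2 * Real.pi)) = Real.sin θ := Real.sin_sub_int_mul_two_pi θ m
  constructor
  · refine lt_of_le_of_ne h1 ?_
    intro he
    rw [← h3, he, sub_self, Real.sin_zero] at h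
    exact lt_irrefl _ h
  · by_contra! hle
    have h4 : 0 ≤ Real.sin (θ - m * (2 * Real.pi) - Real.pi) :=
      Real.sin_nonneg_of_nonneg_of_le_pi (by linarith) (by linarith)
    rw [Real.sin_sub_pi, h3] at h4
    linarith

section
variable {p : ℝ} {hp : 0 < p ∧ p < 1} {G : SX ≃ₜ SX} {g : YP p ≃ₜ YP p}

lemma sin_of_im {η : YP p} (h : 0 < (qY η : ℂ).im) : 0 < Real.sin (η : ℂ).im := by
  rw [qY_im] at h
  exact (mul_pos_iff_of_pos_left (Real.exp_pos _)).1 h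

lemma LY.pow_q (h : LY hp G g) (n : ℕ) (η : YP p) : qY ((g ^ n) η) = (G ^ n) (qY η) := by
  induction n generalizing η with
  | zero => simp
  | succ n ih => rw [pow_succ, Homeomorph.mul_apply, ih, h.q, pow_succ, Homeomorph.mul_apply]

lemma LY.far_pow (h : LY hp G g) (n : ℕ) : ∃ R : ℝ, ∀ η : YP p, R ≤ (qY η : ℂ).im →
    0 < (η : ℂ).im → (η : ℂ).im < Real.pi →
    0 < ((g ^ n) η : ℂ).im ∧ ((g ^ n) η : ℂ).im < Real.pi := by
  have hpi := Real.pi_pos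
  induction n with
  | zero => exact ⟨0, fun η _ h1 h2 => ⟨by simpa using h1, by simpa using h2⟩⟩
  | succ n ih =>
    obtain ⟨R, hR⟩ := ih
    obtain ⟨M, hM⟩ := h.far
    obtain ⟨C, hC⟩ := h.bd
    have hC0 : 0 ≤ C := (abs_nonneg _).trans (hC (qY ⟨_, xP_mem hp 0⟩))
    refine ⟨max (max R M) 1 + C, fun η hη h1 h2 => ?_⟩
    have hle1 : R ≤ max (max R M) 1 := (le_max_left _ _).trans (le_max_left _ _)
    have hle2 : M ≤ max (max R M) 1 := (le_max_right _ _).trans (le_max_left _ _)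
    have hle3 : 1 ≤ max (max R M) 1 := le_max_right _ _
    have hb := abs_le.1 (hC (qY η))
    rw [← h.q] at hb
    have hgR : R ≤ (qY (g η) : ℂ).im := by linarith
    have hg1 : 0 < (qY (g η) : ℂ).im := by linarith
    have hf := abs_lt.1 (hM η ((le_abs_self _).trans' (by linarith)))
    obtain ⟨m, m1, m2⟩ := sin_pos_sheet (sin_of_im hg1)
    have hm0 : m = 0 := by
      have a1 : m < 1 := by
        by_contra! hge
        have : (1 : ℝ) ≤ m := by exact_mod_cast hge
        nlinarith
      have a2 : -1 < m := by
        by_contra! hge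
        have : (m : ℝ) ≤ -1 := by exact_mod_cast hge
        nlinarith
      omega
    subst hm0
    rw [pow_succ, Homeomorph.mul_apply]
    exact hR _ hgR (by simpa using m1) (by simpa using m2)

lemma far_point (hp : 0 < p ∧ p < 1) (R : ℝ) :
    ∃ η : YP p, (η : ℂ).im = Real.pi / 2 ∧ R ≤ (qY η : ℂ).im := by
  have hm : (⟨Real.log (max R 1), Real.pi / 2⟩ : ℂ) ∈ YP p := by
    rw [mem_YP]
    simp [hp.1.le, hp.2.le]
  refine ⟨⟨_, hm⟩, rfl, ?_⟩
  rw [qY_im]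
  simp only [Real.sin_pi_div_two, mul_one]
  rw [Real.exp_log (lt_of_lt_of_le one_pos (le_max_right _ _))]
  exact le_max_left _ _

lemma LY.noM (h : LY hp G g) {n₀ : ℕ} (hR : Red G n₀) (n : ℕ) (hn : 2 ≤ n)
    (hc : Nat.Coprime n n₀) (η : YP p) (hη : (η : ℂ).im = -Real.pi) :
    ((g ^ n) η : ℂ).im ≠ Real.pi := by
  intro hg
  obtain ⟨ω, hω, hgω, -⟩ := (h.sys.pow n).line η _ Real.pi rfl hη hg
  have e1 : (DY hp).c ω = ((DY hp).T ^ (-1 : ℤ)) ω := by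
    apply Subtype.ext
    apply Complex.ext
    · rw [c_re, Tz_re]
    · rw [c_im, Tz_im, hω]; push_cast; ring
  rw [e1, (h.sys.pow n).apply_Tz] at hgω
  have h1 := congrArg ((DY hp).T ^ (1 : ℤ)) hgω
  rw [Tz_cancel] at h1
  have hre : (qY ω : ℂ).im = 0 := by rw [qY_im, hω, Real.sin_pi, mul_zero]
  have h2 : (G ^ n) (qY ω) = qY ω := by
    rw [← h.pow_q, h1, zpow_one, qY_T hp]
  obtain ⟨b, hb⟩ := hR.s3 _ hre n (by omega) hc 0 (by simpa using h2)
  have h3 := hR.sys.pow_Tz _ b hb n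
  have h4 : (DX.T ^ ((n : ℤ) * b)) (qY ω) = (DX.T ^ (0 : ℤ)) (qY ω) := by
    rw [← h3, h2]; simp
  have h5 := Tz_inj h4
  have hb0 : b = 0 := by
    rcases mul_eq_zero.1 h5 with h | h
    · omega
    · exact h
  subst hb0
  have h6 : qY (g ω) = qY ω := by rw [h.q, hb]; simp
  obtain ⟨j, hj⟩ := qY_eq hp h6
  have h7 := h.sys.pow_Tz ω j hj n
  rw [h1] at h7
  have h8 := Tz_inj h7
  have : (n : ℤ) ∣ 1 := ⟨j, h8⟩
  have := Int.le_of_dvd one_pos this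
  omega

lemma LY.height (h : LY hp G g) {n₀ : ℕ} (hR : Red G n₀) (n : ℕ) (hn : 2 ≤ n)
    (hc : Nat.Coprime n n₀) (ξ : YP p) (hξ : (ξ : ℂ).im ≤ Real.pi) :
    ((g ^ n) ξ : ℂ).im < 3 * Real.pi := by
  have hpi := Real.pi_pos
  have hS := h.sys.pow n
  have hline : ∀ u : YP p, (u : ℂ).im = -Real.pi → ((g ^ n) u : ℂ).im < Real.pi := by
    intro u hu
    by_contra! hge
    have hall : ∀ w : YP p, (w : ℂ).im = -Real.pi → Real.pi < ((g ^ n) w : ℂ).im := by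
      intro w hw
      by_contra! hle
      have hoc := im_ordConn {-Real.pi} Set.ordConnected_singleton (g ^ n) (g ^ n).continuous
        (DY hp)
      obtain ⟨x, hx, hx1⟩ := hoc.out ⟨w, hw, rfl⟩ ⟨u, hu, rfl⟩ ⟨hle, hge⟩
      exact h.noM hR n hn hc x hx hx1
    obtain ⟨R, hRR⟩ := h.far_pow n
    obtain ⟨η, e1, e2⟩ := far_point hp R
    have := hRR η e2 (by rw [e1]; linarith) (by rw [e1]; linarith)
    have := hS.hs_up (-Real.pi) Real.pi 0 (by simp) hall η (by rw [e1]; linarith)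
    linarith
  have h2 := hS.hs_down (-Real.pi) Real.pi 0 (by simp) hline (((DY hp).T ^ (-1 : ℤ)) ξ)
    (by rw [Tz_im]; push_cast; linarith)
  rw [hS.apply_Tz, Tz_im] at h2
  push_cast at h2
  linarith

lemma sigma_conn (hp : 0 < p ∧ p < 1) : IsPreconnected
    {η : YP p | 1 ≤ (qY η : ℂ).im ∧ 0 < (η : ℂ).im ∧ (η : ℂ).im < Real.pi} := by
  apply preconn_sub
  have hC : IsPreconnected (Complex.reLm ⁻¹' (Set.Icc 0 1) ∩ Complex.imLm ⁻¹' (Set.Ici 1)) :=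
    (((convex_Icc (0 : ℝ) 1).linear_preimage _).inter
        ((convex_Ici 1).linear_preimage _)).isPreconnected
  have him : ∀ w : ℂ, 1 ≤ w.im → 0 < (w - p).im := fun w hw => by
    simp; linarith
  have hI := hC.image (fun w => Complex.log (w - p)) (by
    intro w hw
    have hw2 : 1 ≤ w.im := hw.2
    apply ContinuousAt.continuousWithinAt
    refine ContinuousAt.clog (by fun_prop) ?_
    exact Or.inr (him w hw2).ne')
  convert hI using 1
  ext η
  constructor
  · rintro ⟨η, ⟨h1, h2, h3⟩, rfl⟩
    refine ⟨qY η, ⟨η.2, h1⟩, ?_⟩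
    simp only [qY_coe, add_sub_cancel_left]
    exact Complex.log_exp (by linarith [Real.pi_pos]) h3.le
  · rintro ⟨w, ⟨h1, h2⟩, rfl⟩
    have h2' : 1 ≤ w.im := h2
    have hw := him w h2'
    have hw0 : w - p ≠ 0 := by intro h; rw [h] at hw; simp at hw
    have he : (p : ℂ) + Complex.exp (Complex.log (w - p)) = w := by
      rw [Complex.exp_log hw0]; ring
    have hmem : Complex.log (w - p) ∈ YP p := by
      show (p : ℂ) + Complex.exp (Complex.log (w - p)) ∈ SX
      rw [he]; exact h1
    refine ⟨⟨_, hmem⟩, ⟨?_, ?_, ?_⟩, rfl⟩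
    · rw [qY_coe, he]; exact h2
    · show 0 < (Complex.log (w - p)).im
      rw [Complex.log_im]
      refine lt_of_le_of_ne (Complex.arg_nonneg_iff.2 hw.le) ?_
      intro h0
      have := (Complex.arg_eq_zero_iff.1 h0.symm).2
      exact hw.ne' this
    · show (Complex.log (w - p)).im < Real.pi
      rw [Complex.log_im]
      refine lt_of_le_of_ne (Complex.arg_le_pi _) ?_
      intro h0
      have := (Complex.arg_eq_pi_iff.1 h0).2
      exact hw.ne' this

lemma LY.sigma (h : LY hp G g) {n₀ : ℕ} (hR : Red G n₀) (n : ℕ) (hn : 2 ≤ n)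
    (hc : Nat.Coprime n n₀) (m : ℤ) (η : YP p) (hq : 1 ≤ (qY η : ℂ).im)
    (h1 : m * (2 * Real.pi) < (η : ℂ).im) (h2 : (η : ℂ).im < m * (2 * Real.pi) + Real.pi) :
    m * (2 * Real.pi) < ((g ^ n) η : ℂ).im ∧
      ((g ^ n) η : ℂ).im < m * (2 * Real.pi) + Real.pi := by
  have hpi := Real.pi_pos
  have hS := h.sys.pow n
  have hqz : ∀ m : ℤ, ∀ η : YP p, qY (((DY hp).T ^ m) η) = qY η := by
    intro m η
    apply Subtype.ext
    simp only [qY_coe, Tzpow_coe]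
    congr 1
    rw [Complex.exp_eq_exp_iff_exists_int]
    exact ⟨m, by push_cast; ring⟩
  have hpos : ∀ η : YP p, 1 ≤ (qY η : ℂ).im → 0 < (qY ((g ^ n) η) : ℂ).im := by
    intro η hη
    have := hR.u_up n hn hc ((DX.T ^ (-1 : ℤ)) (qY η)) (by rw [Tz_im]; push_cast; linarith)
    rw [(hR.sys.pow n).apply_Tz, Tz_im, ← h.pow_q] at this
    push_cast at this
    linarith
  have hoc : ((fun η : YP p => ((g ^ n) η : ℂ).im) ''
      {η : YP p | 1 ≤ (qY η : ℂ).im ∧ 0 < (η : ℂ).im ∧ (η : ℂ).im < Real.pi}).OrdConnected :=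
    ((sigma_conn hp).image _ (by fun_prop)).ordConnected
  obtain ⟨R, hRR⟩ := h.far_pow n
  obtain ⟨ζ, e1, e2⟩ := far_point hp (max R 1)
  have hζm : ζ ∈ {η : YP p | 1 ≤ (qY η : ℂ).im ∧ 0 < (η : ℂ).im ∧ (η : ℂ).im < Real.pi} :=
    ⟨(le_max_right _ _).trans e2, by rw [e1]; linarith, by rw [e1]; linarith⟩
  obtain ⟨z1, z2⟩ := hRR ζ ((le_max_left _ _).trans e2) hζm.2.1 hζm.2.2
  have key : ∀ η : YP p, 1 ≤ (qY η : ℂ).im → 0 < (η : ℂ).im → (η : ℂ).im < Real.pi →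
      0 < ((g ^ n) η : ℂ).im ∧ ((g ^ n) η : ℂ).im < Real.pi := by
    intro η a1 a2 a3
    constructor
    · by_contra! hle
      obtain ⟨x, hx, hx1⟩ := hoc.out ⟨η, ⟨a1, a2, a3⟩, rfl⟩ ⟨ζ, hζm, rfl⟩ ⟨hle, z1.le⟩
      have := sin_of_im (hpos x hx.1)
      simp only at hx1
      rw [hx1, Real.sin_zero] at this
      exact lt_irrefl _ this
    · by_contra! hle
      obtain ⟨x, hx, hx1⟩ := hoc.out ⟨ζ, hζm, rfl⟩ ⟨η, ⟨a1, a2, a3⟩, rfl⟩ ⟨z2.le, hle⟩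
      have := sin_of_im (hpos x hx.1)
      simp only at hx1
      rw [hx1, Real.sin_pi] at this
      exact lt_irrefl _ this
  have := key (((DY hp).T ^ (-m)) η) (by rw [hqz]; exact hq)
    (by rw [Tz_im]; push_cast; linarith) (by rw [Tz_im]; push_cast; linarith)
  rw [hS.apply_Tz, Tz_im] at this
  push_cast at this
  constructor <;> linarith [this.1, this.2]

lemma LY.bounds (h : LY hp G g) {n₀ : ℕ} (hR : Red G n₀) (n : ℕ) (hn : 2 ≤ n)
    (hc : Nat.Coprime n n₀) (η : YP p) (h1 : 0 < (η : ℂ).im)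
    (h2 : (((g ^ n)⁻¹ η : YP p) : ℂ).im < 0) :
    (η : ℂ).im < 3 * Real.pi ∧ (qY η : ℂ).im < 1 ∧ -1 < (qY η : ℂ).im := by
  have hpi := Real.pi_pos
  refine ⟨?_, ?_, ?_⟩
  · have := h.height hR n hn hc ((g ^ n)⁻¹ η) (by linarith)
    have e : (g ^ n) ((g ^ n)⁻¹ η) = η := (g ^ n).apply_symm_apply η
    rwa [e] at this
  · by_contra! hge
    obtain ⟨m, m1, m2⟩ := sin_pos_sheet (sin_of_im (p := p) (η := η) (by linarith))
    have hm : 0 ≤ m := by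
      by_contra! hlt
      have : m ≤ -1 := by omega
      have : (m : ℝ) ≤ -1 := by exact_mod_cast this
      nlinarith
    have := (h.inv.sigma hR.inv n hn hc m η hge m1 m2).1
    rw [inv_pow] at this
    have hm' : (0 : ℝ) ≤ m := by exact_mod_cast hm
    nlinarith
  · by_contra! hle
    have hcq : 1 ≤ (qY ((DY hp).c η) : ℂ).im := by rw [qY_c hp, c_im]; linarith
    obtain ⟨m, m1, m2⟩ := sin_pos_sheet (sin_of_im (p := p) (η := (DY hp).c η) (by linarith))
    have := (h.sigma hR n hn hc m _ hcq m1 m2).2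
    rw [(h.sys.pow n).inv_apply, c_im] at h2
    rw [c_im] at m1
    have hm : m ≤ -1 := by
      by_contra! hlt
      have : 0 ≤ m := by omega
      have : (0 : ℝ) ≤ m := by exact_mod_cast this
      nlinarith
    have : (m : ℝ) ≤ -1 := by exact_mod_cast hm
    nlinarith

lemma LY.hne (h : LY hp G g)
    (hno : ∀ u : SX, (u : ℂ).im = 0 → p < (u : ℂ).re → (u : ℂ).re < 1 → G u ≠ u)
    (η : YP p) (hη : (η : ℂ).im = 0) (e1 : (qY η : ℂ).re < 1) : (g η : ℂ).im ≠ 0 := by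
  intro hG
  obtain ⟨ω, hω, hg, hr⟩ := h.sys.line η _ 0 rfl (by simp [hη]) hG
  rw [c_real hω] at hg
  have hqω : (qY ω : ℂ).im = 0 := by rw [qY_im, hω]; simp
  have hGω : G (qY ω) = qY ω := by rw [← h.q, hg]
  have hω1 : 1 ≤ (qY ω : ℂ).re := by
    by_contra! hlt
    refine hno _ hqω ?_ hlt hGω
    rw [qY_re_real _ hω]
    linarith [Real.exp_pos (ω : ℂ).re]
  have hg1 : (qY (g η) : ℂ).re ≤ 1 := (g η).2.2
  rw [qY_re_real _ hω] at hω1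
  rw [qY_re_real _ hG] at hg1
  rw [qY_re_real _ hη] at e1
  have c1 : (g η : ℂ).re ≤ (ω : ℂ).re := Real.exp_le_exp.1 (by linarith)
  have c2 : (η : ℂ).re < (ω : ℂ).re := Real.exp_lt_exp.1 (by linarith)
  have h5 : (ω : ℂ).re = (g η : ℂ).re := by
    rcases Set.mem_uIcc.1 hr with ⟨k1, k2⟩ | ⟨k1, k2⟩
    · linarith
    · linarith
  have h6 : ω = g η := by
    apply Subtype.ext; apply Complex.ext
    · exact h5
    · rw [hω, hG]
  rw [← hg] at h6
  have h7 := g.injective h6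
  rw [h7] at c2
  exact lt_irrefl _ c2

lemma LY.caseA_pos (h : LY hp G g) {n₀ : ℕ} (hR : Red G n₀) (hn₀ : 1 ≤ n₀) (μ : Measure AnnC)
    (hfin : μ Set.univ < ⊤)
    (hpos : ∀ U : Set AnnC, IsOpen U → U.Nonempty → 0 < μ U) (f : AnnC → AnnC)
    (hf : MeasurePreserving f μ μ) (hpr : ∀ w, prX (G w) = f (prX w))
    (hno : ∀ u : SX, (u : ℂ).im = 0 → p < (u : ℂ).re → (u : ℂ).re < 1 → G u ≠ u)
    (η₀ : YP p) (hη₀ : (η₀ : ℂ).im = 0) (h1 : (qY η₀ : ℂ).re < 1)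
    (hgp : 0 < (g η₀ : ℂ).im) : False := by
  classical
  have hpi := Real.pi_pos
  refine h.sys.core μ hfin hpos (fun η => prX (qY η)) (prX_open.comp qY_open) f hf
    (fun η => by rw [h.q, hpr])
    (fun η => (decide (0 ≤ (qY η : ℂ).im), decide ((η : ℂ).im < 2 * Real.pi)))
    {η : YP p | (η : ℂ).im = 0 ∧ (qY η : ℂ).re < 1} (fun _ h => h.1) ?_ ?_ ?_ ?_
    η₀ ⟨hη₀, h1⟩ hgp ?_
  · apply preconn_sub
    have : (Subtype.val '' {η : YP p | (η : ℂ).im = 0 ∧ (qY η : ℂ).re < 1}) =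
        Complex.reLm ⁻¹' (Set.Iio (Real.log (1 - p))) ∩ Complex.imLm ⁻¹' {0} := by
      ext w
      constructor
      · rintro ⟨η, hη, rfl⟩
        refine ⟨?_, hη.1⟩
        have := hη.2
        rw [qY_re_real _ hη.1] at this
        show (η : ℂ).re < _
        rw [Real.lt_log_iff_exp_lt (by linarith [hp.2])]
        linarith
      · rintro ⟨h1, h2⟩
        have h1' : w.re < Real.log (1 - p) := h1
        have h2' : w.im = 0 := h2
        rw [Real.lt_log_iff_exp_lt (by linarith [hp.2])] at h1'
        have hm : w ∈ YP p := by
          rw [mem_YP, h2', Real.cos_zero, mul_one]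
          constructor <;> linarith [hp.1, Real.exp_pos w.re]
        refine ⟨⟨w, hm⟩, ⟨h2', ?_⟩, rfl⟩
        rw [qY_re_real _ h2']
        show p + Real.exp w.re < 1
        linarith
    rw [this]
    exact (((convex_Iio _).linear_preimage _).inter
      ((convex_singleton _).linear_preimage _)).isPreconnected
  · intro η hη
    rw [Metric.mem_closure_iff]
    intro ε hε
    have hm : (⟨(η : ℂ).re - ε / 2, (η : ℂ).im⟩ : ℂ) ∈ YP p :=
      YP_left hp (x := (η : ℂ).re) η.2 (by linarith)
    refine ⟨⟨_, hm⟩, ⟨hη, ?_⟩, ?_⟩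
    · rw [qY_re_real ⟨_, hm⟩ hη]
      show p + Real.exp ((η : ℂ).re - ε / 2) < 1
      have h2 : (qY η : ℂ).re ≤ 1 := η.2.2
      rw [qY_re_real _ hη] at h2
      have : Real.exp ((η : ℂ).re - ε / 2) < Real.exp (η : ℂ).re :=
        Real.exp_lt_exp.2 (by linarith)
      linarith
    · rw [Subtype.dist_eq, Complex.dist_eq]
      have : (η : ℂ) - (⟨(η : ℂ).re - ε / 2, (η : ℂ).im⟩ : ℂ) = ((ε / 2 : ℝ) : ℂ) := by
        apply Complex.ext <;> simp
      rw [this, Complex.norm_real, Real.norm_eq_abs, abs_of_pos (by linarith)]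
      linarith
  · intro η hη
    rw [Metric.mem_closure_iff]
    intro ε hε
    obtain ⟨d, hd0, hd1, hd2⟩ : ∃ d : ℝ, 0 < d ∧ d < ε ∧ d ≤ Real.pi / 2 :=
      ⟨min (ε / 2) (Real.pi / 2), by positivity,
        (min_le_left _ _).trans_lt (by linarith), min_le_right _ _⟩
    have hm : (⟨(η : ℂ).re, d⟩ : ℂ) ∈ YP p := by
      have h2 := mem_YP.1 η.2
      rw [hη, Real.cos_zero, mul_one] at h2
      rw [mem_YP]
      simp only
      have c1 := Real.cos_le_one d
      have c0 : 0 ≤ Real.cos d := Real.cos_nonneg_of_mem_Icc ⟨by linarith, hd2⟩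
      have ep := Real.exp_pos (η : ℂ).re
      constructor
      · have := mul_nonneg ep.le c0
        linarith [hp.1]
      · nlinarith [h2.2]
    refine ⟨⟨_, hm⟩, hd0, ?_⟩
    rw [Subtype.dist_eq, Complex.dist_eq]
    have : (η : ℂ) - (⟨(η : ℂ).re, d⟩ : ℂ) = ((-d : ℝ) : ℂ) * Complex.I := by
      apply Complex.ext <;> simp [hη]
    rw [this, norm_mul, Complex.norm_I, mul_one, Complex.norm_real, Real.norm_eq_abs, abs_neg,
      abs_of_pos hd0]
    exact hd1
  · rintro η ⟨hη, e1⟩ hG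
    exact h.hne hno η hη e1 hG
  · intro N
    obtain ⟨n, hnN, hn2, hnc⟩ := Red.coprime_ex n₀ hn₀ N
    refine ⟨n, hnN, ?_⟩
    intro η η' hpη hcode a1 a2 b1 b2
    obtain ⟨a3, a4, a5⟩ := h.bounds hR n hn2 hnc η a1 a2
    obtain ⟨b3, b4, b5⟩ := h.bounds hR n hn2 hnc η' b1 b2
    rw [Prod.mk.injEq] at hcode
    obtain ⟨d1, d2⟩ := hcode
    rw [decide_eq_decide] at d1 d2
    have hq : qY η = qY η' := by
      obtain ⟨m, hm⟩ := prX_eq hpη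
      have hmi := congrArg (fun w : SX => (w : ℂ).im) hm
      simp only [Tz_im, mul_one] at hmi
      have m1 : (m : ℝ) < 1 := by
        by_cases hh : 0 ≤ (qY η : ℂ).im
        · linarith [d1.1 hh]
        · have := mt d1.2 hh
          linarith
      have m2 : (-1 : ℝ) < m := by
        by_cases hh : 0 ≤ (qY η : ℂ).im
        · linarith [d1.1 hh]
        · have := mt d1.2 hh
          linarith
      have m1' : m < 1 := by exact_mod_cast m1
      have m2' : -1 < m := by exact_mod_cast m2
      have : m = 0 := by omega
      subst this
      simpa using hm
    obtain ⟨m, hm⟩ := qY_eq hp hq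
    have hmi := congrArg (fun w : YP p => (w : ℂ).im) hm
    simp only [Tz_im] at hmi
    have m1 : m < 1 := by
      by_contra! hge
      have : (1 : ℝ) ≤ m := by exact_mod_cast hge
      by_cases hh : (η : ℂ).im < 2 * Real.pi
      · nlinarith [d2.1 hh]
      · have := mt d2.2 hh
        nlinarith
    have m2 : -1 < m := by
      by_contra! hge
      have : (m : ℝ) ≤ -1 := by exact_mod_cast hge
      by_cases hh : (η : ℂ).im < 2 * Real.pi
      · nlinarith [d2.1 hh]
      · have := mt d2.2 hh
        nlinarith
    have : m = 0 := by omega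
    subst this
    simpa using hm

end

end

section

open Dom

lemma Red.combine {G : SX ≃ₜ SX} {n₀ : ℕ} (hR : Red G n₀) (hn₀ : 1 ≤ n₀) (μ : Measure AnnC)
    (hfin : μ Set.univ < ⊤)
    (hpos : ∀ U : Set AnnC, IsOpen U → U.Nonempty → 0 < μ U) (f : AnnC ≃ₜ AnnC)
    (hf : MeasurePreserving f μ μ) (hpr : ∀ w, prX (G w) = f (prX w))
    (hfs : {u : SX | (u : ℂ).im = 0 ∧ G u = u}.Finite) : False := by
  have hfi : MeasurePreserving f.symm μ μ := MeasurePreserving.symm f.toMeasurableEquiv hf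
  have hpri : ∀ w, prX (G⁻¹ w) = f.symm (prX w) := by
    intro w
    rw [Homeomorph.eq_symm_apply, ← hpr]
    congr 1
    exact G.apply_symm_apply w
  by_cases hno : ∀ u : SX, (u : ℂ).im = 0 → 0 < (u : ℂ).re → (u : ℂ).re < 1 → G u ≠ u
  · have hm : (⟨1 / 2, 0⟩ : ℂ) ∈ SX := ⟨by norm_num, by norm_num⟩
    have h0 : (0 : ℝ) < ((⟨_, hm⟩ : SX) : ℂ).re := by show (0 : ℝ) < 1 / 2; norm_num
    have h1 : ((⟨_, hm⟩ : SX) : ℂ).re < 1 := by show (1 / 2 : ℝ) < 1; norm_num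
    have hne := hR.hne hno ⟨_, hm⟩ rfl h0 h1
    rcases lt_or_gt_of_ne hne with hlt | hgt
    · refine hR.inv.caseB_pos hn₀ μ hfin hpos f.symm hfi hpri ?_ ⟨_, hm⟩ rfl h0 h1 ?_
      · intro u a b c d
        exact hno u a b c (inv_fix.1 d).symm
      · rw [hR.sys.inv_im_real rfl]; linarith
    · exact hR.caseB_pos hn₀ μ hfin hpos f hf hpr hno ⟨_, hm⟩ rfl h0 h1 hgt
  · push Not at hno
    have hfs2 : {u : SX | (u : ℂ).im = 0 ∧ 0 < (u : ℂ).re ∧ (u : ℂ).re < 1 ∧ G u = u}.Finite :=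
      hfs.subset (fun u hu => ⟨hu.1, hu.2.2.2⟩)
    obtain ⟨P, hPm, hPmax⟩ := Set.exists_max_image _ (fun u : SX => (u : ℂ).re) hfs2 hno
    obtain ⟨p, hpdef⟩ : ∃ p : ℝ, p = (P : ℂ).re := ⟨_, rfl⟩
    have hp : 0 < p ∧ p < 1 := by rw [hpdef]; exact ⟨hPm.2.1, hPm.2.2.1⟩
    have hno' : ∀ u : SX, (u : ℂ).im = 0 → p < (u : ℂ).re → (u : ℂ).re < 1 → G u ≠ u := by
      intro u a b c d
      have := hPmax u ⟨a, hp.1.trans b, c, d⟩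
      linarith
    obtain ⟨g, hg⟩ := LY_exists hp G hR.sys P
      (Complex.ext (by simp [hpdef]) (by simp [hPm.1])) hPm.2.2.2
    have hm : (⟨xP p - 1, 0⟩ : ℂ) ∈ YP p := YP_left hp (xP_mem hp 0) (by linarith)
    have h1 : (qY (⟨_, hm⟩ : YP p) : ℂ).re < 1 := by
      have a1 := (qY (⟨_, xP_mem hp 0⟩ : YP p)).2.2
      rw [qY_re_real (⟨_, xP_mem hp 0⟩ : YP p) rfl] at a1
      rw [qY_re_real (⟨_, hm⟩ : YP p) rfl]
      have : Real.exp (xP p - 1) < Real.exp (xP p) := Real.exp_lt_exp.2 (by linarith)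
      have a2 : p + Real.exp (xP p) ≤ 1 := a1
      show p + Real.exp (xP p - 1) < 1
      linarith
    have hne := hg.hne hno' ⟨_, hm⟩ rfl h1
    rcases lt_or_gt_of_ne hne with hlt | hgt
    · refine hg.inv.caseA_pos hR.inv hn₀ μ hfin hpos f.symm hfi hpri ?_ ⟨_, hm⟩ rfl h1 ?_
      · intro u a b c d
        exact hno' u a b c (inv_fix.1 d).symm
      · rw [hg.sys.inv_im_real rfl]; linarith
    · exact hg.caseA_pos hR hn₀ μ hfin hpos f hf hpr hno' ⟨_, hm⟩ rfl h1 hgt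

lemma homeo_pow_apply {X : Type*} [TopologicalSpace X] (f : X ≃ₜ X) (n : ℕ) (x : X) :
    (f ^ n) x = (⇑f)^[n] x := by
  induction n generalizing x with
  | zero => simp
  | succ n ih => rw [pow_succ, Homeomorph.mul_apply, ih, Function.iterate_succ_apply]

lemma prX_pow {F : SX ≃ₜ SX} {f : AnnC → AnnC} (hF : ∀ w, prX (F w) = f (prX w)) (n : ℕ) (w : SX) :
    prX ((F ^ n) w) = f^[n] (prX w) := by
  induction n generalizing w with
  | zero => simp
  | succ n ih => rw [pow_succ, Homeomorph.mul_apply, ih, hF, Function.iterate_succ_apply]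

lemma final_thm (f : AnnC ≃ₜ AnnC)
    (hiso : IsotopicToIdC f) (harea : PreservesFiniteAreaC f)
    (hrev : ∀ z, f (RC z) = RC (f.symm z))
    (k n₀ : ℕ) (hk : 1 ≤ k) (hn₀ : 1 ≤ n₀) (hcop : Nat.gcd k n₀ = 1)
    (z : AnnC) (hz : (⇑f)^[k] z = z) :
    {w : AnnC | 0 < Function.minimalPeriod (⇑f) w ∧
      Nat.Coprime (Function.minimalPeriod (⇑f) w) n₀ ∧
      (∃ j : ℕ, RC w = (⇑f)^[j] w)}.Infinite := by
  intro hS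
  obtain ⟨μ, hfin, -, hpos, hf⟩ := harea
  obtain ⟨K, hKk, hKc, hK1, hKS⟩ : ∃ K : ℕ, k ∣ K ∧ Nat.Coprime K n₀ ∧ 1 ≤ K ∧
      ∀ w ∈ {w : AnnC | 0 < Function.minimalPeriod (⇑f) w ∧
      Nat.Coprime (Function.minimalPeriod (⇑f) w) n₀ ∧
      (∃ j : ℕ, RC w = (⇑f)^[j] w)}, Function.minimalPeriod (⇑f) w ∣ K := by
    refine ⟨k * ∏ w ∈ hS.toFinset, Function.minimalPeriod (⇑f) w, Dvd.intro _ rfl, ?_, ?_, ?_⟩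
    · refine Nat.Coprime.mul_left hcop (Nat.Coprime.prod_left ?_)
      intro w hw
      exact ((hS.mem_toFinset).1 hw).2.1
    · refine Nat.mul_pos hk (Finset.prod_pos ?_)
      intro w hw
      exact ((hS.mem_toFinset).1 hw).1
    · intro w hw
      exact (Finset.dvd_prod_of_mem _ (hS.mem_toFinset.2 hw)).mul_left _
  obtain ⟨F, hFs, hF⟩ := lift_exists f hiso hrev
  obtain ⟨zt, rfl⟩ := prX_surj z
  have hzK : (⇑f)^[K] (prX zt) = prX zt := by
    have : Function.IsPeriodicPt f k (prX zt) := hz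
    exact this.trans_dvd hKk
  obtain ⟨a, ha⟩ := prX_eq (w := (F ^ K) zt) (w' := zt) (by rw [prX_pow hF, hzK])
  have hGpr : ∀ w, prX ((DX.T ^ (-a) * F ^ K) w) = (⇑f)^[K] (prX w) := by
    intro w
    rw [Homeomorph.mul_apply, prX_T, prX_pow hF]
  have hgood : ∀ u : SX, (u : ℂ).im = 0 → ∀ n : ℕ, 1 ≤ n → Nat.Coprime n n₀ →
      (⇑f)^[n] (prX u) = prX u → prX u ∈ {w : AnnC | 0 < Function.minimalPeriod (⇑f) w ∧
      Nat.Coprime (Function.minimalPeriod (⇑f) w) n₀ ∧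
      (∃ j : ℕ, RC w = (⇑f)^[j] w)} := by
    intro u hu n hn hc hper
    have hP : Function.IsPeriodicPt f n (prX u) := hper
    refine ⟨hP.minimalPeriod_pos hn, hc.coprime_dvd_left hP.minimalPeriod_dvd, 0, ?_⟩
    rw [← prX_c, c_real hu]; rfl
  have hRed : Red (DX.T ^ (-a) * F ^ K) n₀ := by
    refine ⟨(hFs.pow K).Tmul _, ⟨zt, ?_⟩, ?_⟩
    · rw [Homeomorph.mul_apply, ha, ← Homeomorph.mul_apply, ← zpow_add]; simp
    · intro u hu n hn hc m hm
      have h1 := prX_pow hGpr n u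
      rw [hm, prX_T, ← Function.iterate_mul] at h1
      have h2 := hgood u hu (K * n) (Nat.mul_pos hK1 hn) (Nat.Coprime.mul_left hKc hc) h1.symm
      have h3 : (⇑f)^[K] (prX u) = prX u :=
        (Function.isPeriodicPt_minimalPeriod f (prX u)).trans_dvd (hKS _ h2)
      exact prX_eq (by rw [hGpr, h3])
  refine hRed.combine hn₀ μ hfin hpos (f ^ K) ?_ ?_ ?_
  · have : (⇑(f ^ K) : AnnC → AnnC) = (⇑f)^[K] := funext (homeo_pow_apply f K)
    rw [this]
    exact hf.iterate K
  · intro w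
    rw [hGpr, homeo_pow_apply]
  · refine Set.Finite.of_finite_image (f := prX) (hS.subset ?_) ?_
    · rintro _ ⟨u, ⟨hu, hG⟩, rfl⟩
      refine hgood u hu K hK1 hKc ?_
      rw [← hGpr, hG]
    · rintro u ⟨hu, -⟩ v ⟨hv, -⟩ huv
      have h3 := congrArg (fun p : AnnC => (p.2 : ℝ)) huv
      simp only [prX] at h3
      apply Subtype.ext
      apply Complex.ext
      · exact h3
      · rw [hu, hv]

end

/-- Refinement of Franks' theorem for reversible maps (closed annulus): if a
reversible area-preserving homeomorphism of the closed annulus isotopic to the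
identity has a `k`-periodic point with `gcd(k, n₀) = 1`, then it has infinitely
many symmetric periodic points whose minimal period is coprime to `n₀`. -/
theorem franks_reversible_refinement_closed (f : AnnC ≃ₜ AnnC)
    (hiso : IsotopicToIdC f) (harea : PreservesFiniteAreaC f)
    (hrev : ∀ z, f (RC z) = RC (f.symm z))
    (k n₀ : ℕ) (hk : 1 ≤ k) (hn₀ : 1 ≤ n₀) (hcop : Nat.gcd k n₀ = 1)
    (z : AnnC) (hz : (⇑f)^[k] z = z) :
    {w : AnnC | 0 < Function.minimalPeriod (⇑f) w ∧
      Nat.Coprime (Function.minimalPeriod (⇑f) w) n₀ ∧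
      (∃ j : ℕ, RC w = (⇑f)^[j] w)}.Infinite := by
  exact final_thm f hiso harea hrev k n₀ hk hn₀ hcop z hz
end
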